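/- arXiv:1307.3851 — 6 statements merged into one kernel-verified Lean document; each statement's English description precedes it below -/
import Mathlib

section
/- Let m ≥ 3 and let χ be a nontrivial primitive Dirichlet character mod m. Then the completed L-function Λ(χ,s), defined for Re s > 1 by Λ(χ,s) = (m/π)^{s/2} Γ((s+q)/2) ∏_{p prime, p ∤ m} (1 − χ(p) p^{−s})^{−1}, extends to an entire holomorphic function on ℂ. -/
open Complex

/-- The Euler product of a Dirichlet `L`-function, restricted to the primes not dividing the
level. -/
lemma DirichletCharacter.tprod_primes_not_dvd_eq_LFunction {m : ℕ} [NeZero m]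
    (χ : DirichletCharacter ℂ m) {s : ℂ} (hs : 1 < s.re) :
    ∏' p : {p : Nat.Primes // ¬ (p : ℕ) ∣ m},
      (1 - χ ((p : ℕ) : ZMod m) * (p : ℕ) ^ (-s))⁻¹ = χ.LFunction s := by
  rw [χ.LFunction_eq_LSeries hs, ← χ.LSeries_eulerProduct_tprod hs]
  refine tprod_subtype_eq_of_mulSupport_subset (s := {p : Nat.Primes | ¬ (p : ℕ) ∣ m})
    (f := fun p : Nat.Primes ↦ (1 - χ ((p : ℕ) : ZMod m) * (p : ℕ) ^ (-s))⁻¹) fun p hp hpm ↦ hp ?_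
  have : ¬ IsUnit ((p : ℕ) : ZMod m) := by rwa [ZMod.isUnit_prime_iff_not_dvd p.prop, not_not]
  simp [χ.map_nonunit this]

/-- The gamma factor of a Dirichlet character of parity `q`. -/
lemma DirichletCharacter.gammaFactor_eq_Gammaℝ_add {m : ℕ} (χ : DirichletCharacter ℂ m)
    {q : ℕ} (hq : q = 0 ∨ q = 1) (hχq : χ (-1) = (-1) ^ q) (s : ℂ) :
    χ.gammaFactor s = Gammaℝ (s + q) := by
  rcases hq with rfl | rfl
  · have : χ.Even := by simpa [DirichletCharacter.Even] using hχq
    simp [this.gammaFactor_def]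
  · have : χ.Odd := by simpa [DirichletCharacter.Odd] using hχq
    simp [this.gammaFactor_def]

/-- The archimedean factor normalised with `(m / π) ^ (s / 2)`, in terms of `Gammaℝ`. -/
lemma natCast_div_pi_cpow_mul_Gamma (m q : ℕ) (s : ℂ) :
    ((m : ℂ) / (Real.pi : ℂ)) ^ (s / 2) * Gamma ((s + q) / 2) =
      (m : ℂ) ^ (s / 2) * (Real.pi : ℂ) ^ ((q : ℂ) / 2) * Gammaℝ (s + q) := by
  have hπ : (Real.pi : ℂ) ≠ 0 := ofReal_ne_zero.mpr Real.pi_ne_zero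
  have hdiv : ((m : ℂ) / (Real.pi : ℂ)) ^ (s / 2) =
      (m : ℂ) ^ (s / 2) * (Real.pi : ℂ) ^ (-(s / 2)) := by
    rw [div_eq_mul_inv, ← ofReal_natCast, ← ofReal_inv,
      mul_cpow_ofReal_nonneg m.cast_nonneg (inv_nonneg.mpr Real.pi_pos.le), ofReal_inv,
      inv_cpow _ _ (by rw [arg_ofReal_of_nonneg Real.pi_pos.le]; exact Real.pi_ne_zero.symm),
      cpow_neg]
  have hadd : (Real.pi : ℂ) ^ (-(s / 2)) =
      (Real.pi : ℂ) ^ ((q : ℂ) / 2) * (Real.pi : ℂ) ^ (-(s + q) / 2) := by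
    rw [← cpow_add _ _ hπ]
    congr 1
    ring
  rw [hdiv, hadd, Gammaℝ_def]
  ring

/-- Let `m ≥ 3` and `χ` a nontrivial primitive Dirichlet character mod `m`, with
`χ(−1) = (−1)^q`, `q ∈ {0,1}`. Then the completed L-function, defined for `Re s > 1` by
`Λ(χ,s) = (m/π)^{s/2} Γ((s+q)/2) ∏_{p prime, p ∤ m} (1 − χ(p) p^{−s})⁻¹`,
extends to an entire holomorphic function on `ℂ`. -/
theorem statement2 (m : ℕ) (hm : 3 ≤ m) (χ : DirichletCharacter ℂ m)
    (hχ : χ ≠ 1) (hχprim : χ.IsPrimitive)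
    (q : ℕ) (hq : q = 0 ∨ q = 1) (hχq : χ (-1) = (-1) ^ q) :
    ∃ Λ : ℂ → ℂ, Differentiable ℂ Λ ∧
      ∀ s : ℂ, 1 < s.re →
        Λ s = ((m : ℂ) / (Real.pi : ℂ)) ^ (s / 2) * Complex.Gamma ((s + q) / 2) *
          ∏' p : {p : Nat.Primes // ¬ (p : ℕ) ∣ m},
            (1 - χ ((p : ℕ) : ZMod m) * (p : ℕ) ^ (-s))⁻¹ := by
  have : NeZero m := ⟨by omega⟩
  refine ⟨fun s ↦ (m : ℂ) ^ (s / 2) * (Real.pi : ℂ) ^ ((q : ℂ) / 2) * χ.completedLFunction s,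
    ?_, fun s hs ↦ ?_⟩
  · have hΛ := DirichletCharacter.differentiable_completedLFunction hχ
    have hm0 : (m : ℂ) ≠ 0 := NeZero.ne _
    exact (((differentiable_id.div_const 2).const_cpow (.inl hm0)).mul_const _).mul hΛ
  · have hΓ : Gammaℝ (s + q) ≠ 0 := Gammaℝ_ne_zero_of_re_pos <| by
      rw [add_re, natCast_re]
      linarith [q.cast_nonneg (α := ℝ)]
    rw [χ.tprod_primes_not_dvd_eq_LFunction hs, natCast_div_pi_cpow_mul_Gamma,
      χ.LFunction_eq_completed_div_gammaFactor s (.inr (by omega)),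
      χ.gammaFactor_eq_Gammaℝ_add hq hχq, mul_assoc _ (Gammaℝ _), mul_div_cancel₀ _ hΓ]
end

section
/- Let m ≥ 3 and let χ be a nontrivial primitive Dirichlet character mod m, with q ∈ {0,1} defined by χ(−1) = (−1)^q. Define the theta function θ(χ,y) = (1/2)(π/m)^{q/2} Σ_{n∈ℤ} χ(n) n^q e^{−n²πy/m} for y > 0. Then for all s ∈ ℂ with Re s > 1, the Mellin transform of θ(χ,·) at (s+q)/2 equals the completed L-function: ∫₀^∞ θ(χ,y) y^{(s+q)/2} dy/y = (m/π)^{s/2} Γ((s+q)/2) L(s,χ), where L(s,χ) = Σ_{n≥1} χ(n) n^{−s}. -/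
open Complex Set

/-- The theta series of a character whose parity agrees with `q`, folded onto the positive
integers. -/
lemma hasSum_theta_nat_succ {m : ℕ} (hm : 3 ≤ m) (χ : DirichletCharacter ℂ m)
    {q : ℕ} (hχq : χ (-1) = (-1) ^ q) {y : ℝ} (hy : 0 < y) :
    HasSum (fun n : ℕ ↦ χ ((n + 1 : ℕ) : ZMod m) * ((n + 1 : ℕ) : ℂ) ^ q *
        Real.exp (-(((n + 1 : ℕ) : ℝ) ^ 2 * (Real.pi / m)) * y))
      ((1 / 2) * ∑' n : ℤ, χ ((n : ℤ) : ZMod m) * (n : ℂ) ^ q *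
          Complex.exp (-(n : ℂ) ^ 2 * Real.pi * y / m)) := by
  have hm0 : (0 : ℝ) < m := by positivity
  have : Fact (1 < m) := ⟨by lia⟩
  set f : ℤ → ℂ := fun n ↦ χ ((n : ℤ) : ZMod m) * (n : ℂ) ^ q *
    Complex.exp (-(n : ℂ) ^ 2 * Real.pi * y / m) with hf
  have hzero : f 0 = 0 := by
    simp [hf, χ.map_nonunit not_isUnit_zero]
  have heven (n : ℤ) : f (-n) = f n := by
    have h1 : χ (-(n : ZMod m)) = (-1) ^ q * χ n := by
      rw [← hχq, ← map_mul, neg_one_mul]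
    have h2 : (-(n : ℂ)) ^ q = (-1) ^ q * (n : ℂ) ^ q := by rw [← mul_pow, neg_one_mul]
    have h3 : ((-1 : ℂ) ^ q) * (-1) ^ q = 1 := by rw [← mul_pow]; simp
    simp only [hf, Int.cast_neg, h1, h2, neg_sq]
    linear_combination (χ n * (n : ℂ) ^ q * Complex.exp (-(n : ℂ) ^ 2 * Real.pi * y / m)) * h3
  have hterm (n : ℕ) : f n = χ (n : ZMod m) * (n : ℂ) ^ q *
      Real.exp (-((n : ℝ) ^ 2 * (Real.pi / m)) * y) := by
    simp only [hf]
    push_cast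
    congr 2
    ring
  have hnat : Summable fun n : ℕ ↦ f n := by
    have hc : 0 < Real.pi / m * y := by positivity
    refine (Real.summable_pow_mul_exp_neg_nat_mul q hc).of_norm_bounded fun n ↦ ?_
    rw [hterm, norm_mul, norm_mul, norm_pow, Complex.norm_natCast, norm_real, Real.norm_eq_abs,
      Real.abs_exp, mul_assoc]
    refine (mul_le_of_le_one_left (by positivity) (χ.norm_le_one _)).trans ?_
    refine mul_le_mul_of_nonneg_left (Real.exp_le_exp.mpr ?_) (by positivity)
    have hn : (n : ℝ) ≤ (n : ℝ) ^ 2 := by exact_mod_cast Nat.le_self_pow two_ne_zero n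
    linarith [mul_le_mul_of_nonneg_right hn hc.le]
  have hsucc : Summable fun n : ℕ ↦ f (n + 1 : ℕ) := (summable_nat_add_iff 1).mpr hnat
  have hint : HasSum f ((∑' n : ℕ, f (n + 1 : ℕ)) + f 0 + ∑' n : ℕ, f (n + 1 : ℕ)) := by
    refine HasSum.of_add_one_of_neg_add_one (by simpa using hsucc.hasSum) ?_
    simpa only [heven, ← Nat.cast_add_one] using hsucc.hasSum
  rw [hint.tsum_eq, hzero]
  simp only [← hterm]
  convert! hsucc.hasSum using 1
  ring

/-- For a nontrivial primitive Dirichlet character `χ` mod `m ≥ 3` with `χ(−1) = (−1)^q`,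
`q ∈ {0,1}`, let `θ(χ,y) = (1/2)(π/m)^{q/2} Σ_{n∈ℤ} χ(n) n^q e^{−n²πy/m}` for `y > 0`.
Then for `Re s > 1`, the Mellin transform of `θ(χ,·)` at `(s+q)/2` equals
`(m/π)^{s/2} Γ((s+q)/2) L(s,χ)` with `L(s,χ) = Σ_{n≥1} χ(n) n^{−s}`. -/
theorem statement4 (m : ℕ) (hm : 3 ≤ m) (χ : DirichletCharacter ℂ m)
    (hχ : χ ≠ 1) (hχprim : χ.IsPrimitive)
    (q : ℕ) (hq : q = 0 ∨ q = 1) (hχq : χ (-1) = (-1) ^ q)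
    (θ : ℝ → ℂ)
    (hθ : ∀ y : ℝ, 0 < y →
      θ y = (1 / 2) * ((Real.pi / m : ℝ) ^ ((q : ℝ) / 2) : ℝ) *
        ∑' n : ℤ, χ ((n : ℤ) : ZMod m) * (n : ℂ) ^ q *
          Complex.exp (-(n : ℂ) ^ 2 * Real.pi * y / m)) :
    ∀ s : ℂ, 1 < s.re →
      ∫ y in Ioi (0 : ℝ), θ y * (y : ℂ) ^ ((s + q) / 2 - 1) =
        ((m : ℂ) / (Real.pi : ℂ)) ^ (s / 2) * Complex.Gamma ((s + q) / 2) *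
          ∑' n : ℕ, χ (((n + 1 : ℕ) : ℤ) : ZMod m) * ((n + 1 : ℕ) : ℂ) ^ (-s) := by
  intro s hs
  have hm0 : (0 : ℝ) < m := by positivity
  set r : ℝ := Real.pi / m with hr
  have hr0 : 0 < r := by positivity
  have hrC : (r : ℂ) ≠ 0 := by exact_mod_cast hr0.ne'
  set C : ℝ := r ^ ((q : ℝ) / 2) with hC
  have hC0 : 0 < C := by positivity
  have hwre : ((s + q) / 2).re = (s.re + q) / 2 := by simp
  have key := hasSum_mellin (a := fun n : ℕ ↦ C * (χ ((n + 1 : ℕ) : ZMod m) *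
      ((n + 1 : ℕ) : ℂ) ^ q)) (p := fun n : ℕ ↦ ((n + 1 : ℕ) : ℝ) ^ 2 * r) (F := θ)
      (s := (s + q) / 2) (fun n ↦ Or.inr (by positivity)) (by rw [hwre]; positivity)
      (fun t ht ↦ by
        rw [hθ t ht, mul_comm (1 / 2 : ℂ), mul_assoc (C : ℂ)]
        simpa only [mul_assoc (C : ℂ)] using
          (hasSum_theta_nat_succ hm χ hχq ht).mul_left (C : ℂ)) ?_
  · have hterm (n : ℕ) : Complex.Gamma ((s + q) / 2) * (C * (χ ((n + 1 : ℕ) : ZMod m) *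
        ((n + 1 : ℕ) : ℂ) ^ q)) / ((((n + 1 : ℕ) : ℝ) ^ 2 * r : ℝ) : ℂ) ^ ((s + q) / 2) =
        ((m : ℂ) / (Real.pi : ℂ)) ^ (s / 2) * Complex.Gamma ((s + q) / 2) *
          (χ (((n + 1 : ℕ) : ℤ) : ZMod m) * ((n + 1 : ℕ) : ℂ) ^ (-s)) := by
      have hn0 : ((n + 1 : ℕ) : ℂ) ≠ 0 := by exact_mod_cast n.succ_ne_zero
      have hbase : ((m : ℂ) / (Real.pi : ℂ)) ^ (s / 2) = (r : ℂ) ^ (-(s / 2)) := by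
        have hinv : (m : ℂ) / (Real.pi : ℂ) = ((r⁻¹ : ℝ) : ℂ) := by
          rw [hr, inv_div]; push_cast; rfl
        rw [hinv, ofReal_inv, inv_cpow _ _ (by
          rw [arg_ofReal_of_nonneg hr0.le]; exact Real.pi_pos.ne), cpow_neg]
      have hCr : (C : ℂ) = (r : ℂ) ^ ((q : ℂ) / 2) := by
        rw [hC, ofReal_cpow hr0.le]; push_cast; rfl
      have hsq : ((((n + 1 : ℕ) : ℝ) ^ 2 : ℝ) : ℂ) ^ ((s + q) / 2) =
          ((n + 1 : ℕ) : ℂ) ^ s * ((n + 1 : ℕ) : ℂ) ^ q := by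
        have harg : ((n + 1 : ℕ) : ℂ).arg = 0 := natCast_arg
        rw [ofReal_pow, ofReal_natCast, ← cpow_nat_mul' (by rw [harg]; simp [Real.pi_pos])
          (by rw [harg]; simp [Real.pi_pos.le]), ← cpow_natCast _ q, ← cpow_add _ _ hn0]
        congr 1
        push_cast
        ring
      have hrs : (r : ℂ) ^ ((s + q) / 2) = (r : ℂ) ^ (s / 2) * (r : ℂ) ^ ((q : ℂ) / 2) := by
        rw [← cpow_add _ _ hrC, add_div]
      have h1 : (r : ℂ) ^ (s / 2) ≠ 0 := by simp [cpow_eq_zero_iff, hrC]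
      have h2 : (r : ℂ) ^ ((q : ℂ) / 2) ≠ 0 := by simp [cpow_eq_zero_iff, hrC]
      have h3 : ((n + 1 : ℕ) : ℂ) ^ s ≠ 0 := by rw [Ne, cpow_eq_zero_iff]; tauto
      rw [ofReal_mul, mul_cpow_ofReal_nonneg (by positivity) hr0.le, hsq, hrs, hbase, hCr,
        cpow_neg, cpow_neg, Int.cast_natCast]
      field_simp
    simp only [hterm] at key
    rw [← tsum_mul_left, key.tsum_eq, mellin]
    simp only [smul_eq_mul, mul_comm]
  · have hsum : Summable fun n : ℕ ↦ 1 / ((n + 1 : ℕ) : ℝ) ^ s.re :=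
      (summable_nat_add_iff 1).mpr (Real.summable_one_div_nat_rpow.mpr hs)
    refine (hsum.mul_left (C / r ^ ((s.re + q) / 2))).of_nonneg_of_le
      (fun n ↦ by positivity) fun n ↦ ?_
    have hn0 : (0 : ℝ) < ((n + 1 : ℕ) : ℝ) := by positivity
    have hsq : (((n + 1 : ℕ) : ℝ) ^ 2) ^ ((s.re + q) / 2) =
        ((n + 1 : ℕ) : ℝ) ^ s.re * ((n + 1 : ℕ) : ℝ) ^ q := by
      rw [← Real.rpow_natCast_mul hn0.le, ← Real.rpow_natCast _ q, ← Real.rpow_add hn0]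
      congr 1
      push_cast
      ring
    rw [hwre, norm_mul, norm_mul, norm_pow, Complex.norm_natCast, norm_real, Real.norm_of_nonneg hC0.le,
      Real.mul_rpow (by positivity) hr0.le, hsq]
    calc C * (‖χ ((n + 1 : ℕ) : ZMod m)‖ * ((n + 1 : ℕ) : ℝ) ^ q) /
          (((n + 1 : ℕ) : ℝ) ^ s.re * ((n + 1 : ℕ) : ℝ) ^ q * r ^ ((s.re + q) / 2))
        ≤ C * (1 * ((n + 1 : ℕ) : ℝ) ^ q) /
          (((n + 1 : ℕ) : ℝ) ^ s.re * ((n + 1 : ℕ) : ℝ) ^ q * r ^ ((s.re + q) / 2)) := by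
          gcongr
          exact χ.norm_le_one _
      _ = C / r ^ ((s.re + q) / 2) * (1 / ((n + 1 : ℕ) : ℝ) ^ s.re) := by
          field_simp
end

section
/- Let K be a number field. The completed Dedekind zeta function ζ̂_K extends to a meromorphic function on ℂ whose only poles are simple poles at s = 0 and s = 1, and it satisfies the functional equation ζ̂_K(s) = ζ̂_K(1−s) for all s. -/
open Complex Filter NumberField

namespace HeckeZeta

open MeasureTheory

section Poisson

variable {ι : Type*}

/-- The inclusion of `ℤ^ι` in `ℝ^ι`. -/
def intVec (m : ι → ℤ) : ι → ℝ := fun i ↦ (m i : ℝ)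

lemma intVec_add (m n : ι → ℤ) : intVec (m + n) = intVec m + intVec n := by
  ext i; simp [intVec]

/-- The unit box with lower corner `m`. -/
def intBox (m : ι → ℤ) : Set (ι → ℝ) := {x | ∀ i, x i ∈ Set.Ioc (m i : ℝ) (m i + 1)}

lemma mem_intBox_iff {m : ι → ℤ} {x : ι → ℝ} : x ∈ intBox m ↔ ∀ i, m i = ⌈x i⌉ - 1 := by
  refine forall_congr' fun i ↦ ?_
  rw [eq_comm, sub_eq_iff_eq_add, Int.ceil_eq_iff]
  simp

lemma pairwise_disjoint_intBox : Pairwise (Function.onFun Disjoint (intBox (ι := ι))) := by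
  intro m n hmn
  rw [Function.onFun, Set.disjoint_left]
  intro x hx hx'
  rw [mem_intBox_iff] at hx hx'
  exact hmn (funext fun i ↦ (hx i).trans (hx' i).symm)

lemma iUnion_intBox : ⋃ m, intBox (ι := ι) m = Set.univ := by
  refine Set.eq_univ_of_forall fun x ↦ Set.mem_iUnion.mpr ⟨fun i ↦ ⌈x i⌉ - 1, ?_⟩
  rw [mem_intBox_iff]
  exact fun i ↦ rfl

variable [Fintype ι]

lemma norm_intVec (m : ι → ℤ) : ‖intVec m‖ = ‖m‖ := by
  simp only [Pi.norm_def, intVec]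
  congr 1

lemma summable_norm_rpow_intVec {r : ℝ} (hr : r < -Fintype.card ι) :
    Summable fun m : ι → ℤ ↦ ‖intVec m‖ ^ r := by
  classical
  let L : Submodule ℤ (ι → ℝ) := Submodule.span ℤ (Set.range (Pi.basisFun ℝ ι))
  have hrank : Module.finrank ℤ L = Fintype.card ι := by
    rw [ZLattice.rank ℝ L, Module.finrank_fintype_fun_eq_card]
  have h := ZLattice.summable_norm_rpow L r (by rwa [hrank])
  have hmem (m : ι → ℤ) : intVec m ∈ L := by
    rw [(Pi.basisFun ℝ ι).mem_span_iff_repr_mem ℤ]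
    intro i
    exact ⟨m i, by simp [intVec]⟩
  have hinj : Function.Injective fun m : ι → ℤ ↦ (⟨intVec m, hmem m⟩ : L) := by
    intro m n hmn
    ext i
    have := congrFun (congrArg Subtype.val hmn) i
    simpa [intVec] using this
  have h' := h.comp_injective hinj
  refine h'.congr fun m ↦ ?_
  rfl

lemma measurableSet_intBox (m : ι → ℤ) : MeasurableSet (intBox m) := by
  have : intBox m = Set.univ.pi fun i ↦ Set.Ioc (m i : ℝ) (m i + 1) := by
    ext; simp [intBox]
  rw [this]
  exact MeasurableSet.univ_pi fun i ↦ measurableSet_Ioc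

lemma setIntegral_intBox {E : Type*} [NormedAddCommGroup E] [NormedSpace ℝ E]
    (f : (ι → ℝ) → E) (m : ι → ℤ) :
    ∫ x in intBox m, f x = ∫ x in intBox 0, f (x + intVec m) := by
  rw [← (measurePreserving_add_right volume (intVec m)).setIntegral_preimage_emb
    (MeasurableEquiv.addRight (intVec m)).measurableEmbedding f (intBox m)]
  congr 2
  ext x
  simp [intBox, intVec, add_comm (x _)]

/-- The additive character `x ↦ exp (-2πi n·x)`. -/
noncomputable def fourierChar (n : ι → ℤ) (x : ι → ℝ) : ℂ :=
  cexp (-2 * Real.pi * I * ∑ i, (n i : ℂ) * (x i : ℂ))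

lemma norm_fourierChar (n : ι → ℤ) (x : ι → ℝ) : ‖fourierChar n x‖ = 1 := by
  rw [fourierChar, show (-2 * Real.pi * I * ∑ i, (n i : ℂ) * (x i : ℂ)) =
    ((-2 * Real.pi * ∑ i, n i * x i : ℝ) : ℂ) * I by push_cast; ring]
  exact Complex.norm_exp_ofReal_mul_I _

lemma continuous_fourierChar (n : ι → ℤ) : Continuous (fourierChar n) := by
  unfold fourierChar
  fun_prop

lemma fourierChar_add_intVec (n m : ι → ℤ) (x : ι → ℝ) :
    fourierChar n (x + intVec m) = fourierChar n x := by
  unfold fourierChar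
  rw [Complex.exp_eq_exp_iff_exists_int]
  refine ⟨-∑ i, n i * m i, ?_⟩
  simp only [Pi.add_apply, intVec]
  push_cast
  simp only [mul_add, Finset.sum_add_distrib]
  ring

lemma mFourier_neg_coe (n : ι → ℤ) (x : ι → ℝ) :
    UnitAddTorus.mFourier (-n) (fun i ↦ (x i : UnitAddCircle)) = fourierChar n x := by
  simp only [UnitAddTorus.mFourier, ContinuousMap.coe_mk, fourierChar, fourier_coe_apply,
    ← Complex.exp_sum]
  congr 1
  rw [Finset.mul_sum]
  refine Finset.sum_congr rfl fun i _ ↦ ?_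
  simp only [Pi.neg_apply, Int.cast_neg, ofReal_one]
  ring

/-- **Poisson summation** for `ℤ^ι ⊂ ℝ^ι`. -/
theorem tsum_eq_tsum_fourier {φ : (ι → ℝ) → ℂ} (hc : Continuous φ) (hi : Integrable φ)
    (hb : ∀ R : ℝ, ∃ u : (ι → ℤ) → ℝ, Summable u ∧ ∀ m x, ‖x‖ ≤ R → ‖φ (x + intVec m)‖ ≤ u m)
    (hF : Summable fun n : ι → ℤ ↦ ∫ x, fourierChar n x * φ x) :
    ∑' m : ι → ℤ, φ (intVec m) = ∑' n : ι → ℤ, ∫ x, fourierChar n x * φ x := by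
  let F : (ι → ℝ) → ℂ := fun x ↦ ∑' m : ι → ℤ, φ (x + intVec m)
  have hFc : Continuous F := by
    rw [continuous_iff_continuousAt]
    intro x₀
    obtain ⟨u, hu, hub⟩ := hb (‖x₀‖ + 1)
    refine ContinuousOn.continuousAt (s := Metric.ball x₀ 1) ?_ (Metric.ball_mem_nhds _ one_pos)
    refine continuousOn_tsum (fun m ↦ by fun_prop) hu fun m x hx ↦ hub m x ?_
    have h1 : ‖x - x₀‖ < 1 := by simpa [dist_eq_norm] using hx
    have h2 := norm_sub_norm_le x x₀
    linarith
  have hFper (n : ι → ℤ) (x : ι → ℝ) : F (x + intVec n) = F x := by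
    simp only [F]
    rw [← (Equiv.addLeft n).tsum_eq fun m ↦ φ (x + intVec m)]
    simp [intVec_add, add_assoc]
  let q : (ι → ℝ) → UnitAddTorus ι := Pi.map fun _ ↦ ((↑) : ℝ → UnitAddCircle)
  have hq : IsOpenQuotientMap q := .piMap fun _ ↦ QuotientAddGroup.isOpenQuotientMap_mk
  have hker (x y : ι → ℝ) (h : q x = q y) : F x = F y := by
    have h' (i : ι) : ∃ k : ℤ, y i = x i + k := by
      obtain ⟨k, hk⟩ := QuotientAddGroup.eq.mp (congrFun h i)
      refine ⟨k, ?_⟩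
      simp only [zsmul_eq_mul, mul_one] at hk
      linarith
    choose k hk using h'
    rw [show y = x + intVec k from funext hk, hFper]
  have hGq (x : ι → ℝ) : F (Function.surjInv hq.surjective (q x)) = F x :=
    hker _ _ (Function.surjInv_eq hq.surjective (q x))
  let G : C(UnitAddTorus ι, ℂ) := ⟨fun z ↦ F (Function.surjInv hq.surjective z), by
    rw [hq.isQuotientMap.continuous_iff]
    exact hFc.congr fun x ↦ (hGq x).symm⟩
  have hG (x : ι → ℝ) : G (fun i ↦ (x i : UnitAddCircle)) = F x := hGq x
  have hcoeff (n : ι → ℤ) : UnitAddTorus.mFourierCoeff G n = ∫ x, fourierChar n x * φ x := by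
    have hi' : Integrable fun x ↦ fourierChar n x * φ x :=
      hi.bdd_mul (continuous_fourierChar n).aestronglyMeasurable
        (.of_forall fun x ↦ (norm_fourierChar n x).le)
    rw [UnitAddTorus.mFourierCoeff_eq_integral _ _ 0]
    have hbox : {x : ι → ℝ | ∀ i, x i ∈ Set.Ioc ((0 : ι → ℝ) i) ((0 : ι → ℝ) i + 1)} =
        intBox 0 := by
      ext; simp [intBox]
    have hsplit {f : (ι → ℝ) → ℝ} (hf : Integrable f) :
        HasSum (fun m ↦ ∫ x in intBox 0, f (x + intVec m)) (∫ x, f x) := by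
      have key := hasSum_integral_iUnion (f := f) (μ := volume)
        measurableSet_intBox pairwise_disjoint_intBox hf.integrableOn
      rw [iUnion_intBox, setIntegral_univ] at key
      exact key.congr_fun fun m ↦ (setIntegral_intBox f m).symm
    have hsplit' {f : (ι → ℝ) → ℂ} (hf : Integrable f) :
        HasSum (fun m ↦ ∫ x in intBox 0, f (x + intVec m)) (∫ x, f x) := by
      have key := hasSum_integral_iUnion (f := f) (μ := volume)
        measurableSet_intBox pairwise_disjoint_intBox hf.integrableOn
      rw [iUnion_intBox, setIntegral_univ] at key
      exact key.congr_fun fun m ↦ (setIntegral_intBox f m).symm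
    simp_rw [hbox, mFourier_neg_coe, hG, F, smul_eq_mul, ← tsum_mul_left]
    have h1 := hsplit' hi'
    simp_rw [fourierChar_add_intVec] at h1
    refine HasSum.unique (hasSum_integral_of_summable_integral_norm (fun m ↦ ?_) ?_) h1
    · have := hi'.comp_add_right (intVec m)
      simp_rw [fourierChar_add_intVec] at this
      exact this.integrableOn
    · refine (hsplit hi.norm).summable.congr fun m ↦ ?_
      simp [norm_fourierChar]
  have hsum : Summable (UnitAddTorus.mFourierCoeff G) := by simpa only [← hcoeff] using hF
  have h0 := (UnitAddTorus.hasSum_mFourier_series_apply_of_summable hsum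
    (fun i ↦ ((0 : ι → ℝ) i : UnitAddCircle))).tsum_eq
  rw [hG] at h0
  simp only [F, zero_add] at h0
  rw [← h0]
  refine tsum_congr fun n ↦ ?_
  rw [← hcoeff, ← neg_neg n, mFourier_neg_coe]
  simp [fourierChar]

end Poisson

lemma exp_neg_le_factorial_div_pow {u : ℝ} (hu : 0 < u) (k : ℕ) :
    Real.exp (-u) ≤ k.factorial / u ^ k := by
  rw [Real.exp_neg, inv_eq_one_div, div_le_div_iff₀ (Real.exp_pos u) (by positivity), one_mul]
  have := Real.pow_div_factorial_le_exp u hu.le k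
  rwa [div_le_iff₀' (by positivity)] at this

section Gaussian

variable {ι : Type*} [Fintype ι]

lemma summable_exp_neg_mul_norm_sq_intVec {a : ℝ} (ha : 0 < a) :
    Summable fun m : ι → ℤ ↦ Real.exp (-(a * ‖intVec m‖ ^ 2)) := by
  let k := Fintype.card ι + 1
  have h := (summable_norm_rpow_intVec (ι := ι) (r := -(2 * k : ℕ)) (by
    simp only [k]; push_cast; have : (0 : ℝ) ≤ Fintype.card ι := by positivity
    linarith)).mul_left (k.factorial / a ^ k)
  refine .of_norm_bounded_eventually h ?_
  have : {(0 : ι → ℤ)}ᶜ ∈ cofinite := (Set.finite_singleton _).compl_mem_cofinite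
  filter_upwards [this] with m hm
  have hm' : 0 < ‖intVec m‖ := by
    rw [norm_intVec]; exact norm_pos_iff.mpr hm
  rw [Real.norm_of_nonneg (Real.exp_pos _).le]
  refine (exp_neg_le_factorial_div_pow (by positivity) k).trans_eq ?_
  rw [Real.rpow_neg hm'.le, Real.rpow_natCast, mul_pow, pow_mul]
  field_simp

variable [DecidableEq ι]

open Matrix

lemma exists_mul_norm_sq_le_sum_mulVec_sq {B : Matrix ι ι ℝ} (hB : B.det ≠ 0) :
    ∃ c > 0, ∀ x : ι → ℝ, c * ‖x‖ ^ 2 ≤ ∑ i, (B *ᵥ x) i ^ 2 := by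
  have hker : (Matrix.toLin' B).ker = ⊥ := by
    rw [LinearMap.ker_eq_bot']
    intro x hx
    by_contra h
    exact hB (Matrix.exists_mulVec_eq_zero_iff.mp ⟨x, h, by simpa using hx⟩)
  obtain ⟨K, hK, h⟩ := (Matrix.toLin' B).exists_antilipschitzWith hker
  have hK' : (0 : ℝ) < K := hK
  refine ⟨((K : ℝ) ^ 2)⁻¹, by positivity, fun x ↦ ?_⟩
  rw [inv_mul_le_iff₀ (by positivity)]
  have h1 : ‖x‖ ≤ K * ‖B *ᵥ x‖ := by simpa [dist_zero_right] using h.le_mul_dist x 0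
  have h2 : ‖B *ᵥ x‖ ^ 2 ≤ ∑ i, (B *ᵥ x) i ^ 2 := by
    have h3 : ‖B *ᵥ x‖ ≤ √(∑ i, (B *ᵥ x) i ^ 2) := by
      rw [pi_norm_le_iff_of_nonneg (Real.sqrt_nonneg _)]
      intro i
      rw [Real.norm_eq_abs, ← Real.sqrt_sq_eq_abs]
      exact Real.sqrt_le_sqrt (Finset.single_le_sum (f := fun i ↦ (B *ᵥ x) i ^ 2)
        (fun i _ ↦ sq_nonneg _) (Finset.mem_univ i))
    calc _ ≤ √(∑ i, (B *ᵥ x) i ^ 2) ^ 2 := by gcongr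
      _ = _ := Real.sq_sqrt (Finset.sum_nonneg fun i _ ↦ sq_nonneg _)
  calc ‖x‖ ^ 2 ≤ (K * ‖B *ᵥ x‖) ^ 2 := by gcongr
    _ = K ^ 2 * ‖B *ᵥ x‖ ^ 2 := by ring
    _ ≤ _ := by gcongr

lemma summable_gaussian {B : Matrix ι ι ℝ} (hB : B.det ≠ 0) :
    Summable fun m ↦ Real.exp (-Real.pi * ∑ i, (B *ᵥ intVec m) i ^ 2) := by
  obtain ⟨c, hc, h⟩ := exists_mul_norm_sq_le_sum_mulVec_sq hB
  refine .of_nonneg_of_le (fun _ ↦ (Real.exp_pos _).le) (fun m ↦ ?_)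
    (summable_exp_neg_mul_norm_sq_intVec (ι := ι) (mul_pos Real.pi_pos hc))
  rw [Real.exp_le_exp, neg_mul, mul_assoc, neg_le_neg_iff]
  exact mul_le_mul_of_nonneg_left (h _) Real.pi_pos.le

lemma integral_comp_mulVec {B : Matrix ι ι ℝ} (hB : B.det ≠ 0) (f : (ι → ℝ) → ℂ) :
    ∫ x, f (B *ᵥ x) = |B.det|⁻¹ * ∫ x, f x := by
  have h := Real.map_matrix_volume_pi_eq_smul_volume_pi hB
  let e : (ι → ℝ) ≃L[ℝ] (ι → ℝ) := (Matrix.toLin'OfInv (Matrix.nonsing_inv_mul B hB.isUnit)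
    (Matrix.mul_nonsing_inv B hB.isUnit)).toContinuousLinearEquiv
  have h2 := integral_map_equiv (μ := volume) e.toHomeomorph.toMeasurableEquiv f
  have h3 : ⇑e.toHomeomorph.toMeasurableEquiv = ⇑(Matrix.toLin' B) := rfl
  rw [h3, h, integral_smul_measure] at h2
  simp only [Matrix.toLin'_apply] at h2
  rw [← h2, ENNReal.toReal_ofReal (abs_nonneg _), abs_inv, Complex.real_smul]

lemma integrable_gaussian {B : Matrix ι ι ℝ} (hB : B.det ≠ 0) :
    Integrable fun x ↦ cexp (-Real.pi * ∑ i, ((B *ᵥ x) i : ℂ) ^ 2) := by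
  have h := GaussianFourier.integrable_cexp_neg_mul_sum_add (b := Real.pi) (ι := ι)
    (by simpa using Real.pi_pos) 0
  let e : (ι → ℝ) ≃L[ℝ] (ι → ℝ) := (Matrix.toLin'OfInv (Matrix.nonsing_inv_mul B hB.isUnit)
    (Matrix.mul_nonsing_inv B hB.isUnit)).toContinuousLinearEquiv
  have h3 : ⇑e.toHomeomorph.toMeasurableEquiv = ⇑(Matrix.toLin' B) := rfl
  have h2 := (e.toHomeomorph.toMeasurableEquiv.measurableEmbedding.integrable_map_iff
    (μ := volume) (g := fun v : ι → ℝ ↦ cexp (-Real.pi * ∑ i, (v i : ℂ) ^ 2)))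
  rw [h3, Real.map_matrix_volume_pi_eq_smul_volume_pi hB] at h2
  refine h2.mp (Integrable.smul_measure ?_ ENNReal.ofReal_ne_top)
  simpa using h

lemma integral_fourierChar_mul_gaussian {B : Matrix ι ι ℝ} (hB : B.det ≠ 0) (n : ι → ℤ) :
    ∫ x, fourierChar n x * cexp (-Real.pi * ∑ i, ((B *ᵥ x) i : ℂ) ^ 2) =
      |B.det|⁻¹ * cexp (-Real.pi * ∑ i, (((B⁻¹)ᵀ *ᵥ intVec n) i : ℂ) ^ 2) := by
  have h1 (x : ι → ℝ) : fourierChar n x = fourierChar n (B⁻¹ *ᵥ (B *ᵥ x)) := by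
    rw [Matrix.mulVec_mulVec, Matrix.nonsing_inv_mul B hB.isUnit, Matrix.one_mulVec]
  rw [show (fun x : ι → ℝ ↦ fourierChar n x * cexp (-Real.pi * ∑ i, ((B *ᵥ x) i : ℂ) ^ 2)) =
    fun x ↦ fourierChar n (B⁻¹ *ᵥ (B *ᵥ x)) * cexp (-Real.pi * ∑ i, ((B *ᵥ x) i : ℂ) ^ 2) from
    funext fun x ↦ by rw [← h1]]
  rw [integral_comp_mulVec hB fun v ↦ fourierChar n (B⁻¹ *ᵥ v) *
    cexp (-Real.pi * ∑ i, (v i : ℂ) ^ 2)]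
  congr 1
  have h2 (v : ι → ℝ) : ∑ i, (n i : ℂ) * ((B⁻¹ *ᵥ v) i : ℂ) =
      ∑ i, (((B⁻¹)ᵀ *ᵥ intVec n) i : ℂ) * v i := by
    have : intVec n ⬝ᵥ (B⁻¹ *ᵥ v) = ((B⁻¹)ᵀ *ᵥ intVec n) ⬝ᵥ v := by
      rw [Matrix.dotProduct_mulVec, Matrix.mulVec_transpose]
    simp only [dotProduct, intVec] at this
    exact_mod_cast this
  have h := GaussianFourier.integral_cexp_neg_mul_sum_add (b := Real.pi) (ι := ι)
    (by simpa using Real.pi_pos)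
    fun i ↦ -2 * Real.pi * I * (((B⁻¹)ᵀ *ᵥ intVec n) i : ℂ)
  rw [div_self (by exact_mod_cast Real.pi_ne_zero), Complex.one_cpow, one_mul] at h
  convert h using 2
  · ext v
    rw [fourierChar, ← Complex.exp_add, h2, add_comm, Finset.mul_sum (a := -2 * Real.pi * I)]
    simp only [mul_assoc]
  · have hpi : (Real.pi : ℂ) ≠ 0 := by exact_mod_cast Real.pi_ne_zero
    rw [eq_div_iff (by simp [hpi]), Finset.mul_sum, Finset.sum_mul]
    refine Finset.sum_congr rfl fun i _ ↦ ?_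
    simp only [mul_pow, I_sq]
    ring

/-- The transformation formula of the theta series of a positive definite quadratic form. -/
theorem tsum_gaussian {B : Matrix ι ι ℝ} (hB : B.det ≠ 0) :
    ∑' m, Real.exp (-Real.pi * ∑ i, (B *ᵥ intVec m) i ^ 2) =
      |B.det|⁻¹ * ∑' n, Real.exp (-Real.pi * ∑ i, ((B⁻¹)ᵀ *ᵥ intVec n) i ^ 2) := by
  have hB' : (B⁻¹)ᵀ.det ≠ 0 := by
    rw [Matrix.det_transpose, Matrix.det_nonsing_inv, Ring.inverse_eq_inv']
    exact inv_ne_zero hB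
  have hcast (C : Matrix ι ι ℝ) (x : ι → ℝ) : cexp (-Real.pi * ∑ i, ((C *ᵥ x) i : ℂ) ^ 2) =
      (Real.exp (-Real.pi * ∑ i, (C *ᵥ x) i ^ 2) : ℝ) := by push_cast; rfl
  have key := tsum_eq_tsum_fourier (φ := fun x ↦ cexp (-Real.pi * ∑ i, ((B *ᵥ x) i : ℂ) ^ 2))
    ?_ (integrable_gaussian hB) ?_ ?_
  · simp_rw [integral_fourierChar_mul_gaussian hB, hcast] at key
    rw [tsum_mul_left, ← ofReal_tsum, ← ofReal_tsum] at key
    exact_mod_cast key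
  · simp_rw [hcast]
    refine Complex.continuous_ofReal.comp (Real.continuous_exp.comp (continuous_const.mul ?_))
    refine continuous_finsetSum _ fun i _ ↦ ?_
    exact ((continuous_apply i).comp
      (Continuous.matrix_mulVec continuous_const continuous_id)).pow 2
  · intro R
    obtain ⟨c, hc, h⟩ := exists_mul_norm_sq_le_sum_mulVec_sq hB
    refine ⟨fun m ↦ Real.exp (Real.pi * c * R ^ 2) * Real.exp (-(Real.pi * c / 2 * ‖intVec m‖ ^ 2)),
      (summable_exp_neg_mul_norm_sq_intVec (by have := Real.pi_pos; positivity)).mul_left _,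
      fun m x hx ↦ ?_⟩
    beta_reduce
    rw [hcast, Complex.norm_real, Real.norm_of_nonneg (Real.exp_pos _).le, ← Real.exp_add,
      Real.exp_le_exp]
    have h1 : ‖intVec m‖ ≤ ‖x + intVec m‖ + R := by
      have := norm_sub_le (x + intVec m) x
      rw [add_sub_cancel_left] at this
      linarith
    have h2 : ‖intVec m‖ ^ 2 ≤ 2 * ‖x + intVec m‖ ^ 2 + 2 * R ^ 2 := by
      have := pow_le_pow_left₀ (norm_nonneg _) h1 2
      nlinarith [sq_nonneg (‖x + intVec m‖ - R)]
    have h3 := h (x + intVec m)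
    have h4 : Real.pi * (c * ‖x + intVec m‖ ^ 2) ≤ Real.pi * ∑ i, (B *ᵥ (x + intVec m)) i ^ 2 :=
      mul_le_mul_of_nonneg_left h3 Real.pi_pos.le
    have h5 : Real.pi * c * ‖intVec m‖ ^ 2 ≤
        Real.pi * c * (2 * ‖x + intVec m‖ ^ 2 + 2 * R ^ 2) :=
      mul_le_mul_of_nonneg_left h2 (by have := Real.pi_pos; positivity)
    linarith
  · simp_rw [integral_fourierChar_mul_gaussian hB, hcast]
    exact (Complex.ofRealCLM.summable (summable_gaussian hB')).mul_left _

end Gaussian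

section BasisTheta

open InfinitePlace mixedEmbedding Matrix Module
open scoped Classical

variable {K : Type*} [Field K] [NumberField K]

/-- The quadratic form `a ↦ ∑ σ, y σ * ‖σ a‖ ^ 2`, summed over the complex embeddings of `K`. -/
noncomputable def placeForm (y : InfinitePlace K → ℝ) (a : K) : ℝ :=
  ∑ w, w.mult * y w * w a ^ 2

noncomputable def indexPlace : index K → InfinitePlace K := Sum.elim (·.1) (·.1.1)

noncomputable def indexSign : index K → ℝ := Sum.elim 1 fun p ↦ if p.2 = 0 then 1 else -1

/-- The real coordinates of an element of `K` at its infinite places. -/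
noncomputable def indexCoord (p : index K) (a : K) : ℝ :=
  Sum.elim (fun w ↦ (w.1.embedding a).re)
    (fun p ↦ if p.2 = 0 then (p.1.1.embedding a).re else (p.1.1.embedding a).im) p

lemma indexCoord_sum_intCast_mul {κ : Type*} [Fintype κ] (p : index K) (m : κ → ℤ) (b : κ → K) :
    indexCoord p (∑ i, m i * b i) = ∑ i, m i * indexCoord p (b i) := by
  rcases p with w | ⟨w, j⟩
  · simp [indexCoord]
  · by_cases h : j = 0 <;> simp [indexCoord, h]

lemma sum_index (f : index K → ℝ) (g : InfinitePlace K → ℝ)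
    (hr : ∀ w : {w : InfinitePlace K // IsReal w}, f (.inl w) = g w)
    (hc : ∀ w : {w : InfinitePlace K // IsComplex w}, f (.inr (w, 0)) + f (.inr (w, 1)) = g w) :
    ∑ p, f p = ∑ w, g w := by
  rw [Fintype.sum_sum_type, Fintype.sum_prod_type, sum_eq_sum_add_sum]
  simp [hr, hc, Fin.sum_univ_two]

lemma prod_index (f : index K → ℝ) (g : InfinitePlace K → ℝ)
    (hr : ∀ w : {w : InfinitePlace K // IsReal w}, f (.inl w) = g w)
    (hc : ∀ w : {w : InfinitePlace K // IsComplex w}, f (.inr (w, 0)) * f (.inr (w, 1)) = g w) :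
    ∏ p, f p = ∏ w, g w := by
  rw [Fintype.prod_sum_type, Fintype.prod_prod_type, prod_eq_prod_mul_prod]
  simp [hr, hc, Fin.prod_univ_two]

lemma embedding_im {K : Type*} [Field K] (w : {w : InfinitePlace K // IsReal w}) (a : K) :
    (w.1.embedding a).im = 0 := by
  rw [← embedding_of_isReal_apply w.2 a, ofReal_im]

lemma placeForm_eq_sum_index (y : InfinitePlace K → ℝ) (a : K) :
    placeForm y a =
      ∑ p, (indexPlace p).mult * y (indexPlace p) * indexCoord p a ^ 2 := by
  refine (sum_index _ _ (fun w ↦ ?_) fun w ↦ ?_).symm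
  · simp only [indexPlace, indexCoord, Sum.elim_inl]
    rw [← norm_embedding_eq w.1 a, Complex.sq_norm, Complex.normSq_apply, embedding_im w a]
    simp [sq]
  · simp only [indexPlace, indexCoord, Sum.elim_inr]
    rw [← norm_embedding_eq w.1 a, Complex.sq_norm, Complex.normSq_apply]
    simp
    ring

lemma trace_eq_sum_mult_mul_re (x : K) :
    (Algebra.trace ℚ K x : ℝ) = ∑ w : InfinitePlace K, w.mult * (w.embedding x).re := by
  have h := congrArg Complex.re (trace_eq_sum_embeddings (K := ℚ) (L := K) ℂ (x := x))
  rw [Complex.re_sum, ← Fintype.sum_equiv (RingHom.equivRatAlgHom K ℂ) (fun f ↦ (f x).re)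
      (fun φ ↦ (φ x).re) fun _ ↦ by simp [RingHom.equivRatAlgHom_apply],
    ← Finset.sum_fiberwise Finset.univ InfinitePlace.mk (fun φ ↦ (φ x).re)] at h
  have (w : InfinitePlace K) (φ) (hφ : φ ∈ ({φ | mk φ = w} : Finset (K →+* ℂ))) :
      (φ x).re = (w.embedding x).re := by
    rw [← (Finset.mem_filter.mp hφ).2]
    rcases embedding_mk_eq φ with h | h <;> simp [h]
  simp_rw [Finset.sum_congr rfl (this _), Finset.sum_const, card_filter_mk_eq] at h
  simpa using h

lemma trace_mul_eq_sum_index (a b : K) :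
    (Algebra.trace ℚ K (a * b) : ℝ) =
      ∑ p, (indexPlace p).mult * indexSign p * indexCoord p a * indexCoord p b := by
  rw [trace_eq_sum_mult_mul_re]
  refine (sum_index _ _ (fun w ↦ ?_) fun w ↦ ?_).symm
  · simp only [indexPlace, indexCoord, indexSign, Sum.elim_inl]
    simp [embedding_im w a]
  · simp only [indexPlace, indexCoord, indexSign, Sum.elim_inr]
    simp
    ring

/-- The matrix of the real coordinates of a family, scaled so that its rows are
orthonormal coordinates for `placeForm y`. -/
noncomputable def coordMatrix (y : InfinitePlace K → ℝ) (b : index K → K) :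
    Matrix (index K) (index K) ℝ :=
  .of fun p i ↦ √((indexPlace p).mult * y (indexPlace p)) * indexCoord p (b i)

variable {y : InfinitePlace K → ℝ}

lemma sum_coordMatrix_mulVec_sq (hy : ∀ w, 0 ≤ y w) (b : index K → K) (m : index K → ℤ) :
    ∑ p, (coordMatrix y b *ᵥ intVec m) p ^ 2 = placeForm y (∑ i, m i * b i) := by
  rw [placeForm_eq_sum_index]
  refine Finset.sum_congr rfl fun p _ ↦ ?_
  have : (coordMatrix y b *ᵥ intVec m) p =
      √((indexPlace p).mult * y (indexPlace p)) * indexCoord p (∑ i, m i * b i) := by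
    rw [indexCoord_sum_intCast_mul, Finset.mul_sum]
    refine Finset.sum_congr rfl fun i _ ↦ ?_
    simp only [coordMatrix, Matrix.of_apply, intVec]
    ring
  rw [this, mul_pow, Real.sq_sqrt (mul_nonneg (Nat.cast_nonneg _) (hy _))]

lemma indexSign_sq {K : Type*} [Field K] (p : index K) : indexSign p ^ 2 = 1 := by
  rcases p with w | ⟨w, j⟩
  · simp [indexSign]
  · by_cases h : j = 0 <;> simp [indexSign, h]

lemma transpose_coordMatrix_mul {y' : InfinitePlace K → ℝ} (hy : ∀ w, 0 ≤ y w)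
    (hyy : ∀ w, y w * y' w = 1) (b b' : index K → K) (i j : index K) :
    ((coordMatrix y b)ᵀ * (diagonal indexSign * coordMatrix y' b') :
      Matrix (index K) (index K) ℝ) i j = (Algebra.trace ℚ K (b i * b' j) : ℝ) := by
  rw [trace_mul_eq_sum_index, Matrix.mul_apply]
  refine Finset.sum_congr rfl fun p _ ↦ ?_
  rw [Matrix.diagonal_mul]
  simp only [coordMatrix, Matrix.transpose_apply, Matrix.of_apply]
  have : √((indexPlace p).mult * y (indexPlace p)) * √((indexPlace p).mult * y' (indexPlace p)) =
      (indexPlace p).mult := by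
    rw [← Real.sqrt_mul (mul_nonneg (Nat.cast_nonneg _) (hy _)), Real.sqrt_eq_iff_mul_self_eq]
    · linear_combination ((indexPlace p).mult : ℝ) ^ 2 * hyy (indexPlace p)
    · have : 0 ≤ ((indexPlace p).mult : ℝ) ^ 2 * (y (indexPlace p) * y' (indexPlace p)) := by
        rw [hyy]; positivity
      linarith
    · positivity
  linear_combination (indexSign p * indexCoord p (b i) * indexCoord p (b' j)) * this

lemma coordMatrix_det_sq (hy : ∀ w, 0 ≤ y w) (b : index K → K) :
    (coordMatrix y b).det ^ 2 = |(Algebra.discr ℚ b : ℝ)| * ∏ w, y w ^ w.mult := by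
  have h1 : coordMatrix y b = diagonal (fun p ↦ √(y (indexPlace p))) * coordMatrix 1 b := by
    ext p i
    rw [Matrix.diagonal_mul]
    simp only [coordMatrix, Matrix.of_apply, Pi.one_apply, mul_one]
    rw [Real.sqrt_mul (Nat.cast_nonneg _)]
    ring
  have h2 : (coordMatrix 1 b)ᵀ * (diagonal indexSign * coordMatrix 1 b) =
      (Algebra.traceMatrix ℚ b).map (algebraMap ℚ ℝ) := by
    ext i j
    rw [transpose_coordMatrix_mul (y := 1) (y' := 1) (fun _ ↦ zero_le_one) (fun _ ↦ mul_one _)]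
    simp [Algebra.traceMatrix_apply]
  have h3 := congrArg (fun M ↦ |Matrix.det M|) h2
  rw [← RingHom.mapMatrix_apply, ← RingHom.map_det, ← Algebra.discr_def] at h3
  simp only [Matrix.det_mul, Matrix.det_transpose, Matrix.det_diagonal, abs_mul,
    Finset.abs_prod, eq_ratCast] at h3
  have h4 (p : index K) : |indexSign p| = 1 := by
    rw [← abs_one (α := ℝ), ← sq_eq_sq_iff_abs_eq_abs, indexSign_sq, one_pow]
  simp only [h4, Finset.prod_const_one, one_mul] at h3
  rw [h1, Matrix.det_mul, Matrix.det_diagonal, mul_pow, ← h3, ← Finset.prod_pow, abs_mul_abs_self,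
    ← sq, mul_comm]
  congr 1
  refine prod_index _ _ (fun w ↦ ?_) fun w ↦ ?_
  · simp [indexPlace, Real.sq_sqrt (hy _), IsReal.mult_eq_one w.2]
  · simp [indexPlace, Real.sq_sqrt (hy _), IsComplex.mult_eq_two w.2]
    ring

lemma coordMatrix_det_ne_zero (hy : ∀ w, 0 < y w) (b : Basis (index K) ℚ K) :
    (coordMatrix y b).det ≠ 0 := by
  have h : (coordMatrix y b).det ^ 2 ≠ 0 := by
    rw [coordMatrix_det_sq fun w ↦ (hy w).le]
    have := Algebra.discr_not_zero_of_basis ℚ b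
    have h2 := Finset.prod_pos fun (w : InfinitePlace K) (_ : w ∈ Finset.univ) ↦
      pow_pos (hy w) w.mult
    positivity
  exact fun h' ↦ h (by simp [h'])

lemma tsum_basis_theta (hy : ∀ w, 0 < y w) (b : Basis (index K) ℚ K) :
    ∑' m : index K → ℤ, Real.exp (-Real.pi * placeForm y (∑ i, m i * b i)) =
      (√(|(Algebra.discr ℚ b : ℝ)| * ∏ w, y w ^ w.mult))⁻¹ *
        ∑' m : index K → ℤ, Real.exp (-Real.pi * placeForm y⁻¹ (∑ i, m i * b.traceDual i)) := by
  have hB := coordMatrix_det_ne_zero hy b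
  have h := tsum_gaussian hB
  have hinv : ((coordMatrix y b)⁻¹)ᵀ = diagonal indexSign * coordMatrix y⁻¹ b.traceDual := by
    rw [Matrix.transpose_nonsing_inv]
    refine Matrix.inv_eq_right_inv ?_
    ext i j
    rw [transpose_coordMatrix_mul (y' := y⁻¹) (fun w ↦ (hy w).le)
        (fun w ↦ mul_inv_cancel₀ (hy w).ne'),
      Basis.trace_mul_traceDual, Matrix.one_apply]
    split_ifs <;> simp
  have hsum (m : index K → ℤ) : ∑ i, (((coordMatrix y b)⁻¹)ᵀ *ᵥ intVec m) i ^ 2 =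
      placeForm y⁻¹ (∑ i, m i * b.traceDual i) := by
    rw [← sum_coordMatrix_mulVec_sq (y := y⁻¹) fun w ↦ inv_nonneg.mpr (hy w).le, hinv]
    refine Finset.sum_congr rfl fun i _ ↦ ?_
    rw [← Matrix.mulVec_mulVec, Matrix.mulVec_diagonal, mul_pow, indexSign_sq, one_mul]
  simp_rw [sum_coordMatrix_mulVec_sq fun w ↦ (hy w).le, hsum] at h
  rw [h, ← coordMatrix_det_sq fun w ↦ (hy w).le, Real.sqrt_sq_eq_abs]

end BasisTheta

section IdealTheta

open InfinitePlace mixedEmbedding Matrix Module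
open scoped Classical nonZeroDivisors ENNReal

variable {K : Type*} [Field K] [NumberField K]

/-- The integer combinations of a `ℚ`-basis, as a parametrization of the lattice it spans. -/
noncomputable def latticeEquiv (b : Basis (index K) ℚ K) :
    (index K → ℤ) ≃ Submodule.span ℤ (Set.range b) :=
  (b.restrictScalars ℤ).equivFun.symm.toEquiv

lemma coe_latticeEquiv (b : Basis (index K) ℚ K) (m : index K → ℤ) :
    (latticeEquiv b m : K) = ∑ i, m i * b i := by
  simp [latticeEquiv, Basis.equivFun_symm_apply]

/-- Parametrization of a fractional ideal by the coordinates in a basis spanning it. -/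
noncomputable def fracIdealEquiv (b : Basis (index K) ℚ K) (J : FractionalIdeal (𝓞 K)⁰ K)
    (hb : ∀ x, x ∈ Submodule.span ℤ (Set.range b) ↔ x ∈ J) :
    (index K → ℤ) ≃ {x : K // x ∈ J} :=
  (latticeEquiv b).trans (Equiv.subtypeEquivRight hb)

lemma coe_fracIdealEquiv (b : Basis (index K) ℚ K) (J : FractionalIdeal (𝓞 K)⁰ K)
    (hb : ∀ x, x ∈ Submodule.span ℤ (Set.range b) ↔ x ∈ J) (m : index K → ℤ) :
    (fracIdealEquiv b J hb m : K) = ∑ i, m i * b i :=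
  coe_latticeEquiv b m

variable (J : (FractionalIdeal (𝓞 K)⁰ K)ˣ)

noncomputable def indexEquivChooseBasis : Free.ChooseBasisIndex ℤ J ≃ index K :=
  Fintype.equivOfCardEq (by
    rw [← finrank_eq_card_basis (basisOfFractionalIdeal K J), Fintype.card_congr (indexEquiv K),
      Embeddings.card K ℂ])

/-- A `ℚ`-basis of `K` spanning the fractional ideal `J` over `ℤ`. -/
noncomputable def idealBasis : Basis (index K) ℚ K :=
  (basisOfFractionalIdeal K J).reindex (indexEquivChooseBasis J)

lemma mem_span_idealBasis (x : K) :
    x ∈ Submodule.span ℤ (Set.range (idealBasis J)) ↔ x ∈ J.1 := by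
  rw [idealBasis, Basis.range_reindex]
  exact mem_span_basisOfFractionalIdeal K

/-- The dual of a fractional ideal under the trace form. -/
noncomputable def dualIdeal : (FractionalIdeal (𝓞 K)⁰ K)ˣ :=
  Units.mk0 (FractionalIdeal.dual ℤ ℚ J.1) (FractionalIdeal.dual_ne_zero ℤ ℚ J.ne_zero)

lemma mem_span_traceDual_idealBasis (x : K) :
    x ∈ Submodule.span ℤ (Set.range (idealBasis J).traceDual) ↔ x ∈ (dualIdeal J).1 := by
  have h := Submodule.traceDual_span_of_basis ℤ (J.1 : Submodule (𝓞 K) K) (idealBasis J)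
    (by ext x; exact (mem_span_idealBasis J x).symm)
  rw [← h, Submodule.restrictScalars_mem, ← FractionalIdeal.coe_dual ℤ ℚ J.ne_zero]
  rfl

lemma abs_discr_idealBasis :
    |(Algebra.discr ℚ (idealBasis J) : ℝ)| =
      (FractionalIdeal.absNorm J.1 : ℝ) ^ 2 * |(discr K : ℝ)| := by
  let e : Free.ChooseBasisIndex ℤ (𝓞 K) ≃ Free.ChooseBasisIndex ℤ J :=
    Fintype.equivOfCardEq (by
      rw [← finrank_eq_card_basis (basisOfFractionalIdeal K J),
        ← finrank_eq_card_basis (integralBasis K)])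
  let b := (basisOfFractionalIdeal K J).reindex e.symm
  have h1 : Algebra.discr ℚ (idealBasis J) = Algebra.discr ℚ b := by
    rw [idealBasis, Basis.coe_reindex, Algebra.discr_reindex]
    simp only [b]
    rw [Basis.coe_reindex, Algebra.discr_reindex]
  have h2 : Algebra.discr ℚ b =
      (integralBasis K).det b ^ 2 * Algebra.discr ℚ (integralBasis K) := by
    rw [Basis.det_apply, ← Algebra.discr_of_matrix_vecMul, Basis.toMatrix_map_vecMul]
  have h3 := det_basisOfFractionalIdeal_eq_absNorm K J e
  rw [h1, h2, ← h3, ← coe_discr]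
  push_cast
  rw [abs_mul, abs_pow]

lemma dualIdeal_dualIdeal : dualIdeal (dualIdeal J) = J := by
  ext1
  simp [dualIdeal]

lemma dualIdeal_eq : dualIdeal J = dualIdeal 1 * J⁻¹ := by
  ext1
  simp [dualIdeal, FractionalIdeal.dual_eq_mul_inv ℤ ℚ J.1]

variable {y : InfinitePlace K → ℝ}

lemma summable_theta (hy : ∀ w, 0 < y w) :
    Summable fun a : {x : K // x ∈ J.1} ↦ Real.exp (-Real.pi * placeForm y a) := by
  rw [← (fracIdealEquiv (idealBasis J) J.1 (mem_span_idealBasis J)).summable_iff]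
  refine (summable_gaussian (coordMatrix_det_ne_zero hy (idealBasis J))).congr fun m ↦ ?_
  rw [sum_coordMatrix_mulVec_sq fun w ↦ (hy w).le, Function.comp_apply, coe_fracIdealEquiv]

/-- The theta series of a fractional ideal. -/
noncomputable def idealTheta (y : InfinitePlace K → ℝ) : ℝ≥0∞ :=
  ∑' a : {x : K // x ∈ J.1}, ENNReal.ofReal (Real.exp (-Real.pi * placeForm y a))

theorem idealTheta_eq (hy : ∀ w, 0 < y w) :
    idealTheta J y = ENNReal.ofReal (√((FractionalIdeal.absNorm J.1 : ℝ) ^ 2 *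
      |(discr K : ℝ)| * ∏ w, y w ^ w.mult))⁻¹ * idealTheta (dualIdeal J) y⁻¹ := by
  have hy' (w) : 0 < y⁻¹ w := inv_pos.mpr (hy w)
  rw [idealTheta, idealTheta, ← ENNReal.ofReal_tsum_of_nonneg (fun _ ↦ (Real.exp_pos _).le)
    (summable_theta J hy), ← ENNReal.ofReal_tsum_of_nonneg (fun _ ↦ (Real.exp_pos _).le)
    (summable_theta (dualIdeal J) hy'), ← ENNReal.ofReal_mul (by positivity),
    ← (fracIdealEquiv (idealBasis J) J.1 (mem_span_idealBasis J)).tsum_eq,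
    ← (fracIdealEquiv (idealBasis J).traceDual (dualIdeal J).1
      (mem_span_traceDual_idealBasis J)).tsum_eq]
  simp_rw [coe_fracIdealEquiv]
  rw [tsum_basis_theta hy, abs_discr_idealBasis]

lemma mult_cast_pos {K : Type*} [Field K] (w : InfinitePlace K) : (0 : ℝ) < w.mult :=
  Nat.cast_pos.mpr w.mult_pos

lemma mul_placeForm_one_le {m : ℝ} (hm : ∀ w, m ≤ y w) (a : K) :
    m * placeForm 1 a ≤ placeForm y a := by
  rw [placeForm, placeForm, Finset.mul_sum]
  refine Finset.sum_le_sum fun w _ ↦ ?_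
  have := mul_le_mul_of_nonneg_left (hm w) (by positivity : 0 ≤ w.mult * w a ^ 2)
  simp only [Pi.one_apply]
  linarith

lemma placeForm_zero : placeForm y 0 = 0 := by simp [placeForm]

lemma placeForm_one_pos {a : K} (ha : a ≠ 0) : 0 < placeForm 1 a := by
  refine Finset.sum_pos (fun w _ ↦ ?_) Finset.univ_nonempty
  have := mult_cast_pos w
  have := w.pos_iff.mpr ha
  simp only [Pi.one_apply]
  positivity

lemma summable_placeForm_one_pow_inv {k : ℕ} (hk : finrank ℚ K < 2 * k) :
    Summable fun a : {x : K // x ∈ J.1} ↦ (placeForm 1 (a : K) ^ k)⁻¹ := by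
  rw [← (fracIdealEquiv (idealBasis J) J.1 (mem_span_idealBasis J)).summable_iff]
  obtain ⟨c, hc, h⟩ := exists_mul_norm_sq_le_sum_mulVec_sq
    (coordMatrix_det_ne_zero (fun _ ↦ zero_lt_one) (idealBasis J))
  have hs := (summable_norm_rpow_intVec (ι := index K) (r := -(2 * k : ℕ)) (by
    rw [neg_lt_neg_iff, Fintype.card_congr (indexEquiv K), Embeddings.card K ℂ]
    exact_mod_cast hk)).mul_left (c ^ k)⁻¹
  refine .of_nonneg_of_le (fun m ↦ ?_) (fun m ↦ ?_) hs
  · have : 0 ≤ placeForm 1 ((fracIdealEquiv (idealBasis J) J.1 (mem_span_idealBasis J) m : K)) :=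
      Finset.sum_nonneg fun w _ ↦ by simp only [Pi.one_apply]; positivity
    simp only [Function.comp_apply]
    positivity
  · have h1 := h (intVec m)
    rw [sum_coordMatrix_mulVec_sq fun w ↦ zero_le_one,
      ← coe_fracIdealEquiv (idealBasis J) J.1 (mem_span_idealBasis J)] at h1
    rcases eq_or_ne m 0 with rfl | hm
    · have hz : (fracIdealEquiv (idealBasis J) J.1 (mem_span_idealBasis J) 0 : K) = 0 := by
        simp [coe_fracIdealEquiv]
      rw [Function.comp_apply, hz, placeForm_zero, zero_pow (by omega), _root_.inv_zero]
      positivity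
    · have hm' : 0 < ‖intVec m‖ := by rw [norm_intVec]; exact norm_pos_iff.mpr hm
      rw [Real.rpow_neg hm'.le, Real.rpow_natCast, pow_mul, ← mul_inv, ← mul_pow]
      simp only [Function.comp_apply]
      gcongr
      exact h1

end IdealTheta

section UnitAverage

open InfinitePlace Module Units Units.dirichletUnitTheorem
open scoped Classical nonZeroDivisors ENNReal

variable {K : Type*} [Field K] [NumberField K]

/-- The exponents of the weights on the norm-one hypersurface with logarithmic coordinates `c`. -/
noncomputable def logWeight (c : logSpace K) (w : InfinitePlace K) : ℝ :=
  if h : w = w₀ then -(2 * ∑ v, c v) / (w₀ : InfinitePlace K).mult else 2 * c ⟨w, h⟩ / w.mult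

lemma logWeight_add (c c' : logSpace K) : logWeight (c + c') = logWeight c + logWeight c' := by
  ext w
  by_cases h : w = w₀
  · simp [logWeight, h, Finset.sum_add_distrib]
    ring
  · simp [logWeight, h]
    ring

lemma logWeight_neg (c : logSpace K) : logWeight (-c) = -logWeight c := by
  ext w
  by_cases h : w = w₀
  · simp [logWeight, h]
    ring
  · simp [logWeight, h]
    ring

lemma continuous_logWeight (w : InfinitePlace K) : Continuous fun c ↦ logWeight c w := by
  by_cases h : w = w₀
  · simp only [logWeight, h, dite_true]
    fun_prop
  · simp only [logWeight, h, dite_false]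
    fun_prop

lemma sum_mult_mul_logWeight (c : logSpace K) : ∑ w, w.mult * logWeight c w = 0 := by
  rw [Fintype.sum_eq_add_sum_subtype_ne _ w₀]
  have h1 : ((w₀ : InfinitePlace K).mult : ℝ) * logWeight c w₀ = -(2 * ∑ v, c v) := by
    have := (mult_cast_pos (w₀ : InfinitePlace K)).ne'
    simp only [logWeight, dite_true]
    field_simp
  have h2 (w : {w : InfinitePlace K // w ≠ w₀}) : w.1.mult * logWeight c w.1 = 2 * c w := by
    have := (mult_cast_pos w.1).ne'
    simp only [logWeight, w.2, dite_false]
    field_simp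
  simp_rw [h1, h2, ← Finset.mul_sum]
  ring

lemma logWeight_logEmbedding (u : (𝓞 K)ˣ) (w : InfinitePlace K) :
    logWeight (logEmbedding K (Additive.ofMul u)) w = 2 * Real.log (w (u : K)) := by
  have := (mult_cast_pos w).ne'
  by_cases h : w = w₀
  · subst h
    simp only [logWeight, dite_true]
    rw [sum_logEmbedding_component]
    field_simp
  · simp only [logWeight, h, dite_false, logEmbedding_component]
    field_simp

/-- The weights at the infinite places attached to a scale `t` and logarithmic coordinates `c`. -/
noncomputable def weight (t : ℝ) (c : logSpace K) (w : InfinitePlace K) : ℝ :=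
  t * Real.exp (logWeight c w)

lemma weight_pos {t : ℝ} (ht : 0 < t) (c : logSpace K) (w : InfinitePlace K) :
    0 < weight t c w := mul_pos ht (Real.exp_pos _)

lemma weight_inv (t : ℝ) (c : logSpace K) : (weight t c)⁻¹ = weight t⁻¹ (-c) := by
  ext w
  rw [Pi.inv_apply, weight, weight, _root_.mul_inv, logWeight_neg, Pi.neg_apply, Real.exp_neg]

lemma prod_weight (t : ℝ) (c : logSpace K) :
    ∏ w, weight t c w ^ w.mult = t ^ finrank ℚ K := by
  simp_rw [weight, mul_pow, Finset.prod_mul_distrib, Finset.prod_pow_eq_pow_sum, sum_mult_eq,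
    ← Real.exp_nat_mul]
  rw [← Real.exp_sum, sum_mult_mul_logWeight, Real.exp_zero, mul_one]

lemma placeForm_weight_unit_mul (t : ℝ) (c : logSpace K) (u : (𝓞 K)ˣ) (a : K) :
    placeForm (weight t c) (u * a) =
      placeForm (weight t (c + logEmbedding K (Additive.ofMul u))) a := by
  refine Finset.sum_congr rfl fun w _ ↦ ?_
  have : Real.exp (2 * Real.log (w (u : K))) = w (u : K) ^ 2 := by
    rw [two_mul, Real.exp_add, Real.exp_log (w.pos_iff.mpr (by simp)), sq]
  rw [weight, weight, logWeight_add, Pi.add_apply, logWeight_logEmbedding, Real.exp_add, this,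
    map_mul]
  ring

lemma continuous_placeForm_weight (a : K) :
    Continuous fun p : ℝ × logSpace K ↦ placeForm (weight p.1 p.2) a := by
  refine continuous_finsetSum _ fun w _ ↦ ?_
  have := (continuous_logWeight w).comp (continuous_snd (X := ℝ) (Y := logSpace K))
  simp only [weight]
  fun_prop

variable (K) in
/-- A fundamental domain for the action of the units on the logarithmic space. -/
noncomputable def unitDomain : Set (logSpace K) :=
  ZSpan.fundamentalDomain ((basisUnitLattice K).ofZLatticeBasis ℝ (unitLattice K))

variable (K) in
lemma isAddFundamentalDomain_unitDomain :
    IsAddFundamentalDomain (unitLattice K) (unitDomain K) (volume : Measure (logSpace K)) :=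
  ZLattice.isAddFundamentalDomain (basisUnitLattice K) _

variable (K) in
lemma volume_unitDomain_ne_top : volume (unitDomain K) ≠ ∞ :=
  (ZSpan.fundamentalDomain_isBounded _).measure_lt_top.ne

variable (K) in
lemma volume_unitDomain_ne_zero : volume (unitDomain K) ≠ 0 :=
  ZSpan.measure_fundamentalDomain_ne_zero _

variable (K) in
lemma exists_le_exp_logWeight :
    ∃ m > 0, ∀ c ∈ unitDomain K, ∀ w, m ≤ Real.exp (logWeight c w) := by
  have hb : IsCompact (closure (unitDomain K)) :=
    (ZSpan.fundamentalDomain_isBounded _).isCompact_closure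
  have (w : InfinitePlace K) : ∃ m > 0, ∀ c ∈ unitDomain K, m ≤ Real.exp (logWeight c w) := by
    obtain ⟨B, hB⟩ := (hb.image (continuous_logWeight w)).bddBelow
    exact ⟨Real.exp B, Real.exp_pos _, fun c hc ↦
      Real.exp_le_exp.mpr (hB ⟨c, subset_closure hc, rfl⟩)⟩
  choose m hm hmc using this
  refine ⟨Finset.univ.inf' Finset.univ_nonempty m,
    (Finset.lt_inf'_iff _).mpr fun w _ ↦ hm w, fun c hc w ↦ ?_⟩
  exact (Finset.inf'_le _ (Finset.mem_univ w)).trans (hmc w c hc)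

instance : VAddInvariantMeasure (unitLattice K) (logSpace K) volume :=
  inferInstanceAs (VAddInvariantMeasure (unitLattice K).toAddSubgroup (logSpace K) volume)

variable (J : (FractionalIdeal (𝓞 K)⁰ K)ˣ)

lemma idealTheta_weight_add (t : ℝ) (c : logSpace K) (u : (𝓞 K)ˣ) :
    idealTheta J (weight t (c + logEmbedding K (Additive.ofMul u))) =
      idealTheta J (weight t c) := by
  let e : {x : K // x ∈ J.1} ≃ {x : K // x ∈ J.1} :=
    { toFun := fun x ↦ ⟨u * x, Submodule.smul_mem (J.1 : Submodule (𝓞 K) K) (u : 𝓞 K) x.2⟩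
      invFun := fun x ↦ ⟨(u⁻¹ : (𝓞 K)ˣ) * x,
        Submodule.smul_mem (J.1 : Submodule (𝓞 K) K) ((u⁻¹ : (𝓞 K)ˣ) : 𝓞 K) x.2⟩
      left_inv := fun x ↦ by simp
      right_inv := fun x ↦ by simp }
  refine (tsum_congr fun a ↦ ?_).trans (e.tsum_eq fun a ↦
    ENNReal.ofReal (Real.exp (-Real.pi * placeForm (weight t c) a)))
  rw [← placeForm_weight_unit_mul]
  rfl

/-- The average of the theta series of a fractional ideal over the norm-one hypersurface modulo
units. -/
noncomputable def thetaAverage (t : ℝ) : ℝ≥0∞ := ∫⁻ c in unitDomain K, idealTheta J (weight t c)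

lemma setLIntegral_unitDomain_neg (f : logSpace K → ℝ≥0∞)
    (hf : ∀ (u : (𝓞 K)ˣ) c, f (c + logEmbedding K (Additive.ofMul u)) = f c) :
    ∫⁻ c in unitDomain K, f (-c) = ∫⁻ c in unitDomain K, f c := by
  have hdom := isAddFundamentalDomain_unitDomain K
  have hdom' : IsAddFundamentalDomain (unitLattice K) (Neg.neg ⁻¹' unitDomain K)
      (volume : Measure (logSpace K)) :=
    hdom.preimage_of_equiv (Measure.measurePreserving_neg volume).quasiMeasurePreserving
      (e := Neg.neg) neg_involutive.bijective fun g x ↦ by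
        simp [Submodule.vadd_def, add_comm]
  rw [hdom.setLIntegral_eq hdom' f]
  · have h := Measure.measurePreserving_neg (volume : Measure (logSpace K))
    exact (h.setLIntegral_comp_preimage_emb (MeasurableEquiv.neg (logSpace K)).measurableEmbedding
      (fun c ↦ f (-c)) (unitDomain K)).symm.trans (by simp)
  · rintro ⟨g, hg⟩ x
    obtain ⟨u, -, rfl⟩ := hg
    rw [Submodule.vadd_def, vadd_eq_add, add_comm]
    exact hf u.toMul x

end UnitAverage

section FEPair

open InfinitePlace Module Units Units.dirichletUnitTheorem Set
open scoped Classical nonZeroDivisors ENNReal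

variable {K : Type*} [Field K] [NumberField K] (J : (FractionalIdeal (𝓞 K)⁰ K)ˣ)

/-- The root number in the functional equation of the theta series of `J`. -/
noncomputable def thetaRoot : ℝ :=
  (√((FractionalIdeal.absNorm J.1 : ℝ) ^ 2 * |(discr K : ℝ)|))⁻¹

lemma absNorm_pos : (0 : ℝ) < FractionalIdeal.absNorm J.1 := by
  have h1 := FractionalIdeal.absNorm_nonneg J.1
  have h2 : FractionalIdeal.absNorm J.1 ≠ 0 :=
    FractionalIdeal.absNorm_eq_zero_iff.not.mpr J.ne_zero
  exact_mod_cast h1.lt_of_ne' h2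

variable (K) in
lemma abs_discr_pos : (0 : ℝ) < |(discr K : ℝ)| :=
  abs_pos.mpr (Int.cast_ne_zero.mpr (discr_ne_zero K))

lemma thetaRoot_pos : 0 < thetaRoot J := by
  have := absNorm_pos J
  have := abs_discr_pos K
  unfold thetaRoot
  positivity

lemma thetaAverage_inv {t : ℝ} (ht : 0 < t) :
    thetaAverage J (1 / t) = ENNReal.ofReal (thetaRoot J * t ^ ((finrank ℚ K : ℝ) / 2)) *
      thetaAverage (dualIdeal J) t := by
  have h1 (c : logSpace K) : idealTheta J (weight (1 / t) c) =
      ENNReal.ofReal (thetaRoot J * t ^ ((finrank ℚ K : ℝ) / 2)) *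
        idealTheta (dualIdeal J) (weight t (-c)) := by
    rw [idealTheta_eq J (weight_pos (one_div_pos.mpr ht) c), prod_weight, weight_inv,
      one_div, inv_inv]
    congr 2
    have h2 : √(t⁻¹ ^ finrank ℚ K) = (t ^ ((finrank ℚ K : ℝ) / 2))⁻¹ := by
      rw [inv_pow, Real.sqrt_inv, Real.sqrt_eq_rpow, ← Real.rpow_natCast_mul ht.le,
        mul_one_div]
    rw [thetaRoot, Real.sqrt_mul (by positivity), _root_.mul_inv, h2, inv_inv]
  rw [thetaAverage, thetaAverage]
  simp_rw [h1]
  rw [lintegral_const_mul' _ _ ENNReal.ofReal_ne_top, setLIntegral_unitDomain_neg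
    (fun c ↦ idealTheta (dualIdeal J) (weight t c))
    fun u c ↦ idealTheta_weight_add (dualIdeal J) t c u]

/-- The contribution of the nonzero elements to the theta series. -/
noncomputable def idealThetaTail (y : InfinitePlace K → ℝ) : ℝ≥0∞ :=
  ∑' a : {x : Kˣ // (x : K) ∈ J.1}, ENNReal.ofReal (Real.exp (-Real.pi * placeForm y (a.1 : K)))

lemma tsum_unit_subtype (f : K → ℝ≥0∞) (hf : f 0 = 0) :
    ∑' a : {x : Kˣ // (x : K) ∈ J.1}, f (a.1 : K) = ∑' a : {x : K // x ∈ J.1}, f a := by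
  let g : {x : Kˣ // (x : K) ∈ J.1} → {x : K // x ∈ J.1} := fun a ↦ ⟨a.1, a.2⟩
  refine Function.Injective.tsum_eq (g := g) (f := fun a ↦ f a) (fun a b h ↦ ?_) fun a ha ↦ ?_
  · exact Subtype.ext (Units.ext (congrArg Subtype.val h))
  · have : (a : K) ≠ 0 := fun h ↦ ha (by show f a = 0; rw [h, hf])
    exact ⟨⟨Units.mk0 a this, a.2⟩, rfl⟩

lemma idealTheta_eq_one_add (y : InfinitePlace K → ℝ) :
    idealTheta J y = 1 + idealThetaTail J y := by
  rw [idealTheta, ENNReal.tsum_eq_add_tsum_ite ⟨0, Submodule.zero_mem _⟩]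
  simp only [placeForm_zero, mul_zero, Real.exp_zero, ENNReal.ofReal_one]
  congr 1
  have := tsum_unit_subtype J
    (fun a ↦ if a = 0 then 0 else ENNReal.ofReal (Real.exp (-Real.pi * placeForm y a)))
    (if_pos rfl)
  simp only [Units.ne_zero, if_false] at this
  rw [idealThetaTail, this]
  exact tsum_congr fun a ↦ by simp [Subtype.ext_iff]

noncomputable def thetaTail (t : ℝ) : ℝ≥0∞ :=
  ∫⁻ c in unitDomain K, idealThetaTail J (weight t c)

lemma thetaAverage_eq_add (t : ℝ) :
    thetaAverage J t = volume (unitDomain K) + thetaTail J t := by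
  simp_rw [thetaAverage, idealTheta_eq_one_add]
  rw [lintegral_add_left measurable_const]
  simp [thetaTail]

lemma exists_thetaTail_le {k : ℕ} (hk : finrank ℚ K < 2 * k) :
    ∃ C : ℝ, 0 ≤ C ∧ ∀ t : ℝ, 0 < t → thetaTail J t ≤ ENNReal.ofReal (C * (t ^ k)⁻¹) := by
  obtain ⟨m, hm, hmc⟩ := exists_le_exp_logWeight K
  have hs := summable_placeForm_one_pow_inv J hk
  let S := ∑' a : {x : K // x ∈ J.1}, (placeForm 1 (a : K) ^ k)⁻¹
  have hnn (a : K) : 0 ≤ placeForm 1 a :=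
    Finset.sum_nonneg fun w _ ↦ by simp only [Pi.one_apply]; positivity
  have hS : 0 ≤ S := tsum_nonneg fun a ↦ inv_nonneg.mpr (pow_nonneg (hnn a) _)
  let A := (k.factorial : ℝ) * ((Real.pi * m) ^ k)⁻¹
  have hA : 0 ≤ A := by have := Real.pi_pos; positivity
  refine ⟨A * S * (volume (unitDomain K)).toReal, by positivity, fun t ht ↦ ?_⟩
  have hterm (c) (hc : c ∈ unitDomain K) (a : Kˣ) :
      Real.exp (-Real.pi * placeForm (weight t c) (a : K)) ≤
        A * (t ^ k)⁻¹ * (placeForm 1 (a : K) ^ k)⁻¹ := by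
    have h1 : t * m * placeForm 1 (a : K) ≤ placeForm (weight t c) (a : K) :=
      mul_placeForm_one_le (fun w ↦ mul_le_mul_of_nonneg_left (hmc c hc w) ht.le) _
    have h2 : 0 < Real.pi * (t * m * placeForm 1 (a : K)) := by
      have := placeForm_one_pos a.ne_zero
      have := Real.pi_pos
      positivity
    calc _ ≤ Real.exp (-(Real.pi * (t * m * placeForm 1 (a : K)))) := by
            rw [Real.exp_le_exp, neg_mul, neg_le_neg_iff]
            exact mul_le_mul_of_nonneg_left h1 Real.pi_pos.le
      _ ≤ _ := exp_neg_le_factorial_div_pow h2 k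
      _ = _ := by
        simp only [A, mul_pow]
        field_simp
  have hle (c) (hc : c ∈ unitDomain K) :
      idealThetaTail J (weight t c) ≤ ENNReal.ofReal (A * (t ^ k)⁻¹ * S) := by
    calc _ ≤ ∑' a : {x : Kˣ // (x : K) ∈ J.1},
          ENNReal.ofReal (A * (t ^ k)⁻¹ * (placeForm 1 (a.1 : K) ^ k)⁻¹) :=
          ENNReal.tsum_le_tsum fun a ↦ ENNReal.ofReal_le_ofReal (hterm c hc a)
      _ = ∑' a : {x : K // x ∈ J.1},
          ENNReal.ofReal (A * (t ^ k)⁻¹ * (placeForm 1 (a : K) ^ k)⁻¹) :=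
          tsum_unit_subtype J
            (fun a ↦ ENNReal.ofReal (A * (t ^ k)⁻¹ * (placeForm 1 a ^ k)⁻¹))
            (by simp [placeForm_zero, show k ≠ 0 by omega])
      _ = _ := by
        rw [← ENNReal.ofReal_tsum_of_nonneg _ (hs.mul_left _), tsum_mul_left]
        exact fun a ↦ mul_nonneg (by positivity) (inv_nonneg.mpr (pow_nonneg (hnn a) _))
  calc thetaTail J t ≤ ∫⁻ c in unitDomain K, ENNReal.ofReal (A * (t ^ k)⁻¹ * S) :=
        setLIntegral_mono measurable_const hle
    _ = ENNReal.ofReal (A * (t ^ k)⁻¹ * S) * ENNReal.ofReal (volume (unitDomain K)).toReal := by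
        rw [setLIntegral_const, ENNReal.ofReal_toReal (volume_unitDomain_ne_top K)]
    _ = _ := by
        rw [← ENNReal.ofReal_mul (by positivity)]
        congr 1
        ring

lemma thetaTail_ne_top {t : ℝ} (ht : 0 < t) : thetaTail J t ≠ ∞ := by
  obtain ⟨C, -, h⟩ := exists_thetaTail_le J (k := finrank ℚ K + 1) (by omega)
  exact ((h t ht).trans_lt ENNReal.ofReal_lt_top).ne

lemma thetaAverage_ne_top {t : ℝ} (ht : 0 < t) : thetaAverage J t ≠ ∞ := by
  rw [thetaAverage_eq_add]
  exact ENNReal.add_ne_top.mpr ⟨volume_unitDomain_ne_top K, thetaTail_ne_top J ht⟩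

lemma thetaAverage_antitone : Antitone (thetaAverage J) := by
  intro t t' h
  refine lintegral_mono fun c ↦ ENNReal.tsum_le_tsum fun a ↦ ENNReal.ofReal_le_ofReal ?_
  rw [Real.exp_le_exp, neg_mul, neg_mul, neg_le_neg_iff]
  refine mul_le_mul_of_nonneg_left (Finset.sum_le_sum fun w _ ↦ ?_) Real.pi_pos.le
  unfold weight
  gcongr

lemma locallyIntegrableOn_thetaAverage :
    LocallyIntegrableOn (fun t ↦ ((thetaAverage J t).toReal : ℂ)) (Ioi 0) := by
  rw [locallyIntegrableOn_iff isOpen_Ioi.isLocallyClosed]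
  intro s hs hsc
  refine Integrable.ofReal (AntitoneOn.integrableOn_isCompact hsc fun t ht t' _ h ↦ ?_)
  exact ENNReal.toReal_mono (thetaAverage_ne_top J (hs ht)) (thetaAverage_antitone J h)

lemma thetaAverage_sub_isBigO (r : ℝ) :
    (fun t ↦ ((thetaAverage J t).toReal : ℂ) - ((volume (unitDomain K)).toReal : ℂ))
      =O[atTop] (· ^ r) := by
  obtain ⟨k, hk⟩ := exists_nat_ge (max (finrank ℚ K + 1 : ℝ) (-r))
  have hk1 : finrank ℚ K + 1 ≤ k := by exact_mod_cast (le_max_left _ _).trans hk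
  obtain ⟨C, hC, h⟩ := exists_thetaTail_le J (k := k) (by omega)
  refine Asymptotics.IsBigO.of_bound C ?_
  filter_upwards [eventually_ge_atTop 1] with t ht
  have ht0 : 0 < t := by linarith
  rw [thetaAverage_eq_add, ENNReal.toReal_add (volume_unitDomain_ne_top K)
    (thetaTail_ne_top J ht0), ofReal_add, add_sub_cancel_left, Complex.norm_real,
    Real.norm_of_nonneg ENNReal.toReal_nonneg, Real.norm_of_nonneg (by positivity)]
  refine (ENNReal.toReal_mono ENNReal.ofReal_ne_top (h t ht0)).trans ?_
  rw [ENNReal.toReal_ofReal (by positivity), ← Real.rpow_natCast, ← Real.rpow_neg ht0.le]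
  exact mul_le_mul_of_nonneg_left (Real.rpow_le_rpow_of_exponent_le ht
    (by linarith [le_max_right (finrank ℚ K + 1 : ℝ) (-r)])) hC

/-- The functional equation of the averaged theta series of a fractional ideal and its dual. -/
noncomputable def thetaPair : WeakFEPair ℂ where
  f t := (thetaAverage J t).toReal
  g t := (thetaAverage (dualIdeal J) t).toReal
  k := finrank ℚ K / 2
  ε := thetaRoot J
  f₀ := (volume (unitDomain K)).toReal
  g₀ := (volume (unitDomain K)).toReal
  hf_int := locallyIntegrableOn_thetaAverage J
  hg_int := locallyIntegrableOn_thetaAverage (dualIdeal J)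
  hk := div_pos (Nat.cast_pos.mpr finrank_pos) zero_lt_two
  hε := ofReal_ne_zero.mpr (thetaRoot_pos J).ne'
  h_feq t ht := by
    have ht : 0 < t := ht
    have := thetaRoot_pos J
    rw [thetaAverage_inv J ht, ENNReal.toReal_mul, ENNReal.toReal_ofReal (by positivity),
      _root_.smul_eq_mul]
    push_cast
    rfl
  hf_top := thetaAverage_sub_isBigO J
  hg_top := thetaAverage_sub_isBigO (dualIdeal J)

end FEPair

section Archimedean

open InfinitePlace Module Units Units.dirichletUnitTheorem Set
open scoped Classical ENNReal

lemma setLIntegral_Ioi_eq_lintegral_exp (g : ℝ → ℝ≥0∞) :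
    ∫⁻ t in Ioi 0, g t = ∫⁻ x, ENNReal.ofReal (Real.exp x) * g (Real.exp x) := by
  have := lintegral_image_eq_lintegral_abs_deriv_mul (s := univ) (f := Real.exp) (f' := Real.exp)
    MeasurableSet.univ (fun x _ ↦ (Real.hasDerivAt_exp x).hasDerivWithinAt)
    Real.exp_injective.injOn g
  simpa [Real.range_exp] using this

lemma lintegral_exp_mul_exp_neg {a r : ℝ} (ha : 0 < a) (hr : 0 < r) :
    ∫⁻ x : ℝ, ENNReal.ofReal (Real.exp (a * x) * Real.exp (-(r * Real.exp x))) =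
      ENNReal.ofReal ((1 / r) ^ a * Real.Gamma a) := by
  have h1 := Real.integral_rpow_mul_exp_neg_mul_Ioi ha hr
  have hpos : 0 < (1 / r) ^ a * Real.Gamma a :=
    mul_pos (Real.rpow_pos_of_pos (by positivity) _) (Real.Gamma_pos_of_pos ha)
  have h2 : IntegrableOn (fun t : ℝ ↦ t ^ (a - 1) * Real.exp (-(r * t))) (Ioi 0) := by
    by_contra h
    rw [integral_undef h] at h1
    exact hpos.ne h1
  rw [← h1, ofReal_integral_eq_lintegral_ofReal h2, setLIntegral_Ioi_eq_lintegral_exp]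
  · refine lintegral_congr fun x ↦ ?_
    rw [← ENNReal.ofReal_mul (Real.exp_pos x).le, ← mul_assoc, ← Real.exp_mul,
      ← Real.exp_add x, mul_sub_one, add_sub_cancel, mul_comm x a]
  · refine (ae_restrict_iff' measurableSet_Ioi).mpr (.of_forall fun t (ht : 0 < t) ↦ ?_)
    change 0 ≤ _
    positivity

lemma lintegral_prod_exp_mul_exp_neg {ι : Type*} [Fintype ι] {a r : ι → ℝ} (ha : ∀ i, 0 < a i)
    (hr : ∀ i, 0 < r i) :
    ∫⁻ x : ι → ℝ, ENNReal.ofReal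
      (∏ i, (Real.exp (a i * x i) * Real.exp (-(r i * Real.exp (x i))))) =
      ENNReal.ofReal (∏ i, ((1 / r i) ^ a i * Real.Gamma (a i))) := by
  let f (i : ι) (x : ℝ) : ℝ := Real.exp (a i * x) * Real.exp (-(r i * Real.exp x))
  have hf (i) (x) : 0 ≤ f i x := by positivity
  have hint (i) : Integrable (f i) := by
    refine ⟨by fun_prop, ?_⟩
    rw [hasFiniteIntegral_iff_ofReal (.of_forall (hf i)), lintegral_exp_mul_exp_neg (ha i) (hr i)]
    exact ENNReal.ofReal_lt_top
  have hval (i) : ∫ x, f i x = (1 / r i) ^ a i * Real.Gamma (a i) := by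
    have h0 : 0 < 1 / r i := one_div_pos.mpr (hr i)
    have := (Real.Gamma_pos_of_pos (ha i)).le
    rw [integral_eq_lintegral_of_nonneg_ae (.of_forall (hf i)) (by fun_prop),
      lintegral_exp_mul_exp_neg (ha i) (hr i), ENNReal.toReal_ofReal (by positivity)]
  simp_rw [← hval]
  rw [← integral_fintype_prod_volume_eq_prod, ofReal_integral_eq_lintegral_ofReal]
  · exact Integrable.fintype_prod hint
  · exact .of_forall fun x ↦ Finset.prod_nonneg fun i _ ↦ hf i _

variable {K : Type*} [Field K] [NumberField K]

/-- The linear isomorphism sending a logarithmic scale and a point of the logarithmic space to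
the logarithms of the corresponding weights. -/
noncomputable def logWeightEquiv : (ℝ × logSpace K) ≃ₗ[ℝ] (InfinitePlace K → ℝ) :=
  LinearEquiv.ofInjectiveOfFinrankEq
    { toFun := fun p w ↦ p.1 + logWeight p.2 w
      map_add' := fun p q ↦ by
        ext w
        simp only [Prod.fst_add, Prod.snd_add, logWeight_add, Pi.add_apply]
        ring
      map_smul' := fun r p ↦ by
        ext w
        by_cases h : w = w₀
        · simp [logWeight, h, ← Finset.mul_sum]
          ring
        · simp [logWeight, h]
          ring }
    (by
      rw [← LinearMap.ker_eq_bot, LinearMap.ker_eq_bot']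
      rintro ⟨x, c⟩ h
      have h (w) : x + logWeight c w = 0 := congrFun h w
      have hx : x = 0 := by
        have h1 : ∑ w : InfinitePlace K, (w.mult : ℝ) * (x + logWeight c w) = 0 := by simp [h]
        simp_rw [mul_add, Finset.sum_add_distrib, sum_mult_mul_logWeight, add_zero,
          ← Finset.sum_mul, ← Nat.cast_sum, sum_mult_eq] at h1
        exact (mul_eq_zero.mp h1).resolve_left (Nat.cast_ne_zero.mpr finrank_pos.ne')
      subst hx
      refine Prod.ext rfl (funext fun w ↦ ?_)
      have := h w.1
      simpa [logWeight, w.2] using this)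
    (by
      rw [finrank_prod, finrank_self, finrank_fintype_fun_eq_card, finrank_fintype_fun_eq_card,
        Fintype.card_subtype_compl, Fintype.card_subtype_eq]
      have : 0 < Fintype.card (InfinitePlace K) := Fintype.card_pos
      omega)

@[simp] lemma logWeightEquiv_apply (p : ℝ × logSpace K) (w : InfinitePlace K) :
    logWeightEquiv p w = p.1 + logWeight p.2 w := rfl

variable (K) in
lemma exists_lintegral_logWeightEquiv :
    ∃ C : ℝ, 0 < C ∧ ∀ f : (InfinitePlace K → ℝ) → ℝ≥0∞, Measurable f →
      ∫⁻ p : ℝ × logSpace K, f (logWeightEquiv p) = ENNReal.ofReal C * ∫⁻ x, f x := by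
  let L := (logWeightEquiv (K := K)).toContinuousLinearEquiv
  have h0 : (volume : Measure (ℝ × logSpace K)).IsAddHaarMeasure :=
    inferInstanceAs
      ((volume : Measure ℝ).prod (volume : Measure (logSpace K))).IsAddHaarMeasure
  have h1 : (Measure.map L (volume : Measure (ℝ × logSpace K))).IsAddHaarMeasure :=
    L.isAddHaarMeasure_map volume
  let μ := Measure.map L (volume : Measure (ℝ × logSpace K))
  have h2 := Measure.isAddLeftInvariant_eq_smul μ volume
  refine ⟨Measure.addHaarScalarFactor μ volume,
    Measure.addHaarScalarFactor_pos_of_isAddHaarMeasure μ volume, fun f hf ↦ ?_⟩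
  have h3 : ∫⁻ x, f x ∂μ = ∫⁻ p : ℝ × logSpace K, f (logWeightEquiv p) :=
    lintegral_map hf L.continuous.measurable
  have h4 : ∫⁻ x, f x ∂μ = ∫⁻ x, f x ∂(Measure.addHaarScalarFactor μ volume • volume) :=
    congrArg (fun ν ↦ ∫⁻ x, f x ∂ν) h2
  rw [← h3, h4, lintegral_smul_measure, ENNReal.ofReal_coe_nnreal]
  rfl

variable (K) in
/-- The ratio of the Haar measures appearing in the passage to logarithmic coordinates. -/
noncomputable def logVolume : ℝ := (exists_lintegral_logWeightEquiv K).choose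

variable (K) in
lemma logVolume_pos : 0 < logVolume K := (exists_lintegral_logWeightEquiv K).choose_spec.1

lemma lintegral_logWeightEquiv {f : (InfinitePlace K → ℝ) → ℝ≥0∞} (hf : Measurable f) :
    ∫⁻ p : ℝ × logSpace K, f (logWeightEquiv p) = ENNReal.ofReal (logVolume K) * ∫⁻ x, f x :=
  (exists_lintegral_logWeightEquiv K).choose_spec.2 f hf

variable (K) in
/-- The Gamma factor of the Dedekind zeta function of `K`, on the real line. -/
noncomputable def gammaFactor (s : ℝ) : ℝ :=
  (Real.pi ^ (-s / 2) * Real.Gamma (s / 2)) ^ nrRealPlaces K *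
    ((2 * Real.pi) ^ (-s) * Real.Gamma s) ^ nrComplexPlaces K

variable (K) in
lemma gammaFactor_pos {s : ℝ} (hs : 0 < s) : 0 < gammaFactor K s := by
  have := Real.Gamma_pos_of_pos hs
  have := Real.Gamma_pos_of_pos (half_pos hs)
  have := Real.pi_pos
  unfold gammaFactor
  positivity

lemma prod_gamma_eq {s : ℝ} {a : K} (ha : a ≠ 0) :
    ∏ w : InfinitePlace K, ((1 / (Real.pi * w.mult * w a ^ 2)) ^ (w.mult * s / 2) *
      Real.Gamma (w.mult * s / 2)) =
      gammaFactor K s * |(Algebra.norm ℚ a : ℝ)| ^ (-s) := by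
  have hw (w : InfinitePlace K) : 0 < w a := w.pos_iff.mpr ha
  have h1 (w : InfinitePlace K) : (1 / (Real.pi * w.mult * w a ^ 2)) ^ (w.mult * s / 2) *
      Real.Gamma (w.mult * s / 2) =
      (Real.pi * w.mult) ^ (-(w.mult * s / 2)) * Real.Gamma (w.mult * s / 2) *
        (w a ^ w.mult) ^ (-s) := by
    have h0 : 0 < Real.pi * w.mult := mul_pos Real.pi_pos (mult_cast_pos w)
    rw [one_div, Real.inv_rpow (by positivity), ← Real.rpow_neg (by positivity),
      Real.mul_rpow h0.le (by positivity), ← Real.rpow_natCast_mul (hw w).le,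
      ← Real.rpow_natCast_mul (hw w).le]
    rw [show ((2 : ℕ) : ℝ) * -(w.mult * s / 2) = w.mult * -s by push_cast; ring]
    ring
  simp_rw [h1]
  rw [Finset.prod_mul_distrib, Real.finsetProd_rpow _ _ fun w _ ↦ by positivity,
    prod_eq_abs_norm, Rat.cast_abs, prod_eq_prod_mul_prod, gammaFactor]
  congr 2
  · rw [Finset.prod_congr rfl fun w _ ↦ by rw [mult_isReal w], Finset.prod_const,
      Finset.card_univ, ← nrRealPlaces]
    simp [neg_div]
  · rw [Finset.prod_congr rfl fun w _ ↦ by rw [mult_isComplex w], Finset.prod_const,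
      Finset.card_univ, ← nrComplexPlaces]
    simp [mul_comm]

lemma lintegral_exp_placeForm_weight {s : ℝ} (hs : 0 < s) {a : K} (ha : a ≠ 0) :
    ∫⁻ t in Ioi (0 : ℝ), ENNReal.ofReal (t ^ (finrank ℚ K / 2 * s - 1)) *
      ∫⁻ c : logSpace K, ENNReal.ofReal (Real.exp (-Real.pi * placeForm (weight t c) a)) =
      ENNReal.ofReal (logVolume K * (gammaFactor K s * |(Algebra.norm ℚ a : ℝ)| ^ (-s))) := by
  have hw (w : InfinitePlace K) : 0 < w a := w.pos_iff.mpr ha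
  let F (x : InfinitePlace K → ℝ) : ℝ := ∏ w, (Real.exp (w.mult * s / 2 * x w) *
    Real.exp (-(Real.pi * w.mult * w a ^ 2 * Real.exp (x w))))
  have hF : Measurable fun x ↦ ENNReal.ofReal (F x) := by fun_prop
  have hFint : ∫⁻ x, ENNReal.ofReal (F x) =
      ENNReal.ofReal (gammaFactor K s * |(Algebra.norm ℚ a : ℝ)| ^ (-s)) := by
    rw [← prod_gamma_eq ha]
    refine lintegral_prod_exp_mul_exp_neg (fun w ↦ ?_) fun w ↦ ?_
    · have := mult_cast_pos w
      positivity
    · have := mult_cast_pos w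
      have := hw w
      have := Real.pi_pos
      positivity
  have hFL (x : ℝ) (c : logSpace K) : F (logWeightEquiv (x, c)) =
      Real.exp x * Real.exp x ^ (finrank ℚ K / 2 * s - 1) *
        Real.exp (-Real.pi * placeForm (weight (Real.exp x) c) a) := by
    simp only [F, logWeightEquiv_apply]
    rw [Finset.prod_mul_distrib, ← Real.exp_sum, ← Real.exp_sum, ← Real.exp_mul,
      ← Real.exp_add x]
    congr 2
    · have h1 : ∑ w : InfinitePlace K, (w.mult : ℝ) * (x + logWeight c w) = finrank ℚ K * x := by
        simp_rw [mul_add, Finset.sum_add_distrib, sum_mult_mul_logWeight, add_zero,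
          ← Finset.sum_mul, ← Nat.cast_sum, sum_mult_eq]
      calc _ = s / 2 * ∑ w : InfinitePlace K, (w.mult : ℝ) * (x + logWeight c w) := by
            rw [Finset.mul_sum]
            exact Finset.sum_congr rfl fun w _ ↦ by ring
        _ = _ := by
          rw [h1]
          ring
    · rw [placeForm, Finset.mul_sum]
      refine Finset.sum_congr rfl fun w _ ↦ ?_
      rw [weight, Real.exp_add]
      ring
  rw [ENNReal.ofReal_mul (logVolume_pos K).le, ← hFint, ← lintegral_logWeightEquiv hF,
    Measure.volume_eq_prod, lintegral_prod _ (by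
      refine Measurable.aemeasurable ?_
      exact hF.comp (logWeightEquiv (K := K)).toContinuousLinearEquiv.continuous.measurable),
    setLIntegral_Ioi_eq_lintegral_exp]
  refine lintegral_congr fun x ↦ ?_
  rw [← mul_assoc, ← ENNReal.ofReal_mul (Real.exp_pos x).le,
    ← lintegral_const_mul' _ _ ENNReal.ofReal_ne_top]
  refine lintegral_congr fun c ↦ ?_
  rw [hFL, ← ENNReal.ofReal_mul (by positivity)]

end Archimedean

section Unfolding

open InfinitePlace Module Units Units.dirichletUnitTheorem Set FractionalIdeal
open scoped Classical nonZeroDivisors ENNReal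

variable {K : Type*} [Field K] [NumberField K]

lemma classGroup_mk_eq_one_iff {I : (FractionalIdeal (𝓞 K)⁰ K)ˣ} :
    ClassGroup.mk K I = 1 ↔ ∃ a : Kˣ, spanSingleton (𝓞 K)⁰ (a : K) = I.1 := by
  rw [← (ClassGroup.equiv K).injective.eq_iff, ClassGroup.equiv_mk, canonicalEquiv_self, map_one,
    QuotientGroup.mk'_apply, QuotientGroup.eq_one_iff, MonoidHom.mem_range]
  simp only [toPrincipalIdeal_eq_iff]
  rfl

lemma exists_unit_smul_of_spanSingleton_eq {a b : Kˣ}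
    (h : spanSingleton (𝓞 K)⁰ (a : K) = spanSingleton (𝓞 K)⁰ (b : K)) :
    ∃ u : (𝓞 K)ˣ, (u : K) * a = b := by
  obtain ⟨x, hx⟩ := (mem_spanSingleton _).mp (h ▸ mem_spanSingleton_self (𝓞 K)⁰ (b : K))
  obtain ⟨y, hy⟩ := (mem_spanSingleton _).mp (h ▸ mem_spanSingleton_self (𝓞 K)⁰ (a : K))
  rw [Algebra.smul_def] at hx hy
  have hxy : y * x = 1 := by
    apply FaithfulSMul.algebraMap_injective (𝓞 K) K
    rw [map_mul, map_one]
    refine mul_right_cancel₀ a.ne_zero ?_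
    rw [mul_assoc, hx, hy, one_mul]
  exact ⟨⟨x, y, by rw [mul_comm, hxy], hxy⟩, hx⟩

lemma spanSingleton_unit_mul (u : (𝓞 K)ˣ) (a : K) :
    spanSingleton (𝓞 K)⁰ ((u : K) * a) = spanSingleton (𝓞 K)⁰ a := by
  have h (u : (𝓞 K)ˣ) (a : K) :
      spanSingleton (𝓞 K)⁰ ((u : K) * a) ≤ spanSingleton (𝓞 K)⁰ a := by
    rw [spanSingleton_le_iff_mem, mem_spanSingleton]
    exact ⟨u, Algebra.smul_def _ _⟩
  refine le_antisymm (h u a) ?_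
  simpa using h u⁻¹ ((u : K) * a)

variable (J : (FractionalIdeal (𝓞 K)⁰ K)ˣ)

instance : Countable (Ideal (𝓞 K)) := by
  rw [← Set.countable_univ_iff]
  exact (Set.countable_iUnion fun n : ℕ ↦
    (Ideal.finite_setOfPred_absNorm_eq (S := 𝓞 K) n).countable).mono
      fun I _ ↦ Set.mem_iUnion.mpr ⟨Ideal.absNorm I, rfl⟩

/-- The nonzero integral ideals in the ideal class inverse to that of `J`. -/
abbrev InverseClass := {I : (Ideal (𝓞 K))⁰ // ClassGroup.mk0 I * ClassGroup.mk K J = 1}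

variable {J} in
lemma exists_classGenerator (I : InverseClass J) : ∃ a : Kˣ,
    spanSingleton (𝓞 K)⁰ (a : K) =
      ((I.1 : Ideal (𝓞 K)) : FractionalIdeal (𝓞 K)⁰ K) * J.1 := by
  have h := I.2
  rw [← ClassGroup.mk_mk0 K, ← map_mul, classGroup_mk_eq_one_iff] at h
  simpa using h

/-- A generator of the principal ideal `I * J`. -/
noncomputable def classGenerator {J : (FractionalIdeal (𝓞 K)⁰ K)ˣ} (I : InverseClass J) : Kˣ :=
  (exists_classGenerator I).choose

variable {J} in
lemma span_classGenerator (I : InverseClass J) :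
    spanSingleton (𝓞 K)⁰ (classGenerator I : K) =
      ((I.1 : Ideal (𝓞 K)) : FractionalIdeal (𝓞 K)⁰ K) * J :=
  (exists_classGenerator I).choose_spec

variable {J} in
lemma abs_norm_classGenerator (I : InverseClass J) :
    (|(Algebra.norm ℚ (classGenerator I : K) : ℝ)|) =
      Ideal.absNorm (I.1 : Ideal (𝓞 K)) * (absNorm J.1 : ℝ) := by
  have := congrArg absNorm (span_classGenerator I)
  rw [absNorm_span_singleton, map_mul, coeIdeal_absNorm] at this
  exact_mod_cast this

lemma tsum_eq_tsum_inverseClass (f : Kˣ → ℝ≥0∞) :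
    ∑' a : {x : Kˣ // (x : K) ∈ J.1}, f a.1 =
      ∑' (I : InverseClass J) (u : (𝓞 K)ˣ),
        f (Units.map (algebraMap (𝓞 K) K) u * classGenerator I) := by
  let g (p : InverseClass J × (𝓞 K)ˣ) : Kˣ :=
    Units.map (algebraMap (𝓞 K) K) p.2 * classGenerator p.1
  have hgspan (p) : spanSingleton (𝓞 K)⁰ (g p : K) =
      ((p.1.1 : Ideal (𝓞 K)) : FractionalIdeal (𝓞 K)⁰ K) * J := by
    rw [← span_classGenerator p.1]
    exact spanSingleton_unit_mul _ _
  have hgmem (p) : (g p : K) ∈ J.1 := by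
    rw [← spanSingleton_le_iff_mem, hgspan]
    exact (mul_le_mul_left coeIdeal_le_one _).trans_eq (one_mul _)
  have hbij : Function.Bijective
      fun p ↦ (⟨g p, hgmem p⟩ : {x : Kˣ // (x : K) ∈ J.1}) := by
    constructor
    · rintro ⟨I, u⟩ ⟨I', u'⟩ h
      have h1 : g (I, u) = g (I', u') := congrArg Subtype.val h
      have h2 := hgspan (I, u)
      rw [h1, hgspan (I', u')] at h2
      have h3 : I = I' :=
        Subtype.ext (Subtype.ext (coeIdeal_injective (J.isUnit.mul_left_injective h2).symm))
      subst h3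
      have h4 := Units.map_injective (FaithfulSMul.algebraMap_injective (𝓞 K) K)
        (mul_right_cancel h1)
      exact Prod.ext rfl h4
    · rintro ⟨a, ha⟩
      have h1 : spanSingleton (𝓞 K)⁰ (a : K) * (J⁻¹ : (FractionalIdeal (𝓞 K)⁰ K)ˣ).1 ≤ 1 := by
        rw [← J.mul_inv]
        exact mul_le_mul_left (spanSingleton_le_iff_mem.mpr ha) _
      obtain ⟨I, hI⟩ := le_one_iff_exists_coeIdeal.mp h1
      have hIJ : spanSingleton (𝓞 K)⁰ (a : K) = (I : FractionalIdeal (𝓞 K)⁰ K) * J := by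
        rw [hI, mul_assoc, J.inv_mul, mul_one]
      have hI0 : I ≠ ⊥ := by
        rintro rfl
        rw [coeIdeal_bot, zero_mul, spanSingleton_eq_zero_iff] at hIJ
        exact a.ne_zero hIJ
      let I' : (Ideal (𝓞 K))⁰ := ⟨I, mem_nonZeroDivisors_of_ne_zero hI0⟩
      have hcl : ClassGroup.mk0 I' * ClassGroup.mk K J = 1 := by
        rw [← ClassGroup.mk_mk0 K, ← map_mul, classGroup_mk_eq_one_iff]
        exact ⟨a, by simpa using hIJ⟩
      let I'' : InverseClass J := ⟨I', hcl⟩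
      obtain ⟨u, hu⟩ := exists_unit_smul_of_spanSingleton_eq
        ((span_classGenerator I'').trans hIJ.symm)
      exact ⟨(I'', u), Subtype.ext (Units.ext hu)⟩
  rw [← (Equiv.ofBijective _ hbij).tsum_eq, ENNReal.tsum_prod']
  rfl

lemma tsum_logEmbedding (f : logSpace K → ℝ≥0∞) :
    ∑' u : (𝓞 K)ˣ, f (logEmbedding K (Additive.ofMul u)) =
      torsionOrder K * ∑' v : unitLattice K, f v := by
  have hsec (v : unitLattice K) : ∃ u : (𝓞 K)ˣ, logEmbedding K (Additive.ofMul u) = v := by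
    obtain ⟨u, -, hu⟩ := v.2
    exact ⟨u.toMul, hu⟩
  choose σ hσ using hsec
  let g (p : torsion K × unitLattice K) : (𝓞 K)ˣ := p.1 * σ p.2
  have hg (p) : logEmbedding K (Additive.ofMul (g p)) = p.2 := by
    rw [ofMul_mul, map_add, hσ, logEmbedding_eq_zero_iff.mpr p.1.2, zero_add]
  have hbij : Function.Bijective g := by
    constructor
    · rintro ⟨z, v⟩ ⟨z', v'⟩ h
      have h1 : v = v' := Subtype.ext (by rw [← hg (z, v), ← hg (z', v'), h])
      subst h1
      rw [Subtype.ext (mul_right_cancel h : (z : (𝓞 K)ˣ) = z')]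
    · intro u
      let v : unitLattice K := ⟨logEmbedding K (Additive.ofMul u), _, trivial, rfl⟩
      refine ⟨(⟨u * (σ v)⁻¹, ?_⟩, v), inv_mul_cancel_right u (σ v)⟩
      rw [← logEmbedding_eq_zero_iff, ofMul_mul, ofMul_inv, map_add, map_neg, hσ, add_neg_cancel]
  rw [← (Equiv.ofBijective g hbij).tsum_eq]
  simp only [Equiv.ofBijective_apply, hg]
  rw [ENNReal.tsum_prod']
  dsimp only
  rw [ENNReal.tsum_const, torsionOrder, ENat.card_eq_coe_natCard]
  rfl

lemma thetaTail_eq (t : ℝ) :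
    thetaTail J t = torsionOrder K * ∑' I : InverseClass J, ∫⁻ c : logSpace K,
      ENNReal.ofReal (Real.exp (-Real.pi * placeForm (weight t c) (classGenerator I : K))) := by
  have hcont (a : K) : Continuous fun c : logSpace K ↦
      ENNReal.ofReal (Real.exp (-Real.pi * placeForm (weight t c) a)) := by
    have := (continuous_placeForm_weight a).comp (Continuous.prodMk_right (Y := logSpace K) t)
    exact ENNReal.continuous_ofReal.comp (Real.continuous_exp.comp (continuous_const.mul this))
  have h1 (c : logSpace K) : idealThetaTail J (weight t c) =
      ∑' (I : InverseClass J), torsionOrder K * ∑' v : unitLattice K,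
        ENNReal.ofReal
          (Real.exp (-Real.pi * placeForm (weight t (v +ᵥ c)) (classGenerator I : K))) := by
    rw [idealThetaTail, tsum_eq_tsum_inverseClass J fun a ↦
      ENNReal.ofReal (Real.exp (-Real.pi * placeForm (weight t c) (a : K)))]
    refine tsum_congr fun I ↦ ?_
    refine Eq.trans ?_ (tsum_logEmbedding fun v ↦ ENNReal.ofReal
      (Real.exp (-Real.pi * placeForm (weight t (v + c)) (classGenerator I : K))))
    refine tsum_congr fun u ↦ ?_
    rw [add_comm, ← placeForm_weight_unit_mul]
    rfl
  have hmeas (I : InverseClass J) (v : unitLattice K) : Measurable fun c : logSpace K ↦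
      ENNReal.ofReal
        (Real.exp (-Real.pi * placeForm (weight t (v +ᵥ c)) (classGenerator I : K))) :=
    ((hcont _).comp (continuous_const.add continuous_id)).measurable
  rw [thetaTail]
  simp_rw [h1]
  rw [lintegral_tsum fun I ↦ ((Measurable.tsum (hmeas I)).const_mul _).aemeasurable,
    ← ENNReal.tsum_mul_left]
  refine tsum_congr fun I ↦ ?_
  rw [lintegral_const_mul _ (Measurable.tsum (hmeas I)),
    lintegral_tsum fun v ↦ (hmeas I v).aemeasurable,
    (isAddFundamentalDomain_unitDomain K).lintegral_eq_tsum'']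

lemma lintegral_thetaTail {s : ℝ} (hs : 0 < s) :
    ∫⁻ t in Ioi (0 : ℝ), ENNReal.ofReal (t ^ (finrank ℚ K / 2 * s - 1)) * thetaTail J t =
      ENNReal.ofReal (torsionOrder K * logVolume K * gammaFactor K s *
        (absNorm J.1 : ℝ) ^ (-s)) *
        ∑' I : InverseClass J, ENNReal.ofReal ((Ideal.absNorm (I.1 : Ideal (𝓞 K)) : ℝ) ^ (-s)) := by
  have hmeas (a : K) : Measurable fun t : ℝ ↦ ∫⁻ c : logSpace K,
      ENNReal.ofReal (Real.exp (-Real.pi * placeForm (weight t c) a)) := by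
    refine Measurable.lintegral_prod_right' (f := fun p : ℝ × logSpace K ↦
      ENNReal.ofReal (Real.exp (-Real.pi * placeForm (weight p.1 p.2) a))) ?_
    have := (continuous_placeForm_weight a).measurable
    fun_prop
  have h1 := logVolume_pos K
  have h2 := gammaFactor_pos K hs
  have h3 := absNorm_pos J
  simp_rw [thetaTail_eq, mul_left_comm _ (torsionOrder K : ℝ≥0∞), ← ENNReal.tsum_mul_left]
  rw [lintegral_tsum fun I ↦ by have := hmeas (classGenerator I : K); fun_prop]
  refine tsum_congr fun I ↦ ?_
  rw [lintegral_const_mul _ (by have := hmeas (classGenerator I : K); fun_prop),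
    lintegral_exp_placeForm_weight hs (classGenerator I).ne_zero, abs_norm_classGenerator I,
    Real.mul_rpow (by positivity) h3.le, ← ENNReal.ofReal_natCast,
    ← ENNReal.ofReal_mul (by positivity), ← ENNReal.ofReal_mul (by positivity)]
  congr 1
  ring

end Unfolding

section CompletedZeta

open InfinitePlace Module Units Set Topology FractionalIdeal
open scoped Classical nonZeroDivisors ENNReal

variable {K : Type*} [Field K] [NumberField K] (J : (FractionalIdeal (𝓞 K)⁰ K)ˣ)

lemma thetaPair_f_sub {t : ℝ} (ht : 0 < t) :
    (thetaPair J).f t - (thetaPair J).f₀ = ((thetaTail J t).toReal : ℂ) := by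
  change ((thetaAverage J t).toReal : ℂ) - ((volume (unitDomain K)).toReal : ℂ) = _
  rw [thetaAverage_eq_add, ENNReal.toReal_add (volume_unitDomain_ne_top K) (thetaTail_ne_top J ht),
    ofReal_add, add_sub_cancel_left]

lemma thetaPair_mellin {σ : ℝ} (hσ : finrank ℚ K / 2 < σ) :
    ∫⁻ t in Ioi (0 : ℝ), ENNReal.ofReal (t ^ (σ - 1)) * thetaTail J t ≠ ∞ ∧
    (thetaPair J).Λ σ =
      (∫⁻ t in Ioi (0 : ℝ), ENNReal.ofReal (t ^ (σ - 1)) * thetaTail J t).toReal := by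
  obtain ⟨h1, h2⟩ := (thetaPair J).hasMellin (s := σ) hσ
  have hcongr : ∀ t ∈ Ioi (0 : ℝ),
      (t : ℂ) ^ ((σ : ℂ) - 1) • ((thetaPair J).f t - (thetaPair J).f₀) =
        ((t ^ (σ - 1) * (thetaTail J t).toReal : ℝ) : ℂ) := fun t (ht : 0 < t) ↦ by
    rw [thetaPair_f_sub J ht, _root_.smul_eq_mul, ofReal_mul, ofReal_cpow ht.le]
    norm_cast
  have hnn : ∀ t ∈ Ioi (0 : ℝ), 0 ≤ t ^ (σ - 1) * (thetaTail J t).toReal := fun t (ht : 0 < t) ↦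
    mul_nonneg (Real.rpow_nonneg ht.le _) ENNReal.toReal_nonneg
  have hint : IntegrableOn (fun t : ℝ ↦ t ^ (σ - 1) * (thetaTail J t).toReal) (Ioi 0) := by
    have := (h1.congr_fun hcongr measurableSet_Ioi).re
    simpa [IntegrableOn] using this
  have hval : (∫⁻ t in Ioi (0 : ℝ), ENNReal.ofReal (t ^ (σ - 1)) * thetaTail J t) =
      ENNReal.ofReal (∫ t in Ioi (0 : ℝ), t ^ (σ - 1) * (thetaTail J t).toReal) := by
    rw [ofReal_integral_eq_lintegral_ofReal hint
      ((ae_restrict_iff' measurableSet_Ioi).mpr (.of_forall hnn))]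
    refine setLIntegral_congr_fun measurableSet_Ioi fun t (ht : 0 < t) ↦ ?_
    rw [ENNReal.ofReal_mul (Real.rpow_nonneg ht.le _),
      ENNReal.ofReal_toReal (thetaTail_ne_top J ht)]
  rw [hval, ENNReal.toReal_ofReal (setIntegral_nonneg measurableSet_Ioi hnn)]
  refine ⟨ENNReal.ofReal_ne_top, ?_⟩
  rw [← h2, mellin, ← integral_complex_ofReal]
  exact setIntegral_congr_fun measurableSet_Ioi hcongr

/-- The part of the completed zeta function attached to the class of `J`, up to a constant. -/
noncomputable def partialZeta (s : ℂ) : ℂ :=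
  (thetaRoot J : ℂ) ^ (-s) * (thetaPair J).Λ (finrank ℚ K / 2 * s)

variable (K) in
/-- The constant relating the Mellin transform of theta series to zeta functions. -/
noncomputable def mellinConst : ℝ := torsionOrder K * logVolume K

variable (K) in
lemma mellinConst_pos : 0 < mellinConst K :=
  mul_pos (Nat.cast_pos.mpr (torsionOrder_pos K)) (logVolume_pos K)

lemma finrank_div_two_lt {s : ℝ} (hs : 1 < s) : (finrank ℚ K : ℝ) / 2 < finrank ℚ K / 2 * s :=
  lt_mul_of_one_lt_right (div_pos (Nat.cast_pos.mpr finrank_pos) zero_lt_two) hs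

lemma tsum_inverseClass_ne_top {s : ℝ} (hs : 1 < s) :
    ∑' I : InverseClass J, ENNReal.ofReal ((Ideal.absNorm (I.1 : Ideal (𝓞 K)) : ℝ) ^ (-s)) ≠ ∞ := by
  intro h
  have h1 := (thetaPair_mellin J (finrank_div_two_lt hs)).1
  have h2 := mellinConst_pos K
  have h3 := gammaFactor_pos K (zero_lt_one.trans hs)
  have h4 := absNorm_pos J
  rw [lintegral_thetaTail J (zero_lt_one.trans hs), h, ENNReal.mul_top] at h1
  · exact h1 rfl
  · rw [ne_eq, ENNReal.ofReal_eq_zero, not_le]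
    unfold mellinConst at h2
    positivity

lemma partialZeta_ofReal {s : ℝ} (hs : 1 < s) :
    partialZeta J s = ((mellinConst K * |(discr K : ℝ)| ^ (s / 2) * gammaFactor K s *
      (∑' I : InverseClass J,
        ENNReal.ofReal ((Ideal.absNorm (I.1 : Ideal (𝓞 K)) : ℝ) ^ (-s))).toReal : ℝ) : ℂ) := by
  have h2 := mellinConst_pos K
  have h3 := gammaFactor_pos K (zero_lt_one.trans hs)
  have h4 := absNorm_pos J
  have h5 := abs_discr_pos K
  have hroot : thetaRoot J ^ (-s) = (absNorm J.1 : ℝ) ^ s * |(discr K : ℝ)| ^ (s / 2) := by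
    rw [thetaRoot, Real.inv_rpow (by positivity), Real.rpow_neg (by positivity), inv_inv,
      Real.sqrt_mul (by positivity), Real.sqrt_sq h4.le, Real.mul_rpow h4.le (by positivity),
      Real.sqrt_eq_rpow, ← Real.rpow_mul h5.le]
    ring_nf
  have hΛ := (thetaPair_mellin J (finrank_div_two_lt hs)).2
  rw [lintegral_thetaTail J (zero_lt_one.trans hs), ENNReal.toReal_mul,
    ENNReal.toReal_ofReal (by unfold mellinConst at h2; positivity)] at hΛ
  push_cast at hΛ
  have hroot' : (thetaRoot J : ℂ) ^ (-(s : ℂ)) = ((thetaRoot J ^ (-s) : ℝ) : ℂ) := by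
    rw [ofReal_cpow (thetaRoot_pos J).le, ofReal_neg]
  rw [partialZeta, hΛ, hroot', hroot, Real.rpow_neg h4.le, mellinConst]
  have h6 : (((absNorm J.1 : ℝ) ^ s : ℝ) : ℂ) ≠ 0 := ofReal_ne_zero.mpr (by positivity)
  push_cast
  field_simp

lemma thetaRoot_dualIdeal : thetaRoot (dualIdeal J) = (thetaRoot J)⁻¹ := by
  have h (J : (FractionalIdeal (𝓞 K)⁰ K)ˣ) : (thetaAverage J 1).toReal =
      thetaRoot J * (thetaAverage (dualIdeal J) 1).toReal := by
    have := thetaAverage_inv J zero_lt_one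
    rw [one_div_one, Real.one_rpow, mul_one] at this
    rw [this, ENNReal.toReal_mul, ENNReal.toReal_ofReal (thetaRoot_pos J).le]
  have hpos : 0 < (thetaAverage J 1).toReal := by
    refine ENNReal.toReal_pos (fun h ↦ volume_unitDomain_ne_zero K ?_)
      (thetaAverage_ne_top J zero_lt_one)
    rw [thetaAverage_eq_add] at h
    exact (add_eq_zero.mp h).1
  have h1 := h J
  rw [h (dualIdeal J), dualIdeal_dualIdeal, ← mul_assoc] at h1
  refine eq_inv_of_mul_eq_one_right ?_
  exact mul_right_cancel₀ hpos.ne' (by rw [← h1, one_mul])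

lemma thetaPair_symm : (thetaPair J).symm = thetaPair (dualIdeal J) := by
  simp only [WeakFEPair.symm, thetaPair, thetaRoot_dualIdeal, dualIdeal_dualIdeal, ofReal_inv]

lemma partialZeta_one_sub (s : ℂ) : partialZeta J (1 - s) = partialZeta (dualIdeal J) s := by
  have h0 : (thetaRoot J : ℂ) ≠ 0 := ofReal_ne_zero.mpr (thetaRoot_pos J).ne'
  have h1 := (thetaPair J).functional_equation (finrank ℚ K / 2 * s)
  have h2 : (((thetaPair J).k : ℝ) : ℂ) = finrank ℚ K / 2 := by
    simp [thetaPair]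
  have h3 : (thetaPair J).ε = thetaRoot J := rfl
  rw [h2, thetaPair_symm, h3, _root_.smul_eq_mul] at h1
  have h4 : ((thetaRoot J : ℂ)⁻¹) ^ (-s) = (thetaRoot J : ℂ) ^ s := by
    rw [inv_cpow _ _ (by simp [arg_ofReal_of_nonneg (thetaRoot_pos J).le, Real.pi_pos.ne]),
      ← cpow_neg, neg_neg]
  have h5 : (thetaRoot J : ℂ) ^ (-(1 - s)) * thetaRoot J = (thetaRoot J : ℂ) ^ s := by
    rw [neg_sub, cpow_sub _ _ h0, cpow_one, div_mul_cancel₀ _ h0]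
  rw [partialZeta, partialZeta, mul_sub, mul_one, h1, thetaRoot_dualIdeal, ofReal_inv,
    ← mul_assoc, h4, h5]

end CompletedZeta

section EulerProduct

open IsDedekindDomain Set Topology
open scoped Classical nonZeroDivisors

variable {R : Type*} [CommRing R] [IsDedekindDomain R]

/-- A nonzero prime ideal as a nonzero ideal. -/
def primeIdeal (P : HeightOneSpectrum R) : (Ideal R)⁰ :=
  ⟨P.asIdeal, mem_nonZeroDivisors_of_ne_zero P.ne_bot⟩

/-- The nonzero ideals that are divisible by no prime in `S`. -/
def coprimeIdeals (S : Finset (HeightOneSpectrum R)) : Set (Ideal R)⁰ :=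
  {I | ∀ P ∈ S, ¬ P.asIdeal ∣ (I : Ideal R)}

lemma primeIdeal_mul_mem_coprimeIdeals {S : Finset (HeightOneSpectrum R)}
    {P : HeightOneSpectrum R} (hP : P ∉ S) {I : (Ideal R)⁰} :
    primeIdeal P * I ∈ coprimeIdeals S ↔ I ∈ coprimeIdeals S := by
  refine forall₂_congr fun Q hQ ↦ not_congr ⟨fun h ↦ ?_, fun h ↦ ?_⟩
  · refine (Q.prime.dvd_or_dvd h).resolve_left fun hQP ↦ hP ?_
    have : P.asIdeal = Q.asIdeal :=
      P.isMaximal.eq_of_le Q.isPrime.ne_top (Ideal.le_of_dvd hQP)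
    rwa [HeightOneSpectrum.ext this]
  · exact h.mul_left _

variable {f : (Ideal R)⁰ →* ℂ}

lemma prod_one_sub_mul_tsum (hf : Summable fun I ↦ ‖f I‖) (S : Finset (HeightOneSpectrum R)) :
    (∏ P ∈ S, (1 - f (primeIdeal P))) * ∑' I, f I = ∑' I, (coprimeIdeals S).indicator f I := by
  induction S using Finset.induction_on with
  | empty => simp [coprimeIdeals]
  | insert P S hP ih =>
    rw [Finset.prod_insert hP, mul_assoc, ih, sub_mul, one_mul, sub_eq_iff_eq_add,
      ← sub_eq_iff_eq_add', ← tsum_mul_left,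
      ← (hf.of_norm.indicator _).tsum_sub (hf.of_norm.indicator _)]
    have hinj : Function.Injective fun I : (Ideal R)⁰ ↦ primeIdeal P * I :=
      fun _ _ h ↦ mul_left_cancel h
    rw [← hinj.tsum_eq]
    · refine tsum_congr fun I ↦ ?_
      have h1 : primeIdeal P * I ∉ coprimeIdeals (insert P S) := fun h ↦
        h P (Finset.mem_insert_self _ _) (dvd_mul_right _ _)
      simp only [indicator_of_notMem h1, sub_zero, indicator_apply,
        primeIdeal_mul_mem_coprimeIdeals hP, map_mul, mul_ite, mul_zero]
    · intro I hI
      by_contra h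
      refine hI ?_
      have h1 : ¬ P.asIdeal ∣ (I : Ideal R) := by
        rintro ⟨J, hJ⟩
        have hJ0 : J ≠ 0 := fun h0 ↦ nonZeroDivisors.coe_ne_zero I (by rw [hJ, h0, mul_zero])
        exact h ⟨⟨J, mem_nonZeroDivisors_of_ne_zero hJ0⟩, Subtype.ext hJ.symm⟩
      have h2 : I ∈ coprimeIdeals (insert P S) ↔ I ∈ coprimeIdeals S := by
        simp [coprimeIdeals, h1]
      simp only [indicator_apply, h2, sub_self]

theorem hasProd_eulerProduct_ideal (hf : Summable fun I ↦ ‖f I‖) :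
    HasProd (fun P : HeightOneSpectrum R ↦ (1 - f (primeIdeal P))⁻¹) (∑' I, f I) := by
  have h1 : Tendsto (fun S : Finset (HeightOneSpectrum R) ↦
      ∑' I, (coprimeIdeals S).indicator f I) atTop
      (𝓝 (∑' I : (Ideal R)⁰, if I = 1 then (1 : ℂ) else 0)) := by
    refine tendsto_tsum_of_dominated_convergence hf (fun I ↦ ?_)
      (.of_forall fun S I ↦ norm_indicator_le_norm_self (⇑f) I)
    by_cases hI : I = 1
    · refine tendsto_const_nhds.congr fun S ↦ ?_
      have : (1 : (Ideal R)⁰) ∈ coprimeIdeals S := fun P _ h ↦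
        P.prime.not_isUnit (isUnit_of_dvd_one h)
      simp [hI, this]
    · obtain ⟨P, hP, hIP⟩ := Ideal.exists_le_maximal (I : Ideal R) fun h ↦
        hI (Subtype.ext (h.trans Ideal.one_eq_top.symm))
      let Q : HeightOneSpectrum R := ⟨P, hP.isPrime, fun h0 ↦ nonZeroDivisors.coe_ne_zero I
        (le_bot_iff.mp (h0 ▸ hIP))⟩
      refine tendsto_const_nhds.congr' ?_
      filter_upwards [eventually_ge_atTop {Q}] with S hS
      have : I ∉ coprimeIdeals S := fun h ↦
        h Q (hS (Finset.mem_singleton_self _)) (Ideal.dvd_iff_le.mpr hIP)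
      rw [if_neg hI, indicator_of_notMem this]
  rw [tsum_ite_eq] at h1
  simp_rw [← prod_one_sub_mul_tsum hf] at h1
  have h0 : ∑' I, f I ≠ 0 := fun h ↦ by simp [h] at h1
  have h2 := (h1.mul_const (∑' I, f I)⁻¹).inv₀ (by simpa using h0)
  simpa [HasProd, h0] using h2

end EulerProduct

section DedekindZeta

open InfinitePlace Module IsDedekindDomain Set Topology FractionalIdeal
open scoped Classical nonZeroDivisors ENNReal

variable (K : Type*) [Field K] [NumberField K]

variable {K} in
lemma sum_tsum_inverseClass {J : ClassGroup (𝓞 K) → (FractionalIdeal (𝓞 K)⁰ K)ˣ}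
    (hJ : Function.Bijective fun C ↦ ClassGroup.mk K (J C)) (f : (Ideal (𝓞 K))⁰ → ℝ≥0∞) :
    ∑ C, ∑' I : InverseClass (J C), f I.1 = ∑' I, f I := by
  have hbij : Function.Bijective fun p : (C : ClassGroup (𝓞 K)) × InverseClass (J C) ↦ p.2.1 := by
    constructor
    · rintro ⟨C, I, hI⟩ ⟨D, I', hI'⟩ (rfl : I = I')
      obtain rfl : C = D := hJ.injective (mul_left_cancel (hI.trans hI'.symm))
      rfl
    · intro I
      obtain ⟨C, hC⟩ := hJ.surjective (ClassGroup.mk0 I)⁻¹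
      exact ⟨⟨C, I, by simp only [hC, mul_inv_cancel]⟩, rfl⟩
  rw [← hbij.injective.tsum_eq (by simp [hbij.surjective.range_eq]), ENNReal.tsum_sigma',
    tsum_fintype]

lemma exists_classRep (C : ClassGroup (𝓞 K)) :
    ∃ J : (FractionalIdeal (𝓞 K)⁰ K)ˣ, ClassGroup.mk K J = C := by
  obtain ⟨I, rfl⟩ := ClassGroup.mk0_surjective C
  exact ⟨_, ClassGroup.mk_mk0 K I⟩

variable {K} in
/-- A fractional ideal in a given ideal class. -/
noncomputable def classRep (C : ClassGroup (𝓞 K)) : (FractionalIdeal (𝓞 K)⁰ K)ˣ :=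
  (exists_classRep K C).choose

variable {K} in
lemma mk_classRep (C : ClassGroup (𝓞 K)) : ClassGroup.mk K (classRep C) = C :=
  (exists_classRep K C).choose_spec

lemma bijective_mk_classRep :
    Function.Bijective fun C : ClassGroup (𝓞 K) ↦ ClassGroup.mk K (classRep C) := by
  simp only [mk_classRep]
  exact Function.bijective_id

lemma bijective_mk_dualIdeal_classRep :
    Function.Bijective fun C : ClassGroup (𝓞 K) ↦ ClassGroup.mk K (dualIdeal (classRep C)) := by
  have h (C : ClassGroup (𝓞 K)) : ClassGroup.mk K (dualIdeal (classRep C)) =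
      ClassGroup.mk K (dualIdeal 1) * C⁻¹ := by
    rw [dualIdeal_eq, map_mul, map_inv, mk_classRep]
  simp only [h]
  exact (Equiv.mulLeft (ClassGroup.mk K (dualIdeal 1))).bijective.comp
    (Equiv.inv (ClassGroup (𝓞 K))).bijective

lemma tsum_absNorm_rpow_ne_top {s : ℝ} (hs : 1 < s) :
    ∑' I : (Ideal (𝓞 K))⁰, ENNReal.ofReal ((Ideal.absNorm (I : Ideal (𝓞 K)) : ℝ) ^ (-s)) ≠ ∞ := by
  rw [← sum_tsum_inverseClass (bijective_mk_classRep K)]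
  exact ENNReal.sum_ne_top.mpr fun C _ ↦ tsum_inverseClass_ne_top _ hs

lemma summable_absNorm_rpow {s : ℝ} (hs : 1 < s) :
    Summable fun I : (Ideal (𝓞 K))⁰ ↦ (Ideal.absNorm (I : Ideal (𝓞 K)) : ℝ) ^ (-s) := by
  refine (ENNReal.summable_toReal (tsum_absNorm_rpow_ne_top K hs)).congr fun I ↦ ?_
  exact ENNReal.toReal_ofReal (by positivity)

variable {K} in
lemma absNorm_nonZeroDivisors_pos (I : (Ideal (𝓞 K))⁰) :
    0 < Ideal.absNorm (I : Ideal (𝓞 K)) :=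
  Nat.pos_of_ne_zero (Ideal.absNorm_eq_zero_iff.not.mpr (nonZeroDivisors.coe_ne_zero I))

/-- The completely multiplicative function `I ↦ N(I) ^ (-s)` on nonzero ideals. -/
noncomputable def absNormCPow (s : ℂ) : (Ideal (𝓞 K))⁰ →* ℂ where
  toFun I := (Ideal.absNorm (I : Ideal (𝓞 K)) : ℂ) ^ (-s)
  map_one' := by simp
  map_mul' I I' := by simp [natCast_mul_natCast_cpow]

variable {K} in
lemma norm_absNormCPow (s : ℂ) (I : (Ideal (𝓞 K))⁰) :
    ‖absNormCPow K s I‖ = (Ideal.absNorm (I : Ideal (𝓞 K)) : ℝ) ^ (-s.re) :=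
  norm_natCast_cpow_of_pos (absNorm_nonZeroDivisors_pos I) _

lemma tprod_eq_tsum_absNormCPow {s : ℂ} (hs : 1 < s.re) :
    ∏' P : HeightOneSpectrum (𝓞 K), (1 - (Ideal.absNorm P.asIdeal : ℂ) ^ (-s))⁻¹ =
      ∑' I, absNormCPow K s I := by
  refine (hasProd_eulerProduct_ideal (f := absNormCPow K s) ?_).tprod_eq
  simpa only [norm_absNormCPow] using summable_absNorm_rpow K hs

lemma differentiableOn_tsum_absNormCPow :
    DifferentiableOn ℂ (fun s ↦ ∑' I, absNormCPow K s I) {s | 1 < s.re} := by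
  intro s (hs : 1 < s.re)
  obtain ⟨a, ha, has⟩ := exists_between hs
  have ho : IsOpen {s : ℂ | a < s.re} := isOpen_lt continuous_const continuous_re
  refine (DifferentiableOn.differentiableAt (s := {s : ℂ | a < s.re}) ?_
    (ho.mem_nhds has)).differentiableWithinAt
  refine differentiableOn_tsum_of_summable_norm (summable_absNorm_rpow K ha) (fun I ↦ ?_) ho
    fun I w (hw : a < w.re) ↦ ?_
  · refine fun w _ ↦ DifferentiableAt.differentiableWithinAt ?_
    exact (differentiableAt_id.neg).const_cpow
      (.inl (Nat.cast_ne_zero.mpr (absNorm_nonZeroDivisors_pos I).ne'))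
  · rw [norm_absNormCPow]
    exact Real.rpow_le_rpow_of_exponent_le
      (Nat.one_le_cast.mpr (absNorm_nonZeroDivisors_pos I)) (neg_le_neg hw.le)

/-- The factor at infinity of the completed zeta function. -/
noncomputable def infiniteFactor (s : ℂ) : ℂ :=
  ((|discr K| : ℤ) : ℂ) ^ (s / 2) * ((Real.pi : ℂ) ^ (-s / 2) * Complex.Gamma (s / 2)) ^
    (nrRealPlaces K) * ((2 * (Real.pi : ℂ)) ^ (-s) * Complex.Gamma s) ^ (nrComplexPlaces K)

lemma infiniteFactor_ofReal (s : ℝ) :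
    infiniteFactor K s = ((|(discr K : ℝ)| ^ (s / 2) * gammaFactor K s : ℝ) : ℂ) := by
  have h1 : ((|discr K| : ℤ) : ℂ) = ((|(discr K : ℝ)| : ℝ) : ℂ) := by
    rw [← Int.cast_abs, ofReal_intCast]
  have h2 := Real.pi_pos.le
  rw [infiniteFactor, h1, gammaFactor]
  push_cast [ofReal_cpow (abs_nonneg _), ofReal_cpow h2, ofReal_cpow (mul_nonneg zero_le_two h2),
    ← Complex.Gamma_ofReal]
  ring

lemma differentiableOn_infiniteFactor :
    DifferentiableOn ℂ (infiniteFactor K) {s | 1 < s.re} := by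
  intro s (hs : 1 < s.re)
  have h1 : ((|discr K| : ℤ) : ℂ) ≠ 0 :=
    Int.cast_ne_zero.mpr (abs_ne_zero.mpr (discr_ne_zero K))
  have h2 : (Real.pi : ℂ) ≠ 0 := ofReal_ne_zero.mpr Real.pi_ne_zero
  have h3 {z : ℂ} (hz : 0 < z.re) : DifferentiableAt ℂ Complex.Gamma z :=
    differentiableAt_Gamma _ fun m h ↦ by
      rw [h, neg_re, natCast_re] at hz
      exact absurd hz (by simp)
  have h4 : DifferentiableAt ℂ (fun s : ℂ ↦ s / 2) s := by fun_prop
  have h5 : DifferentiableAt ℂ (fun s : ℂ ↦ -s / 2) s := by fun_prop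
  have h6 : DifferentiableAt ℂ (fun s : ℂ ↦ -s) s := by fun_prop
  have h7 : 0 < (s / 2).re := by simp [zero_lt_one.trans hs]
  exact (((h4.const_cpow (.inl h1)).mul (((h5.const_cpow (.inl h2)).mul
    ((h3 h7).comp s h4)).pow _)).mul (((h6.const_cpow (.inl (mul_ne_zero two_ne_zero h2))).mul
    (h3 (zero_lt_one.trans hs))).pow _)).differentiableWithinAt

/-- The completed Dedekind zeta function. -/
noncomputable def completedZeta (s : ℂ) : ℂ :=
  (2 * mellinConst K : ℂ)⁻¹ * ∑ C : ClassGroup (𝓞 K),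
    (partialZeta (classRep C) s + partialZeta (dualIdeal (classRep C)) s)

lemma completedZeta_one_sub (s : ℂ) : completedZeta K (1 - s) = completedZeta K s := by
  simp only [completedZeta, partialZeta_one_sub, dualIdeal_dualIdeal, add_comm]

variable {K} in
lemma sum_partialZeta_ofReal {J : ClassGroup (𝓞 K) → (FractionalIdeal (𝓞 K)⁰ K)ˣ}
    (hJ : Function.Bijective fun C ↦ ClassGroup.mk K (J C)) {s : ℝ} (hs : 1 < s) :
    ∑ C, partialZeta (J C) s =
      mellinConst K * (infiniteFactor K s * ∑' I, absNormCPow K s I) := by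
  have h : ∑' I, absNormCPow K s I = ((∑' I : (Ideal (𝓞 K))⁰,
      ENNReal.ofReal ((Ideal.absNorm (I : Ideal (𝓞 K)) : ℝ) ^ (-s))).toReal : ℂ) := by
    rw [ENNReal.tsum_toReal_eq fun _ ↦ ENNReal.ofReal_ne_top, ofReal_tsum]
    refine tsum_congr fun I ↦ ?_
    rw [ENNReal.toReal_ofReal (by positivity), ofReal_cpow (by positivity)]
    simp [absNormCPow]
  rw [h, ← sum_tsum_inverseClass hJ,
    ENNReal.toReal_sum fun C _ ↦ tsum_inverseClass_ne_top _ hs, infiniteFactor_ofReal]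
  simp only [partialZeta_ofReal _ hs, ofReal_mul, ofReal_sum, Finset.mul_sum, mul_assoc]

lemma completedZeta_ofReal {s : ℝ} (hs : 1 < s) :
    completedZeta K s = infiniteFactor K s * ∑' I, absNormCPow K s I := by
  have h : (mellinConst K : ℂ) ≠ 0 := ofReal_ne_zero.mpr (mellinConst_pos K).ne'
  rw [completedZeta, Finset.sum_add_distrib, sum_partialZeta_ofReal (bijective_mk_classRep K) hs,
    sum_partialZeta_ofReal (bijective_mk_dualIdeal_classRep K) hs]
  field_simp
  ring

variable {K} in
lemma differentiableAt_partialZeta (J : (FractionalIdeal (𝓞 K)⁰ K)ˣ) {s : ℂ} (h0 : s ≠ 0)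
    (h1 : s ≠ 1) : DifferentiableAt ℂ (partialZeta J) s := by
  have hn : (finrank ℚ K / 2 : ℂ) ≠ 0 :=
    div_ne_zero (Nat.cast_ne_zero.mpr finrank_pos.ne') two_ne_zero
  have hk : (((thetaPair J).k : ℝ) : ℂ) = finrank ℚ K / 2 := by
    simp [thetaPair]
  have hr : (thetaRoot J : ℂ) ≠ 0 := ofReal_ne_zero.mpr (thetaRoot_pos J).ne'
  have h2 : DifferentiableAt ℂ (thetaPair J).Λ (finrank ℚ K / 2 * s) := by
    refine (thetaPair J).differentiableAt_Λ (.inl (mul_ne_zero hn h0)) (.inl ?_)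
    rw [hk]
    exact fun h ↦ h1 (mul_left_cancel₀ hn (h.trans (mul_one _).symm))
  exact ((differentiableAt_id.neg).const_cpow (.inl hr)).mul
    (h2.comp s (differentiableAt_id.const_mul _))

lemma analyticAt_completedZeta {s : ℂ} (h0 : s ≠ 0) (h1 : s ≠ 1) :
    AnalyticAt ℂ (completedZeta K) s := by
  have ho : IsOpen ({0, 1}ᶜ : Set ℂ) := (Set.toFinite _).isClosed.isOpen_compl
  refine DifferentiableOn.analyticAt (s := {0, 1}ᶜ) (fun w hw ↦ ?_) (ho.mem_nhds (by simp [h0, h1]))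
  simp only [mem_compl_iff, mem_insert_iff, mem_singleton_iff, not_or] at hw
  refine DifferentiableAt.differentiableWithinAt (DifferentiableAt.const_mul ?_ _)
  exact DifferentiableAt.fun_sum fun C _ ↦ (differentiableAt_partialZeta _ hw.1 hw.2).add
    (differentiableAt_partialZeta _ hw.1 hw.2)

theorem completedZeta_eq {s : ℂ} (hs : 1 < s.re) :
    completedZeta K s = infiniteFactor K s * ∑' I, absNormCPow K s I := by
  have ho : IsOpen {s : ℂ | 1 < s.re} := isOpen_lt continuous_const continuous_re
  have h1 : AnalyticOnNhd ℂ (completedZeta K) {s | 1 < s.re} := fun w (hw : 1 < w.re) ↦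
    analyticAt_completedZeta K (by rintro rfl; simp at hw; linarith) (by rintro rfl; simp at hw)
  have h2 : AnalyticOnNhd ℂ (fun s ↦ infiniteFactor K s * ∑' I, absNormCPow K s I)
      {s | 1 < s.re} :=
    ((differentiableOn_infiniteFactor K).mul
      (differentiableOn_tsum_absNormCPow K)).analyticOnNhd ho
  refine h1.eqOn_of_preconnected_of_frequently_eq h2 (convex_halfSpace_re_gt 1).isPreconnected
    (z₀ := ((2 : ℝ) : ℂ)) (by simp) ?_ hs
  have ht : Tendsto (fun x : ℝ ↦ (x : ℂ)) (𝓝[>] 2) (𝓝[≠] ((2 : ℝ) : ℂ)) :=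
    continuous_ofReal.continuousWithinAt.tendsto_nhdsWithin fun x (hx : 2 < x) ↦
      ofReal_injective.ne hx.ne'
  refine ht.frequently (Eventually.frequently ?_)
  filter_upwards [self_mem_nhdsWithin] with x (hx : 2 < x)
  exact completedZeta_ofReal K (one_lt_two.trans hx)

/-- The function `s ↦ s * partialZeta J s`, continued to `s = 0`. -/
noncomputable def partialZetaNumerator {K : Type*} [Field K] [NumberField K]
    (J : (FractionalIdeal (𝓞 K)⁰ K)ˣ) (s : ℂ) : ℂ :=
  (thetaRoot J : ℂ) ^ (-s) * (s * (thetaPair J).Λ₀ (finrank ℚ K / 2 * s) -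
    (2 / finrank ℚ K) * (volume (unitDomain K)).toReal -
    s * (thetaRoot J / (finrank ℚ K / 2 - finrank ℚ K / 2 * s)) * (volume (unitDomain K)).toReal)

variable {K} in
lemma partialZeta_eq_div (J : (FractionalIdeal (𝓞 K)⁰ K)ˣ) {s : ℂ} (hs : s ≠ 0) :
    partialZeta J s = partialZetaNumerator J s / s := by
  have hn : (finrank ℚ K : ℂ) ≠ 0 := Nat.cast_ne_zero.mpr finrank_pos.ne'
  have hk : (((thetaPair J).k : ℝ) : ℂ) = finrank ℚ K / 2 := by
    simp [thetaPair]
  have h3 : (thetaPair J).ε = thetaRoot J := rfl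
  have h4 : (thetaPair J).f₀ = ((volume (unitDomain K)).toReal : ℂ) := rfl
  have h5 : (thetaPair J).g₀ = ((volume (unitDomain K)).toReal : ℂ) := rfl
  rw [partialZeta, partialZetaNumerator, WeakFEPair.Λ, hk, h3, h4, h5, _root_.smul_eq_mul,
    _root_.smul_eq_mul]
  field_simp

variable {K} in
lemma partialZetaNumerator_zero (J : (FractionalIdeal (𝓞 K)⁰ K)ˣ) :
    partialZetaNumerator J 0 = -((2 / finrank ℚ K * (volume (unitDomain K)).toReal : ℝ) : ℂ) := by
  simp [partialZetaNumerator]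

variable {K} in
lemma analyticAt_partialZetaNumerator (J : (FractionalIdeal (𝓞 K)⁰ K)ˣ) :
    AnalyticAt ℂ (partialZetaNumerator J) 0 := by
  have hn : (finrank ℚ K / 2 : ℂ) ≠ 0 :=
    div_ne_zero (Nat.cast_ne_zero.mpr finrank_pos.ne') two_ne_zero
  have hr : (thetaRoot J : ℂ) ≠ 0 := ofReal_ne_zero.mpr (thetaRoot_pos J).ne'
  have ho : IsOpen ({1}ᶜ : Set ℂ) := isOpen_compl_singleton
  refine DifferentiableOn.analyticAt (s := {1}ᶜ) (fun w hw ↦ ?_) (ho.mem_nhds (by simp))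
  have h1 : finrank ℚ K / 2 - finrank ℚ K / 2 * w ≠ 0 := by
    rw [← mul_one_sub]
    exact mul_ne_zero hn (sub_ne_zero.mpr (Ne.symm hw))
  have h2 : DifferentiableAt ℂ (fun w ↦ (thetaPair J).Λ₀ (finrank ℚ K / 2 * w)) w :=
    ((thetaPair J).differentiable_Λ₀ _).comp w (differentiableAt_id.const_mul _)
  have h3 : DifferentiableAt ℂ (fun w ↦ (thetaRoot J : ℂ) ^ (-w)) w :=
    (differentiableAt_id.neg).const_cpow (.inl hr)
  have h4 : DifferentiableAt ℂ (fun w ↦ (thetaRoot J : ℂ) /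
      (finrank ℚ K / 2 - finrank ℚ K / 2 * w)) w :=
    (differentiableAt_const _).div (by fun_prop) h1
  exact (h3.mul (((differentiableAt_id.mul h2).sub_const _).sub
    ((differentiableAt_id.mul h4).mul_const _))).differentiableWithinAt

lemma exists_completedZeta_eq_div : ∃ g : ℂ → ℂ, AnalyticAt ℂ g 0 ∧ g 0 ≠ 0 ∧
    ∀ s, s ≠ 0 → completedZeta K s = g s / s := by
  refine ⟨fun s ↦ (2 * mellinConst K : ℂ)⁻¹ * ∑ C : ClassGroup (𝓞 K),
    (partialZetaNumerator (classRep C) s + partialZetaNumerator (dualIdeal (classRep C)) s),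
    ?_, ?_, fun s hs ↦ ?_⟩
  · exact analyticAt_const.mul (Finset.analyticAt_fun_sum _ fun C _ ↦
      (analyticAt_partialZetaNumerator _).add (analyticAt_partialZetaNumerator _))
  · have h1 : (finrank ℚ K : ℂ) ≠ 0 := Nat.cast_ne_zero.mpr finrank_pos.ne'
    have h2 : ((volume (unitDomain K)).toReal : ℂ) ≠ 0 := ofReal_ne_zero.mpr
      (ENNReal.toReal_pos (volume_unitDomain_ne_zero K) (volume_unitDomain_ne_top K)).ne'
    have h3 : (mellinConst K : ℂ) ≠ 0 := ofReal_ne_zero.mpr (mellinConst_pos K).ne'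
    have h4 : (Fintype.card (ClassGroup (𝓞 K)) : ℂ) ≠ 0 :=
      Nat.cast_ne_zero.mpr Fintype.card_ne_zero
    simp only [partialZetaNumerator_zero, Finset.sum_const, Finset.card_univ, nsmul_eq_mul,
      ← two_mul, ofReal_mul, ofReal_div, ofReal_natCast, ofReal_ofNat]
    exact mul_ne_zero (inv_ne_zero (mul_ne_zero two_ne_zero h3)) (mul_ne_zero h4
      (mul_ne_zero two_ne_zero (neg_ne_zero.mpr (mul_ne_zero (div_ne_zero two_ne_zero h1) h2))))
  · simp only [completedZeta, partialZeta_eq_div _ hs, ← add_div, ← Finset.sum_div, mul_div_assoc]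

end DedekindZeta

end HeckeZeta

/-- The completed Dedekind zeta function
`ζ̂_K(s) = |d_K|^{s/2} Γ_ℝ(s)^{r₁} Γ_ℂ(s)^{r₂} ∏_𝒫 (1 − (N𝒫)^{−s})⁻¹`
of a number field `K` extends to a meromorphic function on `ℂ` whose only poles are simple
poles at `s = 0` and `s = 1`, and it satisfies the functional equation
`ζ̂_K(s) = ζ̂_K(1−s)`. -/
theorem statement7 (K : Type*) [Field K] [NumberField K] :
    ∃ Z : ℂ → ℂ,
      (∀ s : ℂ, 1 < s.re →
        Z s = ((|NumberField.discr K| : ℤ) : ℂ) ^ (s / 2) *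
          ((Real.pi : ℂ) ^ (-s / 2) * Complex.Gamma (s / 2)) ^
            (NumberField.InfinitePlace.nrRealPlaces K) *
          ((2 * (Real.pi : ℂ)) ^ (-s) * Complex.Gamma s) ^
            (NumberField.InfinitePlace.nrComplexPlaces K) *
          ∏' P : IsDedekindDomain.HeightOneSpectrum (𝓞 K),
            (1 - (Ideal.absNorm P.asIdeal : ℂ) ^ (-s))⁻¹) ∧
      (∀ s : ℂ, s ≠ 0 → s ≠ 1 → AnalyticAt ℂ Z s) ∧
      (∃ g : ℂ → ℂ, AnalyticAt ℂ g 0 ∧ g 0 ≠ 0 ∧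
        ∀ᶠ s in nhdsWithin (0 : ℂ) {(0 : ℂ)}ᶜ, Z s = g s / s) ∧
      (∃ g : ℂ → ℂ, AnalyticAt ℂ g 1 ∧ g 1 ≠ 0 ∧
        ∀ᶠ s in nhdsWithin (1 : ℂ) {(1 : ℂ)}ᶜ, Z s = g s / (s - 1)) ∧
      (∀ s : ℂ, s ≠ 0 → s ≠ 1 → Z s = Z (1 - s)) := by
  obtain ⟨g, hg, hg0, hZ⟩ := HeckeZeta.exists_completedZeta_eq_div K
  refine ⟨HeckeZeta.completedZeta K, fun s hs ↦ ?_,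
    fun s h0 h1 ↦ HeckeZeta.analyticAt_completedZeta K h0 h1, ⟨g, hg, hg0, ?_⟩,
    ⟨fun s ↦ -g (1 - s), ?_, by simpa using hg0, ?_⟩,
    fun s _ _ ↦ (HeckeZeta.completedZeta_one_sub K s).symm⟩
  · rw [HeckeZeta.completedZeta_eq K hs, HeckeZeta.tprod_eq_tsum_absNormCPow K hs,
      HeckeZeta.infiniteFactor]
  · filter_upwards [self_mem_nhdsWithin] with s hs using hZ s hs
  · exact (AnalyticAt.comp (g := g) (f := fun s : ℂ ↦ 1 - s) (by simpa using hg)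
      (analyticAt_const.sub analyticAt_id)).neg
  · filter_upwards [self_mem_nhdsWithin] with s hs
    have hs' : s - 1 ≠ 0 := sub_ne_zero.mpr hs
    rw [← HeckeZeta.completedZeta_one_sub K s, hZ _ (sub_ne_zero.mpr (Ne.symm hs)),
      ← neg_sub s 1, div_neg, neg_div]
end

section
/- Let A and B be subsets of ℕ and let (u_k)_{k∈A} and (v_l)_{l∈B} be two families of complex numbers (with possible repetition) lying in the closed strip {z ∈ ℂ : 0 ≤ Re z ≤ 1}. Assume that Σ_{k∈A} 1/(1 + |u_k|²) + Σ_{l∈B} 1/(1 + |v_l|²) < ∞, and that for every smooth function α : ℝ → ℝ with compact support contained in (0,∞) one has Σ_{k∈A} ∫₀^∞ α(s) e^{s u_k} ds = Σ_{l∈B} ∫₀^∞ α(s) e^{s v_l} ds. Then there exists a bijection ξ : A → B such that u_k = v_{ξ(k)} for every k ∈ A. -/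
open Complex Set Filter

section CubicPoleSeries

open Topology

variable {ι : Type*} {u : ι → ℂ}

theorem finite_norm_le_of_summable (hu : Summable fun k => 1 / (1 + ‖u k‖ ^ 2)) (R : ℝ) :
    {k | ‖u k‖ ≤ R}.Finite := by
  have h0 : (0 : ℝ) < 1 / (1 + R ^ 2) := by positivity
  have h1 := hu.tendsto_cofinite_zero.eventually_lt_const h0
  refine (eventually_cofinite.1 h1).subset fun k (hk : ‖u k‖ ≤ R) => ?_
  simp only [mem_ofPred_eq, not_lt]
  gcongr

theorem countable_of_summable_cubic (hu : Summable fun k => 1 / (1 + ‖u k‖ ^ 2)) :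
    Countable ι := by
  refine countable_univ_iff.1 ((countable_iUnion fun n : ℕ =>
    (finite_norm_le_of_summable hu n).countable).mono fun k _ => ?_)
  obtain ⟨n, hn⟩ := exists_nat_ge ‖u k‖
  exact mem_iUnion.2 ⟨n, hn⟩

/-- Away from finitely many indices, the terms `1 / (z - u k) ^ 3` are dominated on `ball p 1`. -/
theorem exists_finset_cubic_bound (hu : Summable fun k => 1 / (1 + ‖u k‖ ^ 2)) (p : ℂ) :
    ∃ T : Finset ι, ∀ k ∉ T, ∀ z ∈ Metric.ball p 1,
      z ≠ u k ∧ ‖1 / (z - u k) ^ 3‖ ≤ 8 * (1 / (1 + ‖u k‖ ^ 2)) := by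
  refine ⟨(finite_norm_le_of_summable hu (2 * ‖p‖ + 2)).toFinset, fun k hk z hz => ?_⟩
  simp only [Finite.mem_toFinset, mem_ofPred_eq, not_le] at hk
  have hp := norm_nonneg p
  have h1 : ‖z‖ ≤ ‖p‖ + 1 := by
    have := norm_le_norm_add_norm_sub' z p
    rw [mem_ball_iff_norm] at hz
    linarith
  have h2 : ‖u k‖ / 2 ≤ ‖z - u k‖ := by
    have := norm_sub_norm_le (u k) z
    rw [norm_sub_rev] at this
    linarith
  refine ⟨fun h => ?_, ?_⟩
  · rw [h, sub_self, norm_zero] at h2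
    linarith
  · have h4 : 0 < ‖z - u k‖ := by linarith
    rw [norm_div, norm_one, norm_pow, mul_one_div, div_le_div_iff₀ (by positivity) (by positivity)]
    have h3 : (‖u k‖ / 2) ^ 3 ≤ ‖z - u k‖ ^ 3 := by gcongr
    nlinarith [mul_nonneg (sq_nonneg ‖u k‖) (show 0 ≤ ‖u k‖ - 2 by linarith)]

/-- Near `p`, the series `∑ 1 / (z - u k) ^ 3` is a finite sum plus a differentiable function. -/
theorem exists_cubic_series_decomposition (hu : Summable fun k => 1 / (1 + ‖u k‖ ^ 2)) (p : ℂ) :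
    ∃ (T : Finset ι) (r : ℂ → ℂ), (∀ k ∉ T, ∀ z ∈ Metric.ball p 1, z ≠ u k) ∧
      DifferentiableOn ℂ r (Metric.ball p 1) ∧
      ∀ z ∈ Metric.ball p 1, ∑' k, 1 / (z - u k) ^ 3 = ∑ k ∈ T, 1 / (z - u k) ^ 3 + r z := by
  obtain ⟨T, hT⟩ := exists_finset_cubic_bound hu p
  have hs : Summable fun k : {k // k ∉ T} => 8 * (1 / (1 + ‖u k‖ ^ 2)) :=
    (hu.comp_injective Subtype.val_injective).mul_left 8
  refine ⟨T, fun z => ∑' k : {k // k ∉ T}, 1 / (z - u k) ^ 3, fun k hk z hz => (hT k hk z hz).1,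
    differentiableOn_tsum_of_summable_norm hs (fun k z hz => ?_) Metric.isOpen_ball
      fun k z hz => (hT k k.2 z hz).2, fun z hz => ?_⟩
  · have := sub_ne_zero.2 (hT k k.2 z hz).1
    fun_prop (disch := simpa using this)
  · have h1 : Summable fun k : {k // k ∉ T} => 1 / (z - u k) ^ 3 :=
      .of_norm_bounded hs fun k => (hT k k.2 z hz).2
    have h2 : Summable fun k => 1 / (z - u k) ^ 3 := (Finset.summable_compl_iff T).1 h1
    exact (h2.sum_add_tsum_subtype_compl T).symm

theorem eventually_notMem_range_of_summable (hu : Summable fun k => 1 / (1 + ‖u k‖ ^ 2)) (p : ℂ) :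
    ∀ᶠ z in 𝓝[≠] p, z ∉ range u := by
  obtain ⟨T, r, hT, -, -⟩ := exists_cubic_series_decomposition hu p
  have h1 : ∀ᶠ z in 𝓝[≠] p, z ∉ (u '' T) \ {p} :=
    nhdsWithin_le_nhds ((((T.finite_toSet.image u).sdiff).isClosed.isOpen_compl).mem_nhds
      (by simp))
  filter_upwards [h1, nhdsWithin_le_nhds (Metric.ball_mem_nhds p one_pos), self_mem_nhdsWithin]
    with z hz hzb hzp
  rintro ⟨k, rfl⟩
  by_cases hk : k ∈ T
  · exact hz ⟨⟨k, hk, rfl⟩, hzp⟩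
  · exact hT k hk _ hzb rfl

theorem isClosed_range_of_summable (hu : Summable fun k => 1 / (1 + ‖u k‖ ^ 2)) :
    IsClosed (range u) := by
  rw [← isOpen_compl_iff, isOpen_iff_mem_nhds]
  intro p hp
  have := eventually_notMem_range_of_summable hu p
  rw [eventually_nhdsWithin_iff] at this
  filter_upwards [this] with z hz
  by_cases h : z = p
  · rwa [h]
  · exact hz h

theorem differentiableAt_cubic_series (hu : Summable fun k => 1 / (1 + ‖u k‖ ^ 2)) {p : ℂ}
    (hp : p ∉ range u) : DifferentiableAt ℂ (fun z => ∑' k, 1 / (z - u k) ^ 3) p := by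
  obtain ⟨T, r, hT, hr, hS⟩ := exists_cubic_series_decomposition hu p
  have hb := Metric.ball_mem_nhds p one_pos
  have h1 : DifferentiableAt ℂ (fun z => ∑ k ∈ T, 1 / (z - u k) ^ 3 + r z) p := by
    refine .add (.fun_sum fun k _ => ?_) (hr.differentiableAt hb)
    have := sub_ne_zero.2 fun h : p = u k => hp ⟨k, h.symm⟩
    fun_prop (disch := simpa using this)
  exact h1.congr_of_eventuallyEq (eventually_of_mem hb hS)

/-- The coefficient of the triple pole at `p` is the multiplicity of `p` in the family. -/
theorem tendsto_sub_pow_mul_cubic_series (hu : Summable fun k => 1 / (1 + ‖u k‖ ^ 2)) (p : ℂ) :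
    Tendsto (fun z => (z - p) ^ 3 * ∑' k, 1 / (z - u k) ^ 3) (𝓝[≠] p)
      (𝓝 (Nat.card {k // u k = p} : ℂ)) := by
  classical
  obtain ⟨T, r, hT, hr, hS⟩ := exists_cubic_series_decomposition hu p
  have hb := Metric.ball_mem_nhds p one_pos
  have hpT : ∀ k, u k = p → k ∈ T := fun k hk => by
    by_contra h
    exact hT k h p (Metric.mem_ball_self one_pos) hk.symm
  have hcard : (Nat.card {k // u k = p} : ℂ) =
      ∑ k ∈ T, (if u k = p then 1 else 0) + (p - p) ^ 3 * r p := by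
    rw [Finset.sum_boole, sub_self, Nat.subtype_card (T.filter fun k => u k = p)]
    · simp
    · intro k
      simpa using hpT k
  rw [hcard]
  have hterm : ∀ k ∈ T, Tendsto (fun z => (z - p) ^ 3 * (1 / (z - u k) ^ 3)) (𝓝[≠] p)
      (𝓝 (if u k = p then 1 else 0)) := by
    intro k _
    split_ifs with hk
    · refine tendsto_const_nhds.congr' ?_
      filter_upwards [self_mem_nhdsWithin] with z hz
      rw [hk, mul_one_div_cancel (pow_ne_zero 3 (sub_ne_zero.2 hz))]
    · have h1 : ContinuousAt (fun z => (z - p) ^ 3 * (1 / (z - u k) ^ 3)) p := by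
        have := sub_ne_zero.2 (Ne.symm hk)
        fun_prop (disch := simpa using this)
      simpa using h1.tendsto.mono_left nhdsWithin_le_nhds
  have hrem : Tendsto (fun z => (z - p) ^ 3 * r z) (𝓝[≠] p) (𝓝 ((p - p) ^ 3 * r p)) := by
    have h1 : ContinuousAt r p := (hr.differentiableAt hb).continuousAt
    have h2 : ContinuousAt (fun z => (z - p) ^ 3 * r z) p := by fun_prop
    exact h2.tendsto.mono_left nhdsWithin_le_nhds
  refine ((tendsto_finsetSum T hterm).add hrem).congr' ?_
  filter_upwards [nhdsWithin_le_nhds hb] with z hz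
  rw [hS z hz, mul_add, Finset.mul_sum]

variable {κ : Type*} {v : κ → ℂ}

theorem card_fiber_eq_of_cubic_series_eq (hu : Summable fun k => 1 / (1 + ‖u k‖ ^ 2))
    (hv : Summable fun l => 1 / (1 + ‖v l‖ ^ 2)) {z₀ : ℂ} (hz₀u : z₀ ∉ range u)
    (hz₀v : z₀ ∉ range v)
    (h : ∃ᶠ z in 𝓝[≠] z₀, ∑' k, 1 / (z - u k) ^ 3 = ∑' l, 1 / (z - v l) ^ 3) (p : ℂ) :
    Nat.card {k // u k = p} = Nat.card {l // v l = p} := by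
  have := countable_of_summable_cubic hu
  have := countable_of_summable_cubic hv
  have hopen : IsOpen (range u ∪ range v)ᶜ :=
    ((isClosed_range_of_summable hu).union (isClosed_range_of_summable hv)).isOpen_compl
  have hconn : IsPreconnected (range u ∪ range v)ᶜ :=
    (((countable_range u).union (countable_range v)).isPathConnected_compl_of_one_lt_rank
      (by rw [Complex.rank_real_complex]; exact Cardinal.one_lt_two)).isConnected.isPreconnected
  have heq : EqOn (fun z => ∑' k, 1 / (z - u k) ^ 3) (fun z => ∑' l, 1 / (z - v l) ^ 3)
      (range u ∪ range v)ᶜ := AnalyticOnNhd.eqOn_of_preconnected_of_frequently_eq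
    (DifferentiableOn.analyticOnNhd (fun z hz => (differentiableAt_cubic_series hu
      fun h => hz (Or.inl h)).differentiableWithinAt) hopen)
    (DifferentiableOn.analyticOnNhd (fun z hz => (differentiableAt_cubic_series hv
      fun h => hz (Or.inr h)).differentiableWithinAt) hopen)
    hconn (z₀ := z₀) (by simp [-mem_range, hz₀u, hz₀v]) h
  have hlim := (tendsto_sub_pow_mul_cubic_series hu p).congr' (f₂ :=
      fun z => (z - p) ^ 3 * ∑' l, 1 / (z - v l) ^ 3) <| by
    filter_upwards [eventually_notMem_range_of_summable hu p,
      eventually_notMem_range_of_summable hv p] with z h1 h2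
    exact congrArg _ (heq (by simp [-mem_range, h1, h2] : z ∈ (range u ∪ range v)ᶜ))
  exact_mod_cast tendsto_nhds_unique hlim (tendsto_sub_pow_mul_cubic_series hv p)

theorem exists_equiv_of_card_fiber_eq (hu : Summable fun k => 1 / (1 + ‖u k‖ ^ 2))
    (hv : Summable fun l => 1 / (1 + ‖v l‖ ^ 2))
    (h : ∀ p, Nat.card {k // u k = p} = Nat.card {l // v l = p}) :
    ∃ ξ : ι ≃ κ, ∀ k, u k = v (ξ k) := by
  have hfu (p : ℂ) : Finite {k // u k = p} :=
    ((finite_norm_le_of_summable hu ‖p‖).subset fun k (hk : u k = p) => by simp [hk]).to_subtype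
  have hfv (p : ℂ) : Finite {l // v l = p} :=
    ((finite_norm_le_of_summable hv ‖p‖).subset fun l (hl : v l = p) => by simp [hl]).to_subtype
  exact ⟨.ofFiberEquiv fun p => (Finite.equivFin _).trans ((finCongr (h p)).trans (Finite.equivFin _).symm),
    fun k => (Equiv.ofFiberEquiv_map _ k).symm⟩

end CubicPoleSeries

section LaplaceTransform

open MeasureTheory Topology

variable {g : ℝ → ℝ}

theorem integrable_mul_exp_of_hasCompactSupport (hg : Continuous g) (hc : HasCompactSupport g)
    (y : ℂ) : Integrable fun s : ℝ => (g s : ℂ) * cexp (-(s * y)) := by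
  have hc' : HasCompactSupport fun s : ℝ => (g s : ℂ) := HasCompactSupport.comp_left (g := ofReal) hc ofReal_zero
  exact Continuous.integrable_of_hasCompactSupport (by fun_prop) hc'.mul_right

theorem integral_deriv_mul_exp (hg : ContDiff ℝ 1 g) (hc : HasCompactSupport g) (y : ℂ) :
    ∫ s : ℝ, ((deriv g s : ℝ) : ℂ) * cexp (-(s * y)) = y * ∫ s : ℝ, (g s : ℂ) * cexp (-(s * y)) := by
  have hd : ∀ s : ℝ, HasDerivAt (fun s : ℝ => (g s : ℂ)) ((deriv g s : ℝ) : ℂ) s := fun s =>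
    ((hg.differentiable one_ne_zero) s).hasDerivAt.ofReal_comp
  have he : ∀ s : ℝ, HasDerivAt (fun s : ℝ => cexp (-(s * y))) (cexp (-(s * y)) * -y) s :=
    fun s => by
      have h1 : HasDerivAt (fun s : ℝ => -((s : ℂ) * y)) (-y) s := by
        simpa using ((hasDerivAt_id s).ofReal_comp.mul_const y).fun_neg
      exact h1.cexp
  have hi := integrable_mul_exp_of_hasCompactSupport hg.continuous hc y
  have hi' := integrable_mul_exp_of_hasCompactSupport (hg.continuous_deriv le_rfl)
    hc.deriv y
  have h1 := integral_mul_deriv_eq_deriv_mul_of_integrable (fun s _ => hd s) (fun s _ => he s)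
    ((hi.mul_const (-y)).congr (.of_forall fun s => by simp [mul_assoc])) hi' hi
  rw [← neg_eq_iff_eq_neg] at h1
  rw [← h1, ← integral_neg, ← integral_const_mul]
  congr 1 with s
  ring

/-- Decay of the Laplace transform of a smooth function supported in `[1, ∞)`. -/
theorem exists_norm_sq_mul_laplace_le (hg : ContDiff ℝ 2 g) (hc : HasCompactSupport g)
    (hs : tsupport g ⊆ Ici 1) :
    ∃ C, ∀ y : ℂ, 0 ≤ y.re →
      ‖y‖ ^ 2 * ‖∫ s : ℝ, (g s : ℂ) * cexp (-(s * y))‖ ≤ C * Real.exp (-y.re) := by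
  have hg1 : ContDiff ℝ 1 (deriv g) := by
    exact ((contDiff_succ_iff_deriv (n := 1)).1 (by exact_mod_cast hg)).2.2
  have hcont : Continuous (deriv (deriv g)) := hg1.continuous_deriv le_rfl
  have hs' : tsupport (deriv (deriv g)) ⊆ Ici 1 :=
    tsupport_deriv_subset.trans (tsupport_deriv_subset.trans hs)
  refine ⟨∫ s, ‖deriv (deriv g) s‖, fun y hy => ?_⟩
  rw [← norm_pow, ← norm_mul, sq, mul_assoc, ← integral_deriv_mul_exp (hg.of_le one_le_two) hc,
    ← integral_deriv_mul_exp hg1 hc.deriv, ← integral_mul_const]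
  refine norm_integral_le_of_norm_le
    ((hcont.integrable_of_hasCompactSupport hc.deriv.deriv).norm.mul_const _)
    (.of_forall fun s => ?_)
  by_cases h : s ∈ tsupport (deriv (deriv g))
  · have h1 : (1 : ℝ) ≤ s := hs' h
    rw [norm_mul, norm_real, norm_exp]
    gcongr
    simp
    nlinarith
  · simp [image_eq_zero_of_notMem_tsupport h]

theorem integral_sq_mul_exp_neg_mul_Ioi {y : ℂ} (hy : 0 < y.re) :
    ∫ t in Ioi (0 : ℝ), (t : ℂ) ^ 2 * cexp (-(y * t)) = 2 / y ^ 3 := by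
  have hy0 : y ≠ 0 := by rintro rfl; simp at hy
  have hnorm (n : ℕ) (t : ℝ) (ht : 0 ≤ t) :
      ‖(t : ℂ) ^ n * cexp (-(y * t))‖ = t ^ (n : ℝ) * Real.exp (-y.re * t) := by
    rw [norm_mul, norm_pow, norm_real, norm_exp, Real.norm_of_nonneg ht, Real.rpow_natCast]
    simp
  have hlim (n : ℕ) : Tendsto (fun t : ℝ => (t : ℂ) ^ n * cexp (-(y * t))) atTop (𝓝 0) := by
    refine tendsto_zero_iff_norm_tendsto_zero.2
      ((tendsto_rpow_mul_exp_neg_mul_atTop_nhds_zero n y.re hy).congr' ?_)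
    filter_upwards [eventually_ge_atTop 0] with t ht using (hnorm n t ht).symm
  have hint : IntegrableOn (fun t : ℝ => (t : ℂ) ^ 2 * cexp (-(y * t))) (Ioi 0) := by
    have := integrableOn_rpow_mul_exp_neg_mul_rpow (s := (2 : ℕ)) (p := 1) (b := y.re)
      (by norm_num) one_pos hy
    refine Integrable.mono' this (Continuous.aestronglyMeasurable (by fun_prop)) ?_
    filter_upwards [ae_restrict_mem measurableSet_Ioi] with t ht
    rw [hnorm 2 t (le_of_lt ht), Real.rpow_one]
  have hderiv (t : ℝ) : HasDerivAt (fun t : ℝ => -(1 / y) * ((t : ℂ) ^ 2 * cexp (-(y * t))) -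
      2 / y ^ 2 * ((t : ℂ) ^ 1 * cexp (-(y * t))) - 2 / y ^ 3 * ((t : ℂ) ^ 0 * cexp (-(y * t))))
      ((t : ℂ) ^ 2 * cexp (-(y * t))) t := by
    have h1 : HasDerivAt (fun t : ℝ => (t : ℂ)) 1 t := by
      simpa using (hasDerivAt_id t).ofReal_comp
    have h2 := ((h1.const_mul y).neg).cexp
    convert! ((((h1.pow 2).mul h2).const_mul (-(1 / y))).sub
      (((h1.pow 1).mul h2).const_mul (2 / y ^ 2))).sub
      (((h1.pow 0).mul h2).const_mul (2 / y ^ 3)) using 1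
    simp
    field_simp
    ring
  rw [integral_Ioi_of_hasDerivAt_of_tendsto' (fun t _ => hderiv t) hint
    ((((hlim 2).const_mul _).sub ((hlim 1).const_mul _)).sub ((hlim 0).const_mul _))]
  simp

theorem integrable_laplace_kernel (hg : Continuous g) (hc : HasCompactSupport g)
    (hs : tsupport g ⊆ Ici 1) {y : ℂ} (hy : 0 < y.re) :
    Integrable (Function.uncurry fun t s : ℝ => (t : ℂ) ^ 2 * ((g s : ℂ) * cexp (-(s * (t * y)))))
      ((volume.restrict (Ioi 0)).prod volume) := by
  have h1 : Integrable (fun t : ℝ => t ^ 2 * Real.exp (-(y.re * t))) (volume.restrict (Ioi 0)) := by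
    have := integrableOn_rpow_mul_exp_neg_mul_rpow (s := 2) (p := 1) (b := y.re)
      (by norm_num) one_pos hy
    simpa [IntegrableOn] using this
  refine (h1.mul_prod (hg.integrable_of_hasCompactSupport hc).norm).mono'
    (Continuous.aestronglyMeasurable (by unfold Function.uncurry; fun_prop)) ?_
  have h2 : ∀ᵐ z : ℝ × ℝ ∂((volume.restrict (Ioi 0)).prod volume), z.1 ∈ Ioi (0 : ℝ) :=
    Measure.quasiMeasurePreserving_fst.ae (ae_restrict_mem measurableSet_Ioi)
  filter_upwards [h2] with ⟨t, s⟩ ht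
  simp only [Function.uncurry, mem_Ioi] at ht ⊢
  by_cases h : s ∈ tsupport g
  · have h1 : (1 : ℝ) ≤ s := hs h
    rw [norm_mul, norm_mul, norm_pow, norm_real, norm_real, norm_exp, Real.norm_of_nonneg ht.le,
      mul_comm ‖g s‖, ← mul_assoc]
    gcongr
    simp
    nlinarith [mul_pos hy ht]
  · simp [image_eq_zero_of_notMem_tsupport h]

theorem integral_sq_mul_laplace {b : ℝ → ℝ} (hg : Continuous g) (hc : HasCompactSupport g)
    (hs : tsupport g ⊆ Ici 1) (hb : ∀ s, g s = s ^ 3 * b s) (hb0 : b 0 = 0) {y : ℂ}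
    (hy : 0 < y.re) :
    ∫ t in Ioi (0 : ℝ), (t : ℂ) ^ 2 * ∫ s : ℝ, (g s : ℂ) * cexp (-(s * (t * y))) =
      2 * (∫ s, b s : ℝ) * (1 / y ^ 3) := by
  simp only [← integral_const_mul]
  rw [integral_integral_swap (integrable_laplace_kernel hg hc hs hy), ← integral_complex_ofReal,
    ← integral_const_mul, ← integral_mul_const]
  refine integral_congr_ae (.of_forall fun s => ?_)
  by_cases h : s ∈ tsupport g
  · have h1 : (1 : ℝ) ≤ s := hs h
    have hsy : 0 < ((s : ℂ) * y).re := by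
      rw [re_ofReal_mul]; positivity
    have h2 := integral_sq_mul_exp_neg_mul_Ioi hsy
    calc ∫ t in Ioi (0 : ℝ), (t : ℂ) ^ 2 * ((g s : ℂ) * cexp (-(s * (t * y))))
        = ∫ t in Ioi (0 : ℝ), (g s : ℂ) * ((t : ℂ) ^ 2 * cexp (-(s * y * t))) := by
          congr 1 with t
          ring_nf
      _ = _ := by
          rw [integral_const_mul, h2, hb]
          have h3 : (s : ℂ) ≠ 0 := by exact_mod_cast (by linarith : s ≠ 0)
          have h4 : y ≠ 0 := by rintro rfl; simp at hy
          push_cast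
          field_simp
  · have h0 := image_eq_zero_of_notMem_tsupport h
    have : b s = 0 := by
      by_cases h3 : s = 0
      · rw [h3, hb0]
      · simpa [hb, h3] using h0
    simp [h0, this]

variable {ι : Type*} {u : ι → ℂ}

theorem summable_one_div_norm_sub_sq (hu : Summable fun k => 1 / (1 + ‖u k‖ ^ 2))
    (hre : ∀ k, (u k).re ≤ 1) {x : ℝ} (hx : 2 ≤ x) :
    Summable fun k => 1 / ‖(x : ℂ) - u k‖ ^ 2 := by
  refine .of_nonneg_of_le (fun k => by positivity) (fun k => ?_) (hu.mul_left (3 + 2 * x ^ 2))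
  have h1 : 1 ≤ ‖(x : ℂ) - u k‖ := by
    refine le_trans ?_ (re_le_norm _)
    simp
    linarith [hre k]
  have h2 : ‖u k‖ ≤ ‖(x : ℂ) - u k‖ + x := by
    have := norm_le_norm_add_norm_sub' (u k) x
    rw [norm_sub_rev, norm_real, Real.norm_of_nonneg (by linarith)] at this
    linarith
  rw [mul_one_div, div_le_div_iff₀ (by positivity) (by positivity)]
  have h3 : ‖u k‖ ^ 2 ≤ (‖(x : ℂ) - u k‖ + x) ^ 2 := by gcongr
  have h4 : 0 ≤ ‖(x : ℂ) - u k‖ ^ 2 - 1 := by nlinarith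
  nlinarith [sq_nonneg (‖(x : ℂ) - u k‖ - x), mul_nonneg (sq_nonneg x) h4]

theorem integral_tsum_sq_mul_laplace {b : ℝ → ℝ} (hg : ContDiff ℝ 2 g)
    (hc : HasCompactSupport g) (hs : tsupport g ⊆ Ici 1) (hb : ∀ s, g s = s ^ 3 * b s)
    (hb0 : b 0 = 0) [Countable ι] (hu : Summable fun k => 1 / (1 + ‖u k‖ ^ 2))
    (hre : ∀ k, (u k).re ≤ 1) {x : ℝ} (hx : 2 ≤ x) :
    ∫ t in Ioi (0 : ℝ), ∑' k, (t : ℂ) ^ 2 * ∫ s : ℝ, (g s : ℂ) * cexp (-(s * (t * (x - u k)))) =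
      2 * (∫ s, b s : ℝ) * ∑' k, 1 / ((x : ℂ) - u k) ^ 3 := by
  have hy (k : ι) : 1 ≤ ((x : ℂ) - u k).re := by
    simp
    linarith [hre k]
  have hy0 (k : ι) : 0 < ((x : ℂ) - u k).re := one_pos.trans_le (hy k)
  have hint (k : ι) : Integrable (fun t : ℝ => (t : ℂ) ^ 2 *
      ∫ s : ℝ, (g s : ℂ) * cexp (-(s * (t * (x - u k))))) (volume.restrict (Ioi 0)) := by
    have := (integrable_laplace_kernel hg.continuous hc hs (hy0 k)).integral_prod_left
    simpa only [Function.uncurry, integral_const_mul] using this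
  obtain ⟨C, hC⟩ := exists_norm_sq_mul_laplace_le hg hc hs
  have hC0 : 0 ≤ C := by
    have := hC 0 le_rfl
    simpa using this
  rw [← integral_tsum_of_summable_integral_norm hint, ← tsum_mul_left]
  · exact tsum_congr fun k => integral_sq_mul_laplace hg.continuous hc hs hb hb0 (hy0 k)
  refine .of_nonneg_of_le (fun k => by positivity) (fun k => ?_)
    ((summable_one_div_norm_sub_sq hu hre hx).mul_left (∫ t in Ioi (0 : ℝ), C * Real.exp (-1 * t)))
  rw [← integral_mul_const]
  refine setIntegral_mono_on (hint k).norm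
    (((exp_neg_integrableOn_Ioi 0 one_pos).const_mul C).mul_const _) measurableSet_Ioi
    fun t (ht : 0 < t) => ?_
  have hyn : 0 < ‖(x : ℂ) - u k‖ := (hy0 k).trans_le (re_le_norm _)
  have h1 := hC (t * (x - u k)) (by rw [re_ofReal_mul]; have := hy0 k; positivity)
  rw [mul_one_div, le_div_iff₀ (by positivity)]
  rw [norm_mul, norm_real, Real.norm_of_nonneg ht.le] at h1
  rw [norm_mul, norm_pow, norm_real, Real.norm_of_nonneg ht.le]
  refine le_trans (le_of_eq (by ring)) (h1.trans ?_)
  gcongr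
  rw [re_ofReal_mul]
  nlinarith [hy k]

theorem integral_dilation_mul_exp (hs : tsupport g ⊆ Ici 1) {t : ℝ} (ht : 0 < t) (x : ℝ) (w : ℂ) :
    ∫ s in Ioi (0 : ℝ), ((g (s / t) * Real.exp (-(x * s)) : ℝ) : ℂ) * cexp (s * w) =
      t * ∫ s : ℝ, (g s : ℂ) * cexp (-(s * (t * (x - w)))) := by
  rw [setIntegral_eq_integral_of_forall_compl_eq_zero]
  · have h := Measure.integral_comp_div
      (fun s : ℝ => (g s : ℂ) * cexp (-(s * (t * (x - w))))) t
    rw [abs_of_pos ht, real_smul] at h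
    rw [← h]
    congr 1 with s
    have h3 : (t : ℂ) ≠ 0 := by exact_mod_cast ht.ne'
    push_cast
    rw [mul_assoc, ← Complex.exp_add]
    congr 2
    field_simp
    ring
  · intro s hs0
    rw [mem_Ioi, not_lt] at hs0
    have : s / t ∉ tsupport g := fun h => by
      have h1 : (1 : ℝ) ≤ s / t := hs h
      have h2 : s / t ≤ 0 := div_nonpos_of_nonpos_of_nonneg hs0 ht.le
      linarith
    simp [image_eq_zero_of_notMem_tsupport this]

theorem tsupport_dilation_mul_subset (g f : ℝ → ℝ) (t : ℝ) :
    tsupport (fun s => g (s / t) * f s) ⊆ (fun s => s / t) ⁻¹' tsupport g :=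
  (tsupport_mul_subset_left (f := fun s => g (s / t))).trans
    (closure_minimal (fun _ hs => subset_tsupport g hs)
      ((isClosed_tsupport g).preimage (continuous_id.div_const t)))

theorem exists_cubic_bump : ∃ g b : ℝ → ℝ, ContDiff ℝ (⊤ : ℕ∞) g ∧ HasCompactSupport g ∧
    tsupport g ⊆ Ici 1 ∧ (∀ s, g s = s ^ 3 * b s) ∧ b 0 = 0 ∧ 0 < ∫ s, b s := by
  let b : ContDiffBump (2 : ℝ) := ⟨1 / 2, 1, by norm_num, by norm_num⟩
  refine ⟨fun s => s ^ 3 * b s, b, (contDiff_id.pow 3).mul b.contDiff, b.hasCompactSupport.mul_left,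
    tsupport_mul_subset_right.trans ?_, fun s => rfl, b.zero_of_le_dist ?_, b.integral_pos⟩
  · rw [b.tsupport_eq, Real.closedBall_eq_Icc]
    intro s hs
    simp only [b] at hs
    exact le_trans (by norm_num) hs.1
  · simp [b]

end LaplaceTransform

/-- Let `(u_k)_{k∈A}` and `(v_l)_{l∈B}` be families of complex numbers in the closed strip
`0 ≤ Re z ≤ 1` with `Σ 1/(1+|u_k|²) + Σ 1/(1+|v_l|²) < ∞`. If for every smooth `α : ℝ → ℝ`
with compact support contained in `(0,∞)` the (convergent) sums
`Σ_{k∈A} ∫₀^∞ α(s) e^{s u_k} ds` and `Σ_{l∈B} ∫₀^∞ α(s) e^{s v_l} ds` are equal, then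
there is a bijection `ξ : A → B` with `u_k = v_{ξ(k)}` for all `k ∈ A`. -/
theorem statement9 (A B : Set ℕ) (u v : ℕ → ℂ)
    (hu : ∀ k ∈ A, 0 ≤ (u k).re ∧ (u k).re ≤ 1)
    (hv : ∀ l ∈ B, 0 ≤ (v l).re ∧ (v l).re ≤ 1)
    (husum : Summable fun k : A => 1 / (1 + ‖u k‖ ^ 2))
    (hvsum : Summable fun l : B => 1 / (1 + ‖v l‖ ^ 2))
    (h : ∀ α : ℝ → ℝ, ContDiff ℝ (⊤ : ℕ∞) α → HasCompactSupport α →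
      tsupport α ⊆ Ioi (0 : ℝ) →
      (Summable fun k : A => ∫ s in Ioi (0 : ℝ), (α s : ℂ) * Complex.exp (s * u k)) ∧
      (Summable fun l : B => ∫ s in Ioi (0 : ℝ), (α s : ℂ) * Complex.exp (s * v l)) ∧
      ∑' k : A, ∫ s in Ioi (0 : ℝ), (α s : ℂ) * Complex.exp (s * u k) =
        ∑' l : B, ∫ s in Ioi (0 : ℝ), (α s : ℂ) * Complex.exp (s * v l)) :
    ∃ ξ : A ≃ B, ∀ k : A, u k = v (ξ k) := by
  have hu' : ∀ k : A, (u k).re ≤ 1 := fun k => (hu k k.2).2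
  have hv' : ∀ l : B, (v l).re ≤ 1 := fun l => (hv l l.2).2
  obtain ⟨g, b, hg, hc, hs, hb, hb0, hbpos⟩ := exists_cubic_bump
  have hg2 : ContDiff ℝ 2 g := contDiff_infty.1 hg 2
  have hlap : ∀ x t : ℝ, 0 < t →
      ∑' k : A, (t : ℂ) ^ 2 * ∫ s : ℝ, (g s : ℂ) * cexp (-(s * (t * (x - u k)))) =
        ∑' l : B, (t : ℂ) ^ 2 * ∫ s : ℝ, (g s : ℂ) * cexp (-(s * (t * (x - v l)))) := by
    intro x t ht
    have hc' : HasCompactSupport fun s => g (s / t) * Real.exp (-(x * s)) := by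
      simp only [div_eq_mul_inv]
      exact (hc.comp_homeomorph (Homeomorph.mulRight₀ t⁻¹ (inv_ne_zero ht.ne'))).mul_right
    have hst : tsupport (fun s => g (s / t) * Real.exp (-(x * s))) ⊆ Ioi 0 := fun s h => by
      have h1 : 1 ≤ s / t := hs (tsupport_dilation_mul_subset _ _ _ h)
      rw [le_div_iff₀ ht] at h1
      exact lt_of_lt_of_le (by linarith) h1
    have h1 := (h (fun s => g (s / t) * Real.exp (-(x * s)))
      ((hg.comp (contDiff_id.div_const t)).mul (by fun_prop)) hc' hst).2.2
    simp only [integral_dilation_mul_exp hs ht, tsum_mul_left] at h1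
    simp only [tsum_mul_left]
    rw [mul_left_cancel₀ (by exact_mod_cast ht.ne') h1]
  have hser : ∀ x : ℝ, 2 ≤ x →
      ∑' k : A, 1 / ((x : ℂ) - u k) ^ 3 = ∑' l : B, 1 / ((x : ℂ) - v l) ^ 3 := by
    intro x hx
    have h1 := integral_tsum_sq_mul_laplace hg2 hc hs hb hb0 husum hu' hx
    rw [MeasureTheory.setIntegral_congr_fun measurableSet_Ioi (hlap x),
      integral_tsum_sq_mul_laplace hg2 hc hs hb hb0 hvsum hv' hx] at h1
    have hK : (2 * ((∫ s, b s : ℝ) : ℂ)) ≠ 0 := by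
      exact_mod_cast (mul_pos two_pos hbpos).ne'
    exact (mul_left_cancel₀ hK h1).symm
  refine exists_equiv_of_card_fiber_eq husum hvsum
    (card_fiber_eq_of_cubic_series_eq husum hvsum (z₀ := ((2 : ℝ) : ℂ)) ?_ ?_ ?_)
  · rintro ⟨k, hk⟩
    have := hu' k
    simp only [hk, ofReal_re] at this
    norm_num at this
  · rintro ⟨l, hl⟩
    have := hv' l
    simp only [hl, ofReal_re] at this
    norm_num at this
  · have htend : Tendsto (fun x : ℝ => (x : ℂ)) (nhdsWithin 2 (Ioi 2))
        (nhdsWithin ((2 : ℝ) : ℂ) {((2 : ℝ) : ℂ)}ᶜ) :=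
      continuous_ofReal.continuousWithinAt.tendsto_nhdsWithin fun x (hx : 2 < x) =>
        fun h => hx.ne' (ofReal_injective h)
    refine htend.frequently (Eventually.frequently ?_)
    filter_upwards [self_mem_nhdsWithin] with x hx using hser x (le_of_lt hx)
end

section
/- Let A and B be subsets of ℕ and let (u_k)_{k∈A} and (v_l)_{l∈B} be two families of complex numbers lying in the closed strip {z ∈ ℂ : 0 ≤ Re z ≤ 1}. Assume that Σ_{k∈A} 1/(1 + |u_k|²) + Σ_{l∈B} 1/(1 + |v_l|²) < ∞, and that for every smooth function α : ℝ → ℝ with compact support contained in (0,∞) one has Σ_{k∈A} ∫₀^∞ α(s) e^{s u_k} ds = Σ_{l∈B} ∫₀^∞ α(s) e^{s v_l} ds. Then for every natural number r ≥ 0, Σ_{k∈A} 1/(u_k − 2)^{2+r} = Σ_{l∈B} 1/(v_l − 2)^{2+r}, both series being absolutely convergent. -/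
open Complex Set Filter

open MeasureTheory Topology

/-- The Laplace transform of a real function on the line, with values in `ℂ`. -/
noncomputable def laplaceTransform (φ : ℝ → ℝ) (z : ℂ) : ℂ :=
  ∫ x : ℝ, (φ x : ℂ) * Complex.exp (-x * z)

theorem setIntegral_Ioi_translate_dilate (φ : ℝ → ℝ) (hφ : tsupport φ ⊆ Ioi 0) {ε t : ℝ}
    (hε : 0 < ε) (ht : 0 ≤ t) (u : ℂ) :
    ∫ s in Ioi (0 : ℝ), ((φ ((s - t) / ε) * Real.exp (-2 * s) : ℝ) : ℂ) * Complex.exp (s * u) =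
      ε * (Complex.exp (-t * (2 - u)) * laplaceTransform φ (ε * (2 - u))) := by
  have hpos : ∀ x, φ x ≠ 0 → 0 < x := fun x hx => hφ (subset_tsupport φ hx)
  set g : ℝ → ℂ := fun x => (φ x : ℂ) * Complex.exp (-((ε * x + t : ℝ) : ℂ) * (2 - u)) with hg
  have h1 : ∫ s in Ioi (0 : ℝ), ((φ ((s - t) / ε) * Real.exp (-2 * s) : ℝ) : ℂ) *
      Complex.exp (s * u) = ∫ s in Ioi (0 : ℝ), g ((s - t) / ε) := by
    refine integral_congr_ae (Eventually.of_forall fun s => ?_)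
    simp only [hg]
    have : ε * ((s - t) / ε) + t = s := by field_simp; ring
    rw [this]
    push_cast
    rw [mul_assoc, ← Complex.exp_add]
    ring_nf
  rw [h1, setIntegral_eq_integral_of_forall_compl_eq_zero]
  · rw [integral_sub_right_eq_self (fun s => g (s / ε)) t, Measure.integral_comp_div,
      abs_of_pos hε, Complex.real_smul, laplaceTransform,
      ← integral_const_mul (Complex.exp (-t * (2 - u)))]
    congr 1
    refine integral_congr_ae (Eventually.of_forall fun x => ?_)
    simp only [hg]
    rw [mul_left_comm, ← Complex.exp_add]
    push_cast
    ring_nf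
  · intro s hs
    by_contra hne
    have hφs : φ ((s - t) / ε) ≠ 0 := by
      intro h0
      simp [hg, h0] at hne
    have h2 := hpos _ hφs
    rw [lt_div_iff₀ hε] at h2
    simp only [mem_Ioi, not_lt] at hs
    linarith

theorem contDiff_translate_dilate {φ : ℝ → ℝ} (hφ : ContDiff ℝ (⊤ : ℕ∞) φ) (ε t : ℝ) :
    ContDiff ℝ (⊤ : ℕ∞) fun s => φ ((s - t) / ε) * Real.exp (-2 * s) := by
  refine (hφ.comp ((contDiff_id.sub contDiff_const).div_const ε)).mul ?_
  exact Real.contDiff_exp.comp (contDiff_const.mul contDiff_id)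

theorem tsupport_translate_dilate_subset {φ : ℝ → ℝ} {ε : ℝ} (hε : 0 < ε) (t : ℝ) :
    tsupport (fun s => φ ((s - t) / ε) * Real.exp (-2 * s)) ⊆
      (fun x => ε * x + t) '' tsupport φ := by
  have he : IsClosed ((fun x : ℝ => ε * x + t) '' tsupport φ) := by
    have : (fun x : ℝ => ε * x + t) '' tsupport φ = (fun s => (s - t) / ε) ⁻¹' tsupport φ := by
      ext s
      constructor
      · rintro ⟨x, hx, rfl⟩
        simpa [hε.ne'] using hx
      · intro hs
        exact ⟨_, hs, by field_simp; ring⟩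
    rw [this]
    exact (isClosed_tsupport φ).preimage (by fun_prop)
  refine closure_minimal (fun s hs => ⟨(s - t) / ε, subset_tsupport φ ?_, ?_⟩) he
  · exact left_ne_zero_of_mul hs
  · field_simp
    ring

theorem norm_laplaceTransform_le {φ : ℝ → ℝ} (hcont : Continuous φ) (hc : HasCompactSupport φ)
    (hφ : tsupport φ ⊆ Ioi 0) (hnn : ∀ x, 0 ≤ φ x) {z : ℂ} (hz : 0 ≤ z.re) :
    ‖laplaceTransform φ z‖ ≤ ∫ x, φ x := by
  refine norm_integral_le_of_norm_le (hcont.integrable_of_hasCompactSupport hc)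
    (Eventually.of_forall fun x => ?_)
  rw [norm_mul, Complex.norm_real, Real.norm_of_nonneg (hnn x), Complex.norm_exp]
  by_cases hx : φ x = 0
  · simp [hx]
  · have hx0 : 0 < x := hφ (subset_tsupport φ hx)
    refine mul_le_of_le_one_right (hnn x) (Real.exp_le_one_iff.mpr ?_)
    simp only [Complex.mul_re, Complex.neg_re, Complex.ofReal_re, Complex.neg_im,
      Complex.ofReal_im]
    nlinarith

theorem continuous_laplaceTransform {φ : ℝ → ℝ} (hcont : Continuous φ)
    (hc : HasCompactSupport φ) : Continuous (laplaceTransform φ) := by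
  rw [← continuousOn_univ]
  refine continuousOn_integral_of_compact_support (k := tsupport φ) hc ?_ fun z x _ hx => ?_
  · refine Continuous.continuousOn ?_
    simp only [Function.uncurry_def]
    fun_prop
  · simp [image_eq_zero_of_notMem_tsupport hx]

theorem laplaceTransform_zero (φ : ℝ → ℝ) : laplaceTransform φ 0 = ((∫ x, φ x : ℝ) : ℂ) := by
  simp [laplaceTransform, integral_complex_ofReal]

theorem norm_pow_mul_exp_neg_mul (n : ℕ) (w : ℂ) {t : ℝ} (ht : 0 < t) :
    ‖(t : ℂ) ^ n * Complex.exp (-t * w)‖ = t ^ n * Real.exp (-w.re * t) := by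
  rw [norm_mul, norm_pow, Complex.norm_real, Real.norm_of_nonneg ht.le, Complex.norm_exp]
  congr 2
  simp only [Complex.mul_re, Complex.neg_re, Complex.ofReal_re, Complex.neg_im, Complex.ofReal_im]
  ring

theorem integrableOn_pow_mul_exp_neg_mul (n : ℕ) {w : ℂ} (hw : 0 < w.re) :
    IntegrableOn (fun t : ℝ => (t : ℂ) ^ n * Complex.exp (-t * w)) (Ioi 0) := by
  have hr := integrableOn_rpow_mul_exp_neg_mul_rpow (p := 1) (s := n) (b := w.re)
    (by linarith [n.cast_nonneg (α := ℝ)]) one_pos hw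
  refine Integrable.mono' hr (by fun_prop)
    ((ae_restrict_iff' measurableSet_Ioi).mpr (Eventually.of_forall fun t ht => ?_))
  rw [norm_pow_mul_exp_neg_mul n w ht]
  simp

theorem integral_pow_mul_exp_neg_mul (n : ℕ) {w : ℂ} (hw : 0 < w.re) :
    ∫ t in Ioi (0 : ℝ), (t : ℂ) ^ n * Complex.exp (-t * w) = n.factorial / w ^ (n + 1) := by
  have hw0 : w ≠ 0 := by
    rintro rfl
    simp at hw
  induction n with
  | zero =>
    have := integral_exp_mul_complex_Ioi (a := -w) (by simpa using hw) 0
    simp only [Complex.ofReal_zero, mul_zero, Complex.exp_zero, neg_div_neg_eq] at this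
    simp only [pow_zero, one_mul, Nat.factorial_zero, Nat.cast_one, zero_add, pow_one, ← this]
    refine integral_congr_ae (Eventually.of_forall fun t => ?_)
    simp only
    ring_nf
  | succ n ih =>
    have hd : ∀ t ∈ Ici (0 : ℝ), HasDerivAt
        (fun t : ℝ => (t : ℂ) ^ (n + 1) * Complex.exp (-t * w))
        ((n + 1) * ((t : ℂ) ^ n * Complex.exp (-t * w)) -
          w * ((t : ℂ) ^ (n + 1) * Complex.exp (-t * w))) t := by
      intro t _
      have h1 : HasDerivAt (fun z : ℂ => z ^ (n + 1) * Complex.exp (-z * w))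
          ((n + 1) * ((t : ℂ) ^ n * Complex.exp (-t * w)) -
            w * ((t : ℂ) ^ (n + 1) * Complex.exp (-t * w))) (t : ℂ) := by
        convert! (hasDerivAt_pow (n + 1) (t : ℂ)).mul
          (((hasDerivAt_id (t : ℂ)).neg.mul_const w).cexp) using 1
        simp
        ring
      exact h1.comp_ofReal
    have hi := (integrableOn_pow_mul_exp_neg_mul n hw).const_mul ((n : ℂ) + 1)
    have hi' := (integrableOn_pow_mul_exp_neg_mul (n + 1) hw).const_mul w
    have hlim : Tendsto (fun t : ℝ => (t : ℂ) ^ (n + 1) * Complex.exp (-t * w)) atTop (𝓝 0) := by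
      rw [tendsto_zero_iff_norm_tendsto_zero]
      refine (tendsto_rpow_mul_exp_neg_mul_atTop_nhds_zero ((n + 1 : ℕ) : ℝ) w.re hw).congr' ?_
      filter_upwards [eventually_gt_atTop 0] with t ht
      rw [norm_pow_mul_exp_neg_mul _ w ht, Real.rpow_natCast]
    have := integral_Ioi_of_hasDerivAt_of_tendsto' hd (hi.sub hi') hlim
    rw [integral_sub hi hi', integral_const_mul, integral_const_mul, ih] at this
    simp only [Complex.ofReal_zero, ne_eq, Nat.add_eq_zero_iff, one_ne_zero, and_false,
      not_false_eq_true, zero_pow, zero_mul, sub_zero] at this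
    rw [← mul_right_inj' hw0, ← sub_eq_zero.mp this, Nat.factorial_succ]
    push_cast
    field_simp
    ring

/-- Summing Laplace transforms of monomials against an absolutely summable family of weights. -/
theorem tsum_mul_div_pow_eq_integral {ι : Type*} [Countable ι] (n : ℕ) {w c : ι → ℂ}
    (hw : ∀ i, 1 ≤ (w i).re) (hc : Summable fun i => ‖c i‖) :
    ∑' i, c i * (n.factorial / w i ^ (n + 1)) =
      ∫ t in Ioi (0 : ℝ), (t : ℂ) ^ n * ∑' i, Complex.exp (-t * w i) * c i := by
  have hreal : IntegrableOn (fun t : ℝ => t ^ n * Real.exp (-t)) (Ioi 0) := by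
    have := Real.GammaIntegral_convergent (s := n + 1) (by positivity)
    refine this.congr_fun (fun t _ => ?_) measurableSet_Ioi
    simp [mul_comm]
  have hle : ∀ i, ∀ t ∈ Ioi (0 : ℝ), ‖(t : ℂ) ^ n * (Complex.exp (-t * w i) * c i)‖ ≤
      ‖c i‖ * (t ^ n * Real.exp (-t)) := by
    intro i t ht
    have ht : 0 < t := ht
    rw [← mul_assoc, norm_mul, norm_pow_mul_exp_neg_mul n (w i) ht, mul_comm]
    refine mul_le_mul_of_nonneg_left ?_ (norm_nonneg _)
    refine mul_le_mul_of_nonneg_left (Real.exp_le_exp.mpr ?_) (by positivity)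
    nlinarith [hw i]
  have hint : ∀ i, Integrable (fun t : ℝ => (t : ℂ) ^ n * (Complex.exp (-t * w i) * c i))
      (volume.restrict (Ioi 0)) := fun i => by
    simpa only [mul_assoc, IntegrableOn] using
      (integrableOn_pow_mul_exp_neg_mul n (by linarith [hw i])).mul_const (c i)
  have hsum : Summable fun i => ∫ t in Ioi (0 : ℝ),
      ‖(t : ℂ) ^ n * (Complex.exp (-t * w i) * c i)‖ := by
    refine Summable.of_nonneg_of_le (fun i => integral_nonneg fun _ => norm_nonneg _)
      (fun i => ?_) (hc.mul_right (∫ t in Ioi (0 : ℝ), t ^ n * Real.exp (-t)))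
    rw [← integral_const_mul]
    exact setIntegral_mono_on (hint i).norm (hreal.const_mul _) measurableSet_Ioi (hle i)
  have key := integral_tsum_of_summable_integral_norm hint hsum
  simp only [tsum_mul_left] at key
  rw [← key]
  refine tsum_congr fun i => ?_
  rw [← integral_pow_mul_exp_neg_mul n (w := w i) (by linarith [hw i]), ← integral_const_mul]
  congr 1
  ext t
  ring

/-- For an absolutely summable family `a`, the sums `∑ a i` regularised by the factors
`laplaceTransform φ (ε * w i)` converge to `(∫ φ) * ∑ a i` as `ε → 0⁺`. -/
theorem tendsto_tsum_laplaceTransform_mul {ι : Type*} {φ : ℝ → ℝ} (hcont : Continuous φ)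
    (hc : HasCompactSupport φ) (hφ : tsupport φ ⊆ Ioi 0) (hnn : ∀ x, 0 ≤ φ x) {w a : ι → ℂ}
    (hw : ∀ i, 0 ≤ (w i).re) (ha : Summable fun i => ‖a i‖) :
    Tendsto (fun ε : ℝ => ∑' i, laplaceTransform φ (ε * w i) * a i) (𝓝[>] 0)
      (𝓝 (((∫ x, φ x : ℝ) : ℂ) * ∑' i, a i)) := by
  rw [← tsum_mul_left]
  refine tendsto_tsum_of_dominated_convergence (bound := fun i => (∫ x, φ x) * ‖a i‖)
    (ha.mul_left _) (fun i => ?_) ?_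
  · rw [← laplaceTransform_zero]
    refine Tendsto.mul_const _ (Tendsto.mono_left ?_ nhdsWithin_le_nhds)
    have : Continuous fun ε : ℝ => laplaceTransform φ (ε * w i) :=
      (continuous_laplaceTransform hcont hc).comp (by fun_prop)
    simpa using this.tendsto 0
  · filter_upwards [self_mem_nhdsWithin] with ε hε i
    rw [norm_mul]
    refine mul_le_mul_of_nonneg_right ?_ (norm_nonneg _)
    refine norm_laplaceTransform_le hcont hc hφ hnn ?_
    rw [Complex.re_ofReal_mul]
    exact mul_nonneg (le_of_lt hε) (hw i)

theorem summable_norm_one_div_sub_two_pow {A : Set ℕ} {u : ℕ → ℂ} (hu : ∀ k ∈ A, (u k).re ≤ 1)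
    (husum : Summable fun k : A => 1 / (1 + ‖u k‖ ^ 2)) (r : ℕ) :
    Summable fun k : A => ‖1 / (u k - 2) ^ (2 + r)‖ := by
  refine Summable.of_nonneg_of_le (fun _ => norm_nonneg _) (fun k => ?_) (husum.mul_left 10)
  have hk := hu k k.2
  have h1 : 1 ≤ ‖u k - 2‖ := by
    have := (abs_le.mp (Complex.abs_re_le_norm (u k - 2))).1
    simp at this
    linarith
  have h2 : ‖u k‖ ≤ ‖u k - 2‖ + 2 := by
    simpa using norm_add_le (u k - 2) 2
  rw [norm_div, norm_one, norm_pow, mul_one_div, div_le_div_iff₀ (by positivity) (by positivity)]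
  have h3 : ‖u k - 2‖ ^ 2 ≤ ‖u k - 2‖ ^ (2 + r) := pow_le_pow_right₀ h1 (by omega)
  nlinarith [norm_nonneg (u k)]

/-- With the hypotheses of the matching theorem (families in the strip `0 ≤ Re z ≤ 1`,
square-summability, and equality of the sums `Σ ∫₀^∞ α(s) e^{s u_k} ds` for all smooth `α`
compactly supported in `(0,∞)`), one deduces for every `r : ℕ` the moment identity
`Σ_{k∈A} 1/(u_k − 2)^{2+r} = Σ_{l∈B} 1/(v_l − 2)^{2+r}`, both series being absolutely
convergent. -/
theorem statement10 (A B : Set ℕ) (u v : ℕ → ℂ)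
    (hu : ∀ k ∈ A, 0 ≤ (u k).re ∧ (u k).re ≤ 1)
    (hv : ∀ l ∈ B, 0 ≤ (v l).re ∧ (v l).re ≤ 1)
    (husum : Summable fun k : A => 1 / (1 + ‖u k‖ ^ 2))
    (hvsum : Summable fun l : B => 1 / (1 + ‖v l‖ ^ 2))
    (h : ∀ α : ℝ → ℝ, ContDiff ℝ (⊤ : ℕ∞) α → HasCompactSupport α →
      tsupport α ⊆ Ioi (0 : ℝ) →
      (Summable fun k : A => ∫ s in Ioi (0 : ℝ), (α s : ℂ) * Complex.exp (s * u k)) ∧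
      (Summable fun l : B => ∫ s in Ioi (0 : ℝ), (α s : ℂ) * Complex.exp (s * v l)) ∧
      ∑' k : A, ∫ s in Ioi (0 : ℝ), (α s : ℂ) * Complex.exp (s * u k) =
        ∑' l : B, ∫ s in Ioi (0 : ℝ), (α s : ℂ) * Complex.exp (s * v l)) :
    ∀ r : ℕ,
      (Summable fun k : A => ‖1 / (u k - 2) ^ (2 + r)‖) ∧
      (Summable fun l : B => ‖1 / (v l - 2) ^ (2 + r)‖) ∧
      ∑' k : A, 1 / (u k - 2) ^ (2 + r) = ∑' l : B, 1 / (v l - 2) ^ (2 + r) := by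
  have hu1 : ∀ k : A, 1 ≤ (2 - u k).re := fun k => by
    have := (hu k k.2).2
    simp only [Complex.sub_re, Complex.re_ofNat]
    linarith
  have hv1 : ∀ l : B, 1 ≤ (2 - v l).re := fun l => by
    have := (hv l l.2).2
    simp only [Complex.sub_re, Complex.re_ofNat]
    linarith
  intro r
  have hus := summable_norm_one_div_sub_two_pow (fun k hk => (hu k hk).2) husum r
  have hvs := summable_norm_one_div_sub_two_pow (fun l hl => (hv l hl).2) hvsum r
  refine ⟨hus, hvs, ?_⟩
  let φ : ContDiffBump (2 : ℝ) := ⟨1 / 2, 1, by norm_num, by norm_num⟩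
  have hφpos : tsupport φ ⊆ Ioi 0 := by
    rw [φ.tsupport_eq, Real.closedBall_eq_Icc]
    intro x hx
    have : (2 : ℝ) - 1 ≤ x := hx.1
    simp only [mem_Ioi]
    linarith
  have hφnn : ∀ x, 0 ≤ φ x := fun _ => φ.nonneg
  -- the regularised power sums agree for every scale
  have hreg : ∀ ε : ℝ, 0 < ε →
      ∑' k : A, laplaceTransform φ (ε * (2 - u k)) * (1 / (u k - 2) ^ (2 + r)) =
        ∑' l : B, laplaceTransform φ (ε * (2 - v l)) * (1 / (v l - 2) ^ (2 + r)) := by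
    intro ε hε
    have hεC : (ε : ℂ) ≠ 0 := by exact_mod_cast hε.ne'
    have htest : ∀ t : ℝ, 0 ≤ t →
        (Summable fun k : A =>
          Complex.exp (-t * (2 - u k)) * laplaceTransform φ (ε * (2 - u k))) ∧
        (Summable fun l : B =>
          Complex.exp (-t * (2 - v l)) * laplaceTransform φ (ε * (2 - v l))) ∧
        ∑' k : A, Complex.exp (-t * (2 - u k)) * laplaceTransform φ (ε * (2 - u k)) =
          ∑' l : B, Complex.exp (-t * (2 - v l)) * laplaceTransform φ (ε * (2 - v l)) := by
      intro t ht
      have hsub := tsupport_translate_dilate_subset (φ := φ) hε t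
      have := h _ (contDiff_translate_dilate φ.contDiff ε t)
        ((φ.hasCompactSupport.isCompact.image (by fun_prop)).of_isClosed_subset
          (isClosed_tsupport _) hsub)
        (hsub.trans (by
          rintro _ ⟨x, hx, rfl⟩
          have : 0 < x := hφpos hx
          simp only [mem_Ioi]
          positivity))
      simpa only [setIntegral_Ioi_translate_dilate φ hφpos hε ht, summable_mul_left_iff hεC,
        tsum_mul_left, mul_right_inj' hεC] using this
    have h0 := htest 0 le_rfl
    simp only [Complex.ofReal_zero, neg_zero, zero_mul, Complex.exp_zero, one_mul] at h0
    have hA := tsum_mul_div_pow_eq_integral (r + 1) hu1 h0.1.norm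
    have hB := tsum_mul_div_pow_eq_integral (r + 1) hv1 h0.2.1.norm
    have hAB := hA.trans ((setIntegral_congr_fun measurableSet_Ioi fun t ht => by
      simp only [(htest t (le_of_lt ht)).2.2]).trans hB.symm)
    have hconv : ∀ c z : ℂ, c * (1 / (z - 2) ^ (2 + r)) =
        ((-1) ^ (2 + r) / ((r + 1).factorial : ℂ)) *
          (c * ((r + 1).factorial / (2 - z) ^ (r + 1 + 1))) := by
      intro c z
      have hf : ((r + 1).factorial : ℂ) ≠ 0 := by exact_mod_cast (r + 1).factorial_ne_zero
      have hz : (z - 2) ^ (2 + r) = (-1) ^ (2 + r) * (2 - z) ^ (r + 1 + 1) := by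
        rw [show r + 1 + 1 = 2 + r by ring, ← mul_pow]
        ring
      have hs : ((-1 : ℂ) ^ (2 + r)) * (-1) ^ (2 + r) = 1 := by
        rw [← mul_pow]
        simp
      have hs' : ((-1 : ℂ) ^ (2 + r))⁻¹ = (-1) ^ (2 + r) := inv_eq_of_mul_eq_one_left hs
      rw [hz, one_div, mul_inv, hs']
      field_simp
    simp only [hconv _ (u _), hconv _ (v _), tsum_mul_left, hAB]
  have hφint : ((∫ x, φ x : ℝ) : ℂ) ≠ 0 := by exact_mod_cast φ.integral_pos.ne'
  have hlimA := tendsto_tsum_laplaceTransform_mul φ.continuous φ.hasCompactSupport hφpos hφnn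
    (fun k => zero_le_one.trans (hu1 k)) hus
  have hlimB := tendsto_tsum_laplaceTransform_mul φ.continuous φ.hasCompactSupport hφpos hφnn
    (fun l => zero_le_one.trans (hv1 l)) hvs
  refine mul_left_cancel₀ hφint (tendsto_nhds_unique hlimA (hlimB.congr' ?_))
  filter_upwards [self_mem_nhdsWithin] with ε hε
  exact (hreg ε hε).symm
end

section
/- Let A and B be subsets of ℕ and let (u_k)_{k∈A} and (v_l)_{l∈B} be two families of complex numbers lying in the closed strip {z ∈ ℂ : 0 ≤ Re z ≤ 1} with Σ_{k∈A} 1/(1 + |u_k|²) + Σ_{l∈B} 1/(1 + |v_l|²) < ∞. Assume that for every natural number r ≥ 0, Σ_{k∈A} 1/(u_k − 2)^{2+r} = Σ_{l∈B} 1/(v_l − 2)^{2+r}. Then there exists a bijection ξ : A → B such that u_k = v_{ξ(k)} for every k ∈ A. -/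
open Complex Set Filter

/-- A weight on `ℂ` whose support accumulates only at `0` and whose moments all vanish is
zero away from the origin. -/
theorem eq_zero_of_hasSum_mul_pow_eq_zero (e : ℂ → ℂ)
    (hfin : ∀ r : ℝ, 0 < r → {w | e w ≠ 0 ∧ r ≤ ‖w‖}.Finite)
    (hsum : ∀ n : ℕ, HasSum (fun w => e w * w ^ n) 0) {w : ℂ} (hw : w ≠ 0) : e w = 0 := by
  classical
  by_contra hew
  have hpoly : ∀ P : Polynomial ℂ, HasSum (fun z => e z * P.eval z) 0 := by
    intro P
    induction P using Polynomial.induction_on' with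
    | add p q hp hq => simpa [mul_add] using hp.add hq
    | monomial n a => simpa [mul_left_comm] using (hsum n).mul_left a
  obtain ⟨w₀, ⟨hew₀, hle₀⟩, hmax⟩ := Set.exists_max_image _ (fun z : ℂ => ‖z‖)
    (hfin ‖w‖ (norm_pos_iff.2 hw)) ⟨w, hew, le_rfl⟩
  have hpos : 0 < ‖w₀‖ := (norm_pos_iff.2 hw).trans_le hle₀
  have hw₀ : w₀ ≠ 0 := norm_pos_iff.1 hpos
  have hmax' : ∀ z, e z ≠ 0 → ‖z‖ ≤ ‖w₀‖ := by
    intro z hz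
    by_contra! hlt
    exact absurd (hmax z ⟨hz, hle₀.trans hlt.le⟩) (not_le.2 hlt)
  let S : Finset ℂ := (hfin ‖w₀‖ hpos).toFinset.erase w₀
  let Q : Polynomial ℂ := ∏ s ∈ S, (Polynomial.X - Polynomial.C s)
  have hQ₀ : Q.eval w₀ ≠ 0 := by
    simp only [Q, Polynomial.eval_prod, Polynomial.eval_sub, Polynomial.eval_X,
      Polynomial.eval_C]
    exact Finset.prod_ne_zero_iff.2 fun s hs => sub_ne_zero.2 (Finset.ne_of_mem_erase hs).symm
  have hQ : ∀ z, e z ≠ 0 → ‖w₀‖ ≤ ‖z‖ → z ≠ w₀ → Q.eval z = 0 := by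
    intro z hz hle hne
    simp only [Q, Polynomial.eval_prod, Polynomial.eval_sub, Polynomial.eval_X,
      Polynomial.eval_C]
    exact Finset.prod_eq_zero (i := z) (by simp [S, hz, hle, hne]) (sub_self z)
  have hlim : Tendsto (fun n : ℕ => ∑' z, e z * Q.eval z * (z / w₀) ^ n) atTop
      (nhds (∑' z, if z = w₀ then e w₀ * Q.eval w₀ else 0)) := by
    refine tendsto_tsum_of_dominated_convergence (bound := fun z => ‖e z * Q.eval z‖)
      (hpoly Q).summable.norm ?_ (Eventually.of_forall ?_)
    · intro z
      split_ifs with hz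
      · subst hz
        simp [hw₀]
      · by_cases hez : e z = 0
        · simp [hez]
        by_cases hlt : ‖z‖ < ‖w₀‖
        · have h1 : ‖z / w₀‖ < 1 := by rwa [norm_div, div_lt_one hpos]
          simpa using (tendsto_pow_atTop_nhds_zero_of_norm_lt_one h1).const_mul
            (e z * Q.eval z)
        · simp [hQ z hez (not_lt.1 hlt) hz]
    · intro n z
      by_cases hez : e z = 0
      · simp [hez]
      · rw [norm_mul, norm_pow]
        refine mul_le_of_le_one_right (norm_nonneg _) (pow_le_one₀ (norm_nonneg _) ?_)
        rw [norm_div]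
        exact div_le_one_of_le₀ (hmax' z hez) (norm_nonneg _)
  have hzero : ∀ n : ℕ, ∑' z, e z * Q.eval z * (z / w₀) ^ n = 0 := by
    intro n
    have := ((hpoly (Q * Polynomial.X ^ n)).mul_right ((w₀ ^ n)⁻¹)).tsum_eq
    simpa [div_pow, div_eq_mul_inv, mul_pow, mul_assoc] using this
  simp only [hzero, tsum_ite_eq] at hlim
  exact mul_ne_zero hew₀ hQ₀ (tendsto_nhds_unique hlim tendsto_const_nhds)

theorem finite_le_norm_of_summable_norm_sq {α : Type*} {g : α → ℂ}
    (hg : Summable fun k => ‖g k‖ ^ 2) {r : ℝ} (hr : 0 < r) : {k | r ≤ ‖g k‖}.Finite := by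
  have := hg.tendsto_cofinite_zero.eventually (gt_mem_nhds (pow_pos hr 2))
  refine (eventually_cofinite.1 this).subset fun k hk => ?_
  simpa using pow_le_pow_left₀ hr.le hk 2

theorem summable_pow_of_summable_norm_sq {α : Type*} {g : α → ℂ}
    (hg : Summable fun k => ‖g k‖ ^ 2) (n : ℕ) : Summable fun k => g k ^ (2 + n) := by
  refine Summable.of_norm_bounded_eventually hg ?_
  refine (finite_le_norm_of_summable_norm_sq hg one_pos).subset fun k hk => ?_
  by_contra hlt
  refine hk ?_
  rw [Set.mem_ofPred_eq, norm_pow]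
  exact pow_le_pow_of_le_one (norm_nonneg _) (not_le.1 hlt).le (by omega)

theorem hasSum_card_fiber_mul_pow {α : Type*} {g : α → ℂ}
    (hg : Summable fun k => ‖g k‖ ^ 2) (n : ℕ) :
    HasSum (fun w => (Nat.card (g ⁻¹' {w}) : ℂ) * w ^ (2 + n)) (∑' k, g k ^ (2 + n)) := by
  have hfiber : (fun w : ℂ => (Nat.card (g ⁻¹' {w}) : ℂ) * w ^ (2 + n)) =
      fun w => ∑' k : g ⁻¹' {w}, g k ^ (2 + n) := by
    funext w
    have hconst : ∀ k : g ⁻¹' {w}, g k ^ (2 + n) = w ^ (2 + n) := fun k =>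
      congrArg (· ^ (2 + n)) k.2
    simp only [hconst, tsum_const, nsmul_eq_mul]
  rw [hfiber]
  exact (summable_pow_of_summable_norm_sq hg n).hasSum.tsum_fiberwise g

/-- Two square-summable families of nonzero complex numbers with the same power sums of every
order at least two agree up to reindexing. -/
theorem exists_equiv_of_tsum_pow_eq {α β : Type*} {f : α → ℂ} {g : β → ℂ}
    (hf₀ : ∀ k, f k ≠ 0) (hg₀ : ∀ l, g l ≠ 0)
    (hf : Summable fun k => ‖f k‖ ^ 2) (hg : Summable fun l => ‖g l‖ ^ 2)
    (h : ∀ n : ℕ, ∑' k, f k ^ (2 + n) = ∑' l, g l ^ (2 + n)) :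
    ∃ ξ : α ≃ β, ∀ k, f k = g (ξ k) := by
  have hcard : ∀ w : ℂ, w ≠ 0 → Nat.card (f ⁻¹' {w}) = Nat.card (g ⁻¹' {w}) := by
    intro w hw
    have key := eq_zero_of_hasSum_mul_pow_eq_zero
      (fun z => ((Nat.card (f ⁻¹' {z}) : ℂ) - Nat.card (g ⁻¹' {z})) * z ^ 2) ?_ ?_ hw
    · simpa [hw, sub_eq_zero] using key
    · intro r hr
      refine (((finite_le_norm_of_summable_norm_sq hf hr).image f).union
        ((finite_le_norm_of_summable_norm_sq hg hr).image g)).subset ?_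
      rintro z ⟨hz, hrz⟩
      by_contra hmem
      simp only [Set.mem_union, Set.mem_image, Set.mem_ofPred_eq, not_or, not_exists,
        not_and] at hmem
      have hfz : f ⁻¹' {z} = ∅ := Set.eq_empty_of_forall_notMem fun k hk =>
        hmem.1 k (by rwa [show f k = z from hk]) hk
      have hgz : g ⁻¹' {z} = ∅ := Set.eq_empty_of_forall_notMem fun k hk =>
        hmem.2 k (by rwa [show g k = z from hk]) hk
      simp [hfz, hgz] at hz
    · intro n
      have := (hasSum_card_fiber_mul_pow hf n).sub (hasSum_card_fiber_mul_pow hg n)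
      rw [h n, sub_self] at this
      simpa only [sub_mul, mul_assoc, ← pow_add] using this
  have hequiv : ∀ w : ℂ, Nonempty ({k // f k = w} ≃ {l // g l = w}) := by
    intro w
    by_cases hw : w = 0
    · subst hw
      have : IsEmpty {k // f k = 0} := ⟨fun k => hf₀ k k.2⟩
      have : IsEmpty {l // g l = 0} := ⟨fun l => hg₀ l l.2⟩
      exact ⟨Equiv.equivOfIsEmpty _ _⟩
    · have hpos := norm_pos_iff.2 hw
      have : Finite {k // f k = w} :=
        ((finite_le_norm_of_summable_norm_sq hf hpos).subset
          fun k (hk : f k = w) => (congrArg norm hk).ge)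
      have : Finite {l // g l = w} :=
        ((finite_le_norm_of_summable_norm_sq hg hpos).subset
          fun l (hl : g l = w) => (congrArg norm hl).ge)
      exact (Finite.card_eq).1 (hcard w hw)
  have E := fun w => (hequiv w).some
  exact ⟨Equiv.ofFiberEquiv E, fun k => (Equiv.ofFiberEquiv_map E k).symm⟩

theorem sub_two_ne_zero_of_re_le_one {z : ℂ} (hz : z.re ≤ 1) : z - 2 ≠ 0 := by
  intro h
  have := congrArg Complex.re h
  simp at this
  linarith

theorem one_add_norm_sq_le_of_re_le_one {z : ℂ} (hz : z.re ≤ 1) :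
    1 + ‖z‖ ^ 2 ≤ 2 * ‖z - 2‖ ^ 2 := by
  rw [Complex.sq_norm, Complex.sq_norm, Complex.normSq_apply, Complex.normSq_apply]
  simp
  nlinarith [mul_self_nonneg z.im]

theorem summable_norm_inv_sub_two_sq {ι : Type*} {z : ι → ℂ}
    (hz : ∀ k, (z k).re ≤ 1)
    (hsum : Summable fun k => 1 / (1 + ‖z k‖ ^ 2)) :
    Summable fun k => ‖(z k - 2)⁻¹‖ ^ 2 := by
  refine (hsum.mul_left 2).of_nonneg_of_le (fun k => by positivity) fun k => ?_
  have hpos : 0 < ‖z k - 2‖ := norm_pos_iff.2 (sub_two_ne_zero_of_re_le_one (hz k))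
  rw [norm_inv, inv_pow, mul_one_div, inv_eq_one_div, div_le_div_iff₀ (by positivity)
    (by positivity), one_mul]
  exact one_add_norm_sq_le_of_re_le_one (hz k)

/-- Let `(u_k)_{k∈A}` and `(v_l)_{l∈B}` be families of complex numbers in the closed strip
`0 ≤ Re z ≤ 1` with `Σ 1/(1+|u_k|²) + Σ 1/(1+|v_l|²) < ∞`. If for every `r : ℕ` one has
`Σ_{k∈A} 1/(u_k − 2)^{2+r} = Σ_{l∈B} 1/(v_l − 2)^{2+r}`, then there is a bijection
`ξ : A → B` with `u_k = v_{ξ(k)}` for all `k ∈ A`. -/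
theorem statement11 (A B : Set ℕ) (u v : ℕ → ℂ)
    (hu : ∀ k ∈ A, 0 ≤ (u k).re ∧ (u k).re ≤ 1)
    (hv : ∀ l ∈ B, 0 ≤ (v l).re ∧ (v l).re ≤ 1)
    (husum : Summable fun k : A => 1 / (1 + ‖u k‖ ^ 2))
    (hvsum : Summable fun l : B => 1 / (1 + ‖v l‖ ^ 2))
    (h : ∀ r : ℕ,
      ∑' k : A, 1 / (u k - 2) ^ (2 + r) = ∑' l : B, 1 / (v l - 2) ^ (2 + r)) :
    ∃ ξ : A ≃ B, ∀ k : A, u k = v (ξ k) := by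
  obtain ⟨ξ, hξ⟩ := exists_equiv_of_tsum_pow_eq
    (f := fun k : A => (u k - 2)⁻¹) (g := fun l : B => (v l - 2)⁻¹)
    (fun k => inv_ne_zero (sub_two_ne_zero_of_re_le_one (hu k k.2).2))
    (fun l => inv_ne_zero (sub_two_ne_zero_of_re_le_one (hv l l.2).2))
    (summable_norm_inv_sub_two_sq (fun k : A => (hu k k.2).2) husum)
    (summable_norm_inv_sub_two_sq (fun l : B => (hv l l.2).2) hvsum)
    (fun n => by simpa only [inv_pow, one_div] using h n)
  exact ⟨ξ, fun k => sub_left_injective (inv_injective (hξ k))⟩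
end
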